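/- Let (p,u,U) be a smooth solution of the incompressible Navier-Stokes equations on [0,T_0]×T^3 and let (p^{ε,δ},u^{ε,δ},U^{ε,δ}) solve the two-parameter relaxation system with smooth initial data. Define the rescaled residuals v = u^{ε,δ} − u, q = √ε (p^{ε,δ} − p), V = √δ (U^{ε,δ} − U), W = (q,v,V), and the energy E(t) = ‖W(t,·)‖²_{L²(T³)} + (ε+δ)^a ‖∇²W(t,·)‖²_{L²(T³)} with a ∈ [0,4/3). Then there is a constant C > 0, depending only on (p,u,U) and the domain T³, such that for all sufficiently small ε+δ and all t at which both solutions exist, (d/dt)E(t) ≤ C ( √((ε+δ)E(t)) + E(t) + (ε+δ)^{−3a/4} E(t)² ). -/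

import Mathlib

/-!
Common setup: fields on the torus `𝕋^d = ℝ^d/ℤ^d` are modelled as `ℤ^d`-periodic
functions on `ℝ^d`; all integrals are taken over the fundamental cell `[0,1]^d`.
-/

noncomputable section
open MeasureTheory Real
open scoped ENNReal

namespace NSRelax

/-- Spatial variable; fields on the torus are `ℤ^d`-periodic functions on `ℝ^d`. -/
abbrev Spc (d : ℕ) := Fin d → ℝ

/-- Vectors in `ℝ^m`. -/
abbrev Vec (m : ℕ) := Fin m → ℝ

/-- Fundamental cell `[0,1]^d` of the torus. -/
def cube (d : ℕ) : Set (Spc d) := Set.pi Set.univ fun _ => Set.Icc (0 : ℝ) 1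

/-- `ℤ^d`-periodicity. -/
def Per {d : ℕ} {E : Type*} (f : Spc d → E) : Prop :=
  ∀ (x : Spc d) (k : Fin d → ℤ), f (fun i => x i + (k i : ℝ)) = f x

/-- `i`-th spatial partial derivative of a scalar field. -/
def pd {d : ℕ} (i : Fin d) (f : Spc d → ℝ) (x : Spc d) : ℝ :=
  fderiv ℝ f x (Pi.single i 1)

/-- Time derivative of a time-dependent scalar field. -/
def dtS {d : ℕ} (p : ℝ → Spc d → ℝ) (t : ℝ) (x : Spc d) : ℝ :=
  deriv (fun s => p s x) t

/-- Time derivative of a time-dependent vector field. -/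
def dtV {d m : ℕ} (u : ℝ → Spc d → Vec m) (t : ℝ) (x : Spc d) : Vec m :=
  fun a => deriv (fun s => u s x a) t

/-- Time derivative of a time-dependent matrix field. -/
def dtM {d m : ℕ} (U : ℝ → Spc d → Fin m → Fin m → ℝ) (t : ℝ) (x : Spc d) :
    Fin m → Fin m → ℝ :=
  fun i j => deriv (fun s => U s x i j) t

section Norms

variable {d : ℕ} {ι : Type*} [Fintype ι]

/-- Pointwise squared Euclidean magnitude of an `ι`-indexed field. -/
def ptsq (v : Spc d → ι → ℝ) (x : Spc d) : ℝ := ∑ a, v x a ^ 2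

/-- Pointwise squared magnitude of the first derivatives. -/
def ptsqD1 (v : Spc d → ι → ℝ) (x : Spc d) : ℝ :=
  ∑ a, ∑ i, pd i (fun y => v y a) x ^ 2

/-- Pointwise squared magnitude of the second derivatives. -/
def ptsqD2 (v : Spc d → ι → ℝ) (x : Spc d) : ℝ :=
  ∑ a, ∑ i, ∑ j, pd i (pd j (fun y => v y a)) x ^ 2

/-- Pointwise squared magnitude of the third derivatives. -/
def ptsqD3 (v : Spc d → ι → ℝ) (x : Spc d) : ℝ :=
  ∑ a, ∑ i, ∑ j, ∑ k, pd i (pd j (pd k (fun y => v y a))) x ^ 2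

/-- Squared `L²(𝕋^d)` norm. -/
def L2sq (v : Spc d → ι → ℝ) : ℝ := ∫ x in cube d, ptsq v x

/-- Squared `L²(𝕋^d)` norm of the gradient. -/
def D1L2sq (v : Spc d → ι → ℝ) : ℝ := ∫ x in cube d, ptsqD1 v x

/-- Squared `L²(𝕋^d)` norm of the second derivatives. -/
def D2L2sq (v : Spc d → ι → ℝ) : ℝ := ∫ x in cube d, ptsqD2 v x

/-- Squared `L²(𝕋^d)` norm of the third derivatives. -/
def D3L2sq (v : Spc d → ι → ℝ) : ℝ := ∫ x in cube d, ptsqD3 v x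

/-- Squared `H¹(𝕋^d)` norm. -/
def H1sq (v : Spc d → ι → ℝ) : ℝ := L2sq v + D1L2sq v

/-- Squared `H²(𝕋^d)` norm. -/
def H2sq (v : Spc d → ι → ℝ) : ℝ := L2sq v + D1L2sq v + D2L2sq v

/-- Squared `H³(𝕋^d)` norm. -/
def H3sq (v : Spc d → ι → ℝ) : ℝ := L2sq v + D1L2sq v + D2L2sq v + D3L2sq v

/-- `L^p(𝕋^d)` norm. -/
def LpN (p : ℝ) (v : Spc d → ι → ℝ) : ℝ :=
  (∫ x in cube d, Real.sqrt (ptsq v x) ^ p) ^ (1 / p)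

/-- `L^∞(𝕋^d)` norm (for continuous periodic fields). -/
def LinfN (v : Spc d → ι → ℝ) : ℝ := ⨆ x : Spc d, Real.sqrt (ptsq v x)

end Norms

/-- View a scalar field as a one-component indexed field. -/
def sc {d : ℕ} (f : Spc d → ℝ) : Spc d → Vec 1 := fun x _ => f x

/-- View a matrix field as an indexed field. -/
def mtx {d m : ℕ} (U : Spc d → Fin m → Fin m → ℝ) : Spc d → Fin m × Fin m → ℝ :=
  fun x ij => U x ij.1 ij.2

/-- Divergence of a vector field. -/
def divv {d : ℕ} (v : Spc d → Vec d) (x : Spc d) : ℝ := ∑ i, pd i (fun y => v y i) x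

/-- Row-wise divergence of a matrix field. -/
def divM {d : ℕ} (U : Spc d → Fin d → Fin d → ℝ) (x : Spc d) : Vec d :=
  fun i => ∑ j, pd j (fun y => U y i j) x

/-- Laplacian of a scalar field. -/
def lapS {d : ℕ} (f : Spc d → ℝ) (x : Spc d) : ℝ := ∑ i, pd i (pd i f) x

/-- Componentwise Laplacian of a vector field. -/
def lapV {d m : ℕ} (v : Spc d → Vec m) (x : Spc d) : Vec m :=
  fun a => lapS (fun y => v y a) x

/-- Tensor product `u ⊗ v` of vector fields. -/
def tens {d : ℕ} (u v : Spc d → Vec d) (x : Spc d) : Fin d → Fin d → ℝ :=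
  fun i j => u x i * v x j

/-- Curl of a three-dimensional vector field. -/
def curl3 (v : Spc 3 → Vec 3) (x : Spc 3) : Vec 3 :=
  ![pd 1 (fun y => v y 2) x - pd 2 (fun y => v y 1) x,
    pd 2 (fun y => v y 0) x - pd 0 (fun y => v y 2) x,
    pd 0 (fun y => v y 1) x - pd 1 (fun y => v y 0) x]

/-- Scalar curl of a planar vector field. -/
def curl2 (v : Spc 2 → Vec 2) (x : Spc 2) : ℝ :=
  pd 0 (fun y => v y 1) x - pd 1 (fun y => v y 0) x

/-- Smoothness (jointly in time and space) of a scalar field. -/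
def SmoothS {d : ℕ} (p : ℝ → Spc d → ℝ) : Prop :=
  ContDiff ℝ (⊤ : ℕ∞) fun q : ℝ × Spc d => p q.1 q.2

/-- Smoothness (jointly in time and space) of a vector field. -/
def SmoothV {d m : ℕ} (u : ℝ → Spc d → Vec m) : Prop :=
  ContDiff ℝ (⊤ : ℕ∞) fun q : ℝ × Spc d => u q.1 q.2

/-- Smoothness (jointly in time and space) of a matrix field. -/
def SmoothM {d m : ℕ} (U : ℝ → Spc d → Fin m → Fin m → ℝ) : Prop :=
  ContDiff ℝ (⊤ : ℕ∞) fun q : ℝ × Spc d => U q.1 q.2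

/-- Stress tensor `U = u ⊗ u − ∇u` of a Navier–Stokes solution. -/
def stress {d : ℕ} (u : ℝ → Spc d → Vec d) (t : ℝ) (x : Spc d) : Fin d → Fin d → ℝ :=
  fun i j => u t x i * u t x j - pd j (fun y => u t y i) x

/-- Smooth solution of the incompressible Navier–Stokes equations on the time set `I`. -/
structure IsNS (d : ℕ) (I : Set ℝ) (p : ℝ → Spc d → ℝ) (u : ℝ → Spc d → Vec d) :
    Prop where
  smooth_p : SmoothS p
  smooth_u : SmoothV u
  per_p : ∀ t, Per (p t)
  per_u : ∀ t, Per (u t)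
  div_free : ∀ t ∈ I, ∀ x, divv (u t) x = 0
  momentum : ∀ t ∈ I, ∀ x a,
    dtV u t x a + divM (tens (u t) (u t)) x a = -pd a (p t) x + lapV (u t) x a
  mean_zero : ∀ t ∈ I, ∫ x in cube d, p t x = 0

/-- The time interval `[0, Tl)`. -/
def Itv (Tl : ℝ≥0∞) : Set ℝ := {t : ℝ | 0 ≤ t ∧ ENNReal.ofReal t < Tl}

/-- Solution of the two-parameter relaxation system on the time interval `[0, Tl)`,
with smooth initial data. -/
structure IsRelax (d : ℕ) (ε δ : ℝ) (Tl : ℝ≥0∞) (p : ℝ → Spc d → ℝ)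
    (u : ℝ → Spc d → Vec d) (U : ℝ → Spc d → Fin d → Fin d → ℝ) : Prop where
  pos : 0 < Tl
  init_smooth : ContDiff ℝ (⊤ : ℕ∞) fun x : Spc d => (p 0 x, u 0 x, U 0 x)
  per_p : ∀ t ∈ Itv Tl, Per (p t)
  per_u : ∀ t ∈ Itv Tl, Per (u t)
  per_U : ∀ t ∈ Itv Tl, Per (U t)
  cont : ContinuousOn (fun q : ℝ × Spc d => (p q.1 q.2, u q.1 q.2, U q.1 q.2))
    (Itv Tl ×ˢ (Set.univ : Set (Spc d)))
  smooth : ∀ t ∈ Itv Tl, 0 < t → ∀ x : Spc d,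
    ContDiffAt ℝ (⊤ : ℕ∞) (fun q : ℝ × Spc d => (p q.1 q.2, u q.1 q.2, U q.1 q.2)) (t, x)
  mass : ∀ t ∈ Itv Tl, 0 < t → ∀ x, ε * dtS p t x + divv (u t) x = 0
  momentum : ∀ t ∈ Itv Tl, 0 < t → ∀ x a,
    dtV u t x a + divM (U t) x a + pd a (p t) x = 0
  stress_eq : ∀ t ∈ Itv Tl, 0 < t → ∀ x i j,
    δ * dtM U t x i j + pd j (fun y => u t y i) x = u t x i * u t x j - U t x i j

/-- Relaxation solution whose lifespan `Tl` is maximal (among solutions with the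
same initial data). -/
def IsMaxRelax (d : ℕ) (ε δ : ℝ) (Tl : ℝ≥0∞) (p : ℝ → Spc d → ℝ)
    (u : ℝ → Spc d → Vec d) (U : ℝ → Spc d → Fin d → Fin d → ℝ) : Prop :=
  IsRelax d ε δ Tl p u U ∧
    ∀ (Tl' : ℝ≥0∞) (p' : ℝ → Spc d → ℝ) (u' : ℝ → Spc d → Vec d)
      (U' : ℝ → Spc d → Fin d → Fin d → ℝ),
      IsRelax d ε δ Tl' p' u' U' → p' 0 = p 0 → u' 0 = u 0 → U' 0 = U 0 → Tl' ≤ Tl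

/-- Smooth solution of the intermediate affine system on `[0,T]`. -/
structure IsAffine (ε δ T : ℝ) (u : ℝ → Spc 3 → Vec 3) (p' : ℝ → Spc 3 → ℝ)
    (u' : ℝ → Spc 3 → Vec 3) (U' : ℝ → Spc 3 → Fin 3 → Fin 3 → ℝ) : Prop where
  smooth_p : SmoothS p'
  smooth_u : SmoothV u'
  smooth_U : SmoothM U'
  per_p : ∀ t, Per (p' t)
  per_u : ∀ t, Per (u' t)
  per_U : ∀ t, Per (U' t)
  mass : ∀ t ∈ Set.Icc (0 : ℝ) T, ∀ x, ε * dtS p' t x + divv (u' t) x = 0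
  momentum : ∀ t ∈ Set.Icc (0 : ℝ) T, ∀ x a,
    dtV u' t x a + divM (U' t) x a + pd a (p' t) x = 0
  stress_eq : ∀ t ∈ Set.Icc (0 : ℝ) T, ∀ x i j,
    δ * dtM U' t x i j + pd j (fun y => u' t y i) x = u t x i * u t x j - U' t x i j

/-- `A = curl ∇·(v ⊗ v)`. -/
def Af (v : Spc 3 → Vec 3) (x : Spc 3) : Vec 3 :=
  curl3 (fun y => divM (tens v v) y) x

/-- `K = 1 + ‖(p,u,U)‖²_{C⁰H³}`. -/
def Kc (T0 : ℝ) (p : ℝ → Spc 3 → ℝ) (u : ℝ → Spc 3 → Vec 3) : ℝ :=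
  1 + ⨆ t ∈ Set.Icc (0 : ℝ) T0, (H3sq (sc (p t)) + H3sq (u t) + H3sq (mtx (stress u t)))

/-- `K = 1 + ‖u‖²_{C⁰H³}`. -/
def Ku (T0 : ℝ) (u : ℝ → Spc 3 → Vec 3) : ℝ :=
  1 + ⨆ t ∈ Set.Icc (0 : ℝ) T0, H3sq (u t)

/-- The energy `E(t) = ‖W(t,·)‖²_{L²} + (ε+δ)^a ‖∇²W(t,·)‖²_{L²}` of the rescaled
residual `W = (q, v, V) = (√ε(p^{ε,δ}−p), u^{ε,δ}−u, √δ(U^{ε,δ}−U))`. -/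
def resEnergyL2 (a ε δ : ℝ) (p : ℝ → Spc 3 → ℝ) (u : ℝ → Spc 3 → Vec 3)
    (pe : ℝ → Spc 3 → ℝ) (ue : ℝ → Spc 3 → Vec 3)
    (Ue : ℝ → Spc 3 → Fin 3 → Fin 3 → ℝ) (t : ℝ) : ℝ :=
  (L2sq (sc fun x => Real.sqrt ε * (pe t x - p t x))
      + L2sq (fun x (b : Fin 3) => ue t x b - u t x b)
      + L2sq (mtx fun x i j => Real.sqrt δ * (Ue t x i j - stress u t x i j)))
    + (ε + δ) ^ a *
      (D2L2sq (sc fun x => Real.sqrt ε * (pe t x - p t x))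
        + D2L2sq (fun x (b : Fin 3) => ue t x b - u t x b)
        + D2L2sq (mtx fun x i j => Real.sqrt δ * (Ue t x i j - stress u t x i j)))

section TorusAlgebra

open Set Filter Topology

/-- The algebra of smooth `ℤ³`-periodic scalar functions on `ℝ³`. -/
def torusAlg : Subalgebra ℝ (Spc 3 → ℝ) where
  carrier := {f | ContDiff ℝ (⊤ : ℕ∞) f ∧ Per f}
  mul_mem' := fun {f g} hf hg => ⟨hf.1.mul hg.1, fun x k => by
    simp only [Pi.mul_apply, hf.2 x k, hg.2 x k]⟩
  add_mem' := fun {f g} hf hg => ⟨hf.1.add hg.1, fun x k => by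
    simp only [Pi.add_apply, hf.2 x k, hg.2 x k]⟩
  algebraMap_mem' := fun _ => ⟨contDiff_const, fun _ _ => rfl⟩

/-- Smooth periodic scalar functions on `ℝ³`. -/
abbrev TF := ↥torusAlg

theorem TF.contDiff (f : TF) : ContDiff ℝ (⊤ : ℕ∞) f.1 := f.2.1

theorem TF.continuous (f : TF) : Continuous f.1 := f.contDiff.continuous

theorem TF.differentiableAt (f : TF) (x : Spc 3) : DifferentiableAt ℝ f.1 x :=
  (f.contDiff.differentiable (by simp)).differentiableAt

theorem TF.sum_apply {ι : Type*} (s : Finset ι) (f : ι → TF) (x : Spc 3) :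
    (∑ i ∈ s, f i).1 x = ∑ i ∈ s, (f i).1 x := by
  have h : (∑ i ∈ s, f i).1 = ∑ i ∈ s, (f i).1 := map_sum torusAlg.val f s
  rw [h, Finset.sum_apply]

theorem pd_mem (i : Fin 3) {f : Spc 3 → ℝ} (hf : f ∈ torusAlg) : pd i f ∈ torusAlg := by
  refine ⟨?_, fun x k => ?_⟩
  · exact (hf.1.fderiv_right (m := (⊤ : ℕ∞)) (by simp)).clm_apply contDiff_const
  · have h : (fun y : Spc 3 => f (y + fun i => (k i : ℝ))) = f := funext fun y => hf.2 y k
    have h2 := fderiv_comp_add_right (𝕜 := ℝ) (f := f) (x := x) (fun i => (k i : ℝ))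
    rw [h] at h2
    simp only [pd]
    rw [h2]
    rfl

/-- The partial derivative as a derivation of the algebra of smooth periodic functions. -/
def dx (i : Fin 3) : Derivation ℝ TF TF :=
  Derivation.mk'
    { toFun := fun f => ⟨pd i f.1, pd_mem i f.2⟩
      map_add' := fun f g => Subtype.ext <| funext fun x => by
        change fderiv ℝ (f.1 + g.1) x _ = _
        rw [fderiv_add (f.differentiableAt x) (g.differentiableAt x)]
        rfl
      map_smul' := fun c f => Subtype.ext <| funext fun x => by
        change fderiv ℝ (c • f.1) x _ = _
        rw [fderiv_const_smul (f.differentiableAt x)]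
        rfl }
    (fun f g => Subtype.ext <| funext fun x => by
        change fderiv ℝ (f.1 * g.1) x _ = _
        rw [fderiv_mul (f.differentiableAt x) (g.differentiableAt x)]
        rfl)

theorem dx_apply (i : Fin 3) (f : TF) (x : Spc 3) : (dx i f).1 x = pd i f.1 x := rfl

theorem dx_val (i : Fin 3) (f : TF) : (dx i f).1 = pd i f.1 := rfl

theorem dx_mul (i : Fin 3) (f g : TF) : dx i (f * g) = f * dx i g + dx i f * g := by
  rw [Derivation.leibniz, smul_eq_mul, smul_eq_mul, mul_comm g]

theorem dx_comm (i j : Fin 3) (f : TF) : dx i (dx j f) = dx j (dx i f) := by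
  have key : ∀ (i j : Fin 3) (x : Spc 3), pd i (pd j f.1) x
      = fderiv ℝ (fderiv ℝ f.1) x (Pi.single i 1) (Pi.single j 1) := fun i j x => by
    have hd : DifferentiableAt ℝ (fderiv ℝ f.1) x :=
      ((f.contDiff.fderiv_right (m := (⊤ : ℕ∞)) (by simp)).differentiable
        (by simp)).differentiableAt
    have h := (hd.hasFDerivAt.clm_apply (hasFDerivAt_const (Pi.single j (1 : ℝ)) x)).fderiv
    unfold pd
    rw [h]
    simp
  refine Subtype.ext (funext fun x => ?_)
  rw [dx_val, dx_val, dx_val, dx_val, key, key]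
  exact (f.contDiff.contDiffAt.isSymmSndFDerivAt (by simp; exact WithTop.coe_le_coe.2 le_top)) _ _

theorem isCompact_cube : IsCompact (cube 3) := isCompact_univ_pi fun _ => isCompact_Icc

theorem cube_eq_Icc : cube 3 = Icc (0 : Spc 3) 1 := pi_univ_Icc _ _

theorem TF.integrableOn (f : TF) : IntegrableOn f.1 (cube 3) :=
  f.continuous.continuousOn.integrableOn_compact isCompact_cube

theorem volume_cube : volume (cube 3) = 1 := by
  rw [cube_eq_Icc, Real.volume_Icc_pi]
  simp

/-- Integration over the torus. -/
def integ : TF →ₗ[ℝ] ℝ where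
  toFun f := ∫ x in cube 3, f.1 x
  map_add' f g := integral_add f.integrableOn g.integrableOn
  map_smul' c _ := integral_const_mul c _

theorem integ_def (f : TF) : integ f = ∫ x in cube 3, f.1 x := rfl

theorem integ_nonneg {f : TF} (h : ∀ x, 0 ≤ f.1 x) : 0 ≤ integ f :=
  setIntegral_nonneg (isCompact_cube.measurableSet) fun x _ => h x

theorem integ_mono {f g : TF} (h : ∀ x, f.1 x ≤ g.1 x) : integ f ≤ integ g :=
  setIntegral_mono f.integrableOn g.integrableOn h

theorem integ_algebraMap (c : ℝ) : integ (algebraMap ℝ TF c) = c := by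
  change ∫ x in cube 3, c = c
  rw [setIntegral_const]
  simp [Measure.real, volume_cube]

theorem integ_dx (i : Fin 3) (f : TF) : integ (dx i f) = 0 := by
  have h := integral_divergence_of_hasFDerivAt_off_countable (E := ℝ) (n := 2)
    (0 : Spc 3) 1 (by intro i; simp) (fun x => Pi.single i (f.1 x))
    (fun x => (ContinuousLinearMap.single ℝ (fun _ => ℝ) i).comp (fderiv ℝ f.1 x)) ∅
    countable_empty ?_ ?_ ?_
  · have h1 : ∀ x : Spc 3, (∑ k : Fin 3, ((ContinuousLinearMap.single ℝ (fun _ => ℝ) i).comp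
        (fderiv ℝ f.1 x)) (Pi.single k 1) k) = (dx i f).1 x := fun x => by
      rw [Finset.sum_eq_single i]
      · simp [dx_apply, pd]
      · intro b _ hb
        simp [Pi.single_eq_of_ne hb]
      · simp
    simp only [h1] at h
    rw [integ_def, cube_eq_Icc, h]
    refine Finset.sum_eq_zero fun k _ => ?_
    rw [sub_eq_zero]
    refine setIntegral_congr_fun measurableSet_Icc fun y _ => ?_
    by_cases hk : k = i
    · subst hk
      simp only [Pi.single_eq_same]
      have h3 := f.2.2 (k.insertNth (0 : ℝ) y) (Pi.single k 1)
      change f.1 (k.insertNth (1 : ℝ) y) = f.1 (k.insertNth (0 : ℝ) y)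
      rw [← h3]
      refine congrArg f.1 (funext fun j => ?_)
      refine Fin.succAboveCases k ?_ (fun j => ?_) j
      · simp
      · simp [Fin.succAbove_ne]
    · simp [Pi.single_eq_of_ne hk]
  · exact (ContinuousLinearMap.single ℝ (fun _ => ℝ) i).continuous.comp f.continuous |>.continuousOn
  · intro x _
    exact (ContinuousLinearMap.single ℝ (fun _ => ℝ) i).hasFDerivAt.comp x
      (f.differentiableAt x).hasFDerivAt
  · have h1 : ∀ x : Spc 3, (∑ k : Fin 3, ((ContinuousLinearMap.single ℝ (fun _ => ℝ) i).comp
        (fderiv ℝ f.1 x)) (Pi.single k 1) k) = (dx i f).1 x := fun x => by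
      rw [Finset.sum_eq_single i]
      · simp [dx_apply, pd]
      · intro b _ hb
        simp [Pi.single_eq_of_ne hb]
      · simp
    simp only [h1]
    rw [← cube_eq_Icc]
    exact (dx i f).integrableOn

theorem integ_mul_dx (i : Fin 3) (f g : TF) : integ (f * dx i g) = -integ (dx i f * g) := by
  have h := integ_dx i (f * g)
  rw [dx_mul, map_add] at h
  linarith

end TorusAlgebra

section SobolevTools

open Set Filter Topology

theorem hasDerivAt_integral_cube {F F' : ℝ → Spc 3 → ℝ} {O : Set ℝ} (hO : IsOpen O)
    (hF : ∀ s ∈ O, Continuous (F s))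
    (hF' : ContinuousOn (fun q : ℝ × Spc 3 => F' q.1 q.2) (O ×ˢ univ))
    (hd : ∀ s ∈ O, ∀ x, HasDerivAt (fun r => F r x) (F' s x) s) {t : ℝ} (ht : t ∈ O) :
    HasDerivAt (fun s => ∫ x in cube 3, F s x) (∫ x in cube 3, F' t x) t := by
  obtain ⟨r, hr, hrO⟩ := Metric.isOpen_iff.1 hO t ht
  have hsub : Metric.closedBall t (r / 2) ⊆ O :=
    (Metric.closedBall_subset_ball (by linarith)).trans hrO
  obtain ⟨M, hM⟩ := ((isCompact_closedBall t (r / 2)).prod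
    isCompact_cube).exists_bound_of_continuousOn
    (hF'.mono (prod_mono hsub (subset_univ _)))
  have hF't : Continuous (F' t) :=
    continuousOn_univ.1 (hF'.comp (f := fun x => (t, x)) (by fun_prop) fun x _ => ⟨ht, trivial⟩)
  refine (hasDerivAt_integral_of_dominated_loc_of_deriv_le (bound := fun _ => M)
    (s := Metric.closedBall t (r / 2)) (Metric.closedBall_mem_nhds t (by linarith))
      ?_ ?_ ?_ ?_ ?_ ?_).2
  · filter_upwards [hO.mem_nhds ht] with s hs
    exact (hF s hs).aestronglyMeasurable
  · exact (hF t ht).continuousOn.integrableOn_compact isCompact_cube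
  · exact hF't.aestronglyMeasurable
  · refine (ae_restrict_iff' isCompact_cube.measurableSet).2
      (Eventually.of_forall fun x hx s hs => ?_)
    exact hM (s, x) ⟨hs, hx⟩
  · exact continuousOn_const.integrableOn_compact isCompact_cube
  · exact Eventually.of_forall fun x s hs => hd s (hsub hs) x

/-- Translation of a periodic function. -/
def shift (z : Spc 3) (f : TF) : TF :=
  ⟨fun y => f.1 (z + y), f.contDiff.comp (contDiff_const.add contDiff_id), fun y k => by
    change f.1 _ = f.1 _
    rw [← f.2.2 (z + y) k]
    refine congrArg f.1 (funext fun i => ?_)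
    simp only [Pi.add_apply]
    ring⟩

theorem shift_apply (z : Spc 3) (f : TF) (y : Spc 3) : (shift z f).1 y = f.1 (z + y) := rfl

theorem dx_shift (i : Fin 3) (z : Spc 3) (f : TF) : dx i (shift z f) = shift z (dx i f) :=
  Subtype.ext <| funext fun y => by
    change fderiv ℝ (fun y => f.1 (z + y)) y _ = fderiv ℝ f.1 (z + y) _
    rw [fderiv_comp_add_left]

theorem fderiv_apply_eq_sum (f : TF) (x v : Spc 3) :
    fderiv ℝ f.1 x v = ∑ i, v i * (dx i f).1 x := by
  have h : v = ∑ i, v i • (Pi.single i (1 : ℝ) : Spc 3) := by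
    ext j
    simp [Finset.sum_apply, Pi.single_apply]
  conv_lhs => rw [h]
  rw [map_sum]
  simp [dx_apply, pd]

theorem hasDerivAt_line (f : TF) (c v : Spc 3) (s : ℝ) :
    HasDerivAt (fun s : ℝ => f.1 (c + s • v)) (∑ i, v i * (dx i f).1 (c + s • v)) s := by
  rw [← fderiv_apply_eq_sum]
  have h : HasDerivAt (fun s : ℝ => c + s • v) v s := by
    simpa using ((hasDerivAt_id s).smul_const v).const_add c
  exact (f.differentiableAt _).hasFDerivAt.comp_hasDerivAt s h

theorem hasDerivAt_integ_shift_mul (f g : TF) (z : Spc 3) (s : ℝ) :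
    HasDerivAt (fun s : ℝ => integ (shift (s • z) f * g))
      (integ (∑ i, z i • shift (s • z) (dx i f) * g)) s := by
  have h := hasDerivAt_integral_cube (F := fun s y => f.1 (y + s • z) * g.1 y)
    (F' := fun s y => (∑ i, z i * (dx i f).1 (y + s • z)) * g.1 y) isOpen_univ
    (fun s _ => (f.continuous.comp (by fun_prop)).mul g.continuous)
    (Continuous.continuousOn ((continuous_finsetSum _ fun i _ => continuous_const.mul
      ((dx i f).continuous.comp (by fun_prop))).mul (g.continuous.comp continuous_snd)))
    (fun s _ y => (hasDerivAt_line f y z s).mul_const _) (mem_univ s)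
  have e1 : ∀ s : ℝ, integ (shift (s • z) f * g) = ∫ y in cube 3, f.1 (y + s • z) * g.1 y :=
    fun s => by
      rw [integ_def]
      refine integral_congr_ae (Eventually.of_forall fun y => ?_)
      change f.1 (s • z + y) * g.1 y = _
      rw [add_comm]
  simp only [e1]
  convert h using 1
  rw [integ_def]
  refine integral_congr_ae (Eventually.of_forall fun y => ?_)
  simp only [TF.sum_apply]
  rw [Finset.sum_mul]
  refine Finset.sum_congr rfl fun i _ => ?_
  change z i * (dx i f).1 (s • z + y) * g.1 y = _
  rw [add_comm]

theorem shift_zero (f : TF) : shift 0 f = f :=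
  Subtype.ext <| funext fun y => by rw [shift_apply, zero_add]

theorem integ_shift (z : Spc 3) (f : TF) : integ (shift z f) = integ f := by
  have h : ∀ s : ℝ, HasDerivAt (fun s : ℝ => integ (shift (s • z) f)) 0 s := fun s => by
    have := hasDerivAt_integ_shift_mul f 1 z s
    simp only [mul_one] at this
    convert this using 1
    rw [map_sum]
    refine (Finset.sum_eq_zero fun i _ => ?_).symm
    rw [map_smul, ← dx_shift, integ_dx, smul_zero]
  have h2 := is_const_of_deriv_eq_zero (fun s => (h s).differentiableAt) (fun s => (h s).deriv) 1 0
  simpa [shift_zero] using h2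

/-- Squared `L²` norm. -/
def nsq (f : TF) : ℝ := integ (f * f)

/-- Squared `L²` norm of the gradient. -/
def dsq (f : TF) : ℝ := ∑ i, nsq (dx i f)

/-- Squared `L²` norm of the Hessian. -/
def d2sq (f : TF) : ℝ := ∑ k, ∑ l, nsq (dx k (dx l f))

/-- Squared `H²` norm (without the gradient part). -/
def hsq (f : TF) : ℝ := nsq f + d2sq f

theorem nsq_nonneg (f : TF) : 0 ≤ nsq f := integ_nonneg fun x => mul_self_nonneg (f.1 x)

theorem dsq_nonneg (f : TF) : 0 ≤ dsq f := Finset.sum_nonneg fun _ _ => nsq_nonneg _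

theorem d2sq_nonneg (f : TF) : 0 ≤ d2sq f :=
  Finset.sum_nonneg fun _ _ => Finset.sum_nonneg fun _ _ => nsq_nonneg _

theorem hsq_nonneg (f : TF) : 0 ≤ hsq f := add_nonneg (nsq_nonneg f) (d2sq_nonneg f)

theorem nsq_smul (c : ℝ) (f : TF) : nsq (c • f) = c ^ 2 * nsq f := by
  unfold nsq
  rw [smul_mul_smul_comm, map_smul, smul_eq_mul]
  ring

theorem d2sq_smul (c : ℝ) (f : TF) : d2sq (c • f) = c ^ 2 * d2sq f := by
  simp only [d2sq, Derivation.map_smul, nsq_smul, Finset.mul_sum]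

theorem hsq_smul (c : ℝ) (f : TF) : hsq (c • f) = c ^ 2 * hsq f := by
  rw [hsq, hsq, nsq_smul, d2sq_smul]
  ring

theorem nsq_neg (f : TF) : nsq (-f) = nsq f := by
  rw [nsq, nsq, show -f * -f = f * f by ring]

theorem integ_mul_sq_le (f g : TF) : integ (f * g) ^ 2 ≤ nsq f * nsq g := by
  have h : ∀ t : ℝ, 0 ≤ nsq g * (t * t) + 2 * integ (f * g) * t + nsq f := fun t => by
    have h1 := nsq_nonneg (f + t • g)
    have h2 : nsq (f + t • g) = nsq g * (t * t) + 2 * integ (f * g) * t + nsq f := by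
      unfold nsq
      have : (f + t • g) * (f + t • g) = f * f + (2 * t) • (f * g) + (t * t) • (g * g) := by
        simp only [Algebra.smul_def, map_mul, map_ofNat]
        ring
      rw [this]
      simp only [map_add, map_smul, smul_eq_mul]
      ring
    rwa [h2] at h1
  have := discrim_le_zero h
  unfold discrim at this
  nlinarith

theorem abs_integ_mul_le (f g : TF) : |integ (f * g)| ≤ √(nsq f) * √(nsq g) := by
  rw [← sqrt_mul (nsq_nonneg f)]
  exact abs_le_sqrt (integ_mul_sq_le f g)

theorem two_integ_mul_le (f g : TF) : 2 * integ (f * g) ≤ nsq f + nsq g := by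
  have := nsq_nonneg (f - g)
  have e : nsq (f - g) = nsq f - 2 * integ (f * g) + nsq g := by
    unfold nsq
    have : (f - g) * (f - g) = f * f - (2 : ℝ) • (f * g) + g * g := by
      simp only [Algebra.smul_def, map_ofNat]
      ring
    rw [this]
    simp only [map_add, map_sub, map_smul, smul_eq_mul]
  linarith

theorem nsq_sum_le {ι : Type*} (s : Finset ι) (f : ι → TF) :
    nsq (∑ i ∈ s, f i) ≤ s.card * ∑ i ∈ s, nsq (f i) := by
  have h := integ_mono (f := (∑ i ∈ s, f i) * (∑ i ∈ s, f i))
    (g := (s.card : ℝ) • ∑ i ∈ s, f i * f i) fun x => by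
      change (∑ i ∈ s, f i).1 x * (∑ i ∈ s, f i).1 x ≤ (s.card : ℝ) * (∑ i ∈ s, f i * f i).1 x
      rw [TF.sum_apply, TF.sum_apply, ← sq]
      have := sq_sum_le_card_mul_sum_sq (s := s) (f := fun i => (f i).1 x)
      refine this.trans (le_of_eq ?_)
      congr 1
      exact Finset.sum_congr rfl fun i _ => by rw [sq]; rfl
  rw [map_smul, map_sum] at h
  exact h

theorem nsq_add_le (f g : TF) : nsq (f + g) ≤ 2 * (nsq f + nsq g) := by
  simpa [Fin.sum_univ_two] using nsq_sum_le Finset.univ ![f, g]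

theorem d2sq_sum_le {ι : Type*} (s : Finset ι) (f : ι → TF) :
    d2sq (∑ i ∈ s, f i) ≤ s.card * ∑ i ∈ s, d2sq (f i) := by
  have : s.card * ∑ i ∈ s, d2sq (f i)
      = ∑ k, ∑ l, s.card * ∑ i ∈ s, nsq (dx k (dx l (f i))) := by
    simp only [d2sq]
    rw [Finset.sum_comm, Finset.mul_sum]
    refine Finset.sum_congr rfl fun k _ => ?_
    rw [Finset.sum_comm, Finset.mul_sum]
  rw [this]
  refine Finset.sum_le_sum fun k _ => Finset.sum_le_sum fun l _ => ?_
  rw [map_sum, map_sum]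
  exact nsq_sum_le _ _

theorem hsq_sum_le {ι : Type*} (s : Finset ι) (f : ι → TF) :
    hsq (∑ i ∈ s, f i) ≤ s.card * ∑ i ∈ s, hsq (f i) := by
  simp only [hsq, Finset.sum_add_distrib, mul_add]
  exact add_le_add (nsq_sum_le s f) (d2sq_sum_le s f)

theorem hsq_add_le (f g : TF) : hsq (f + g) ≤ 2 * (hsq f + hsq g) := by
  simpa [Fin.sum_univ_two] using hsq_sum_le Finset.univ ![f, g]

theorem nsq_mul_le {f : TF} {M : ℝ} (hf : ∀ x, f.1 x ^ 2 ≤ M) (g : TF) :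
    nsq (f * g) ≤ M * nsq g := by
  have h := integ_mono (f := f * g * (f * g)) (g := M • (g * g)) fun x => by
    change f.1 x * g.1 x * (f.1 x * g.1 x) ≤ M * (g.1 x * g.1 x)
    nlinarith [hf x, mul_self_nonneg (g.1 x)]
  rwa [map_smul] at h

/-- Gagliardo–Nirenberg: `‖∂ₖf‖₄⁴ ≤ 9 ‖f‖_∞² ‖∂ₖ²f‖₂²`. -/
theorem integ_dx_pow_four_le {f : TF} {M : ℝ} (hf : ∀ x, f.1 x ^ 2 ≤ M) (k : Fin 3) :
    nsq (dx k f * dx k f) ≤ 9 * M * nsq (dx k (dx k f)) := by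
  have h1 : nsq (dx k f * dx k f) = -(3 * integ ((dx k f * dx k f) * (f * dx k (dx k f)))) := by
    have h := integ_mul_dx k (dx k f * dx k f * dx k f) f
    have e1 : dx k f * dx k f * dx k f * dx k f = dx k f * dx k f * (dx k f * dx k f) := by ring
    have e2 : dx k (dx k f * dx k f * dx k f) * f
        = (3 : ℝ) • ((dx k f * dx k f) * (f * dx k (dx k f))) := by
      rw [dx_mul, dx_mul]
      simp only [Algebra.smul_def, map_ofNat]
      ring
    rw [e1, e2, map_smul, smul_eq_mul] at h
    exact h
  have h2 := integ_mul_sq_le (dx k f * dx k f) (f * dx k (dx k f))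
  have h3 := nsq_mul_le hf (dx k (dx k f))
  have h4 := nsq_nonneg (dx k f * dx k f)
  by_contra hc
  push Not at hc
  have h5 : nsq (dx k f * dx k f) ^ 2 ≤ nsq (dx k f * dx k f) * (9 * M * nsq (dx k (dx k f))) := by
    conv_lhs => rw [h1]
    nlinarith
  have h6 : 0 < nsq (dx k f * dx k f) := by
    refine lt_of_le_of_lt ?_ hc
    have := (nsq_nonneg _).trans h3
    linarith
  nlinarith

theorem nsq_dx_mul_dx_le {f g : TF} {M K : ℝ} (hM : ∀ x, f.1 x ^ 2 ≤ M) (hK : ∀ x, g.1 x ^ 2 ≤ K)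
    (k l : Fin 3) :
    nsq (dx k f * dx l g) ≤ 9 * (M * d2sq g + K * d2sq f) := by
  have hM0 : 0 ≤ M := (sq_nonneg _).trans (hM 0)
  have hK0 : 0 ≤ K := (sq_nonneg _).trans (hK 0)
  have hdiag : ∀ (f : TF) k, nsq (dx k (dx k f)) ≤ d2sq f := fun f k =>
    (Finset.single_le_sum (f := fun l => nsq (dx k (dx l f))) (fun _ _ => nsq_nonneg _)
      (Finset.mem_univ k)).trans
    (Finset.single_le_sum (f := fun k => ∑ l, nsq (dx k (dx l f)))
      (fun _ _ => Finset.sum_nonneg fun _ _ => nsq_nonneg _) (Finset.mem_univ k))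
  have h1 := integ_dx_pow_four_le hM k
  have h2 := integ_dx_pow_four_le hK l
  have e : nsq (dx k f * dx l g) = integ (dx k f * dx k f * (dx l g * dx l g)) := by
    unfold nsq
    congr 1
    ring
  have h3 := integ_mul_sq_le (dx k f * dx k f) (dx l g * dx l g)
  rw [← e] at h3
  have h4 := hdiag f k
  have h5 := hdiag g l
  have h6 := nsq_nonneg (dx k f * dx k f)
  have h7 := nsq_nonneg (dx l g * dx l g)
  have h8 := d2sq_nonneg f
  have h9 := d2sq_nonneg g
  have h10 : nsq (dx k f * dx k f) ≤ 9 * M * d2sq f := h1.trans (by gcongr)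
  have h11 : nsq (dx l g * dx l g) ≤ 9 * K * d2sq g := h2.trans (by gcongr)
  refine abs_le_of_sq_le_sq' ?_ (by positivity) |>.2
  calc _ ≤ (9 * M * d2sq f) * (9 * K * d2sq g) := h3.trans (by gcongr)
    _ ≤ _ := by nlinarith [sq_nonneg (M * d2sq g - K * d2sq f),
        mul_nonneg (mul_nonneg hM0 h9) (mul_nonneg hK0 h8)]

theorem d2sq_mul_le {f g : TF} {M K : ℝ} (hM : ∀ x, f.1 x ^ 2 ≤ M) (hK : ∀ x, g.1 x ^ 2 ≤ K) :
    d2sq (f * g) ≤ 700 * (M * d2sq g + K * d2sq f) := by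
  have hM0 : 0 ≤ M := (sq_nonneg _).trans (hM 0)
  have hK0 : 0 ≤ K := (sq_nonneg _).trans (hK 0)
  have h1 : ∀ k l, nsq (dx k (dx l (f * g))) ≤
      4 * (M * nsq (dx k (dx l g)) + K * nsq (dx k (dx l f))
      + 18 * (M * d2sq g + K * d2sq f)) := fun k l => by
    have e : dx k (dx l (f * g)) = ∑ i, ![f * dx k (dx l g), g * dx k (dx l f),
        dx k f * dx l g, dx l f * dx k g] i := by
      rw [dx_mul, map_add, dx_mul, dx_mul]
      simp only [Fin.sum_univ_four, Matrix.cons_val]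
      ring
    rw [e]
    refine (nsq_sum_le _ _).trans ?_
    simp only [Fin.sum_univ_four, Matrix.cons_val, Finset.card_univ, Fintype.card_fin]
    have := nsq_mul_le hM (dx k (dx l g))
    have := nsq_mul_le hK (dx k (dx l f))
    have := nsq_dx_mul_dx_le hM hK k l
    have := nsq_dx_mul_dx_le hM hK l k
    push_cast
    linarith
  have h2 : d2sq (f * g) ≤ ∑ k : Fin 3, ∑ l : Fin 3, 4 * (M * nsq (dx k (dx l g))
      + K * nsq (dx k (dx l f)) + 18 * (M * d2sq g + K * d2sq f)) :=
    Finset.sum_le_sum fun k _ => Finset.sum_le_sum fun l _ => h1 k l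
  refine h2.trans (le_of_eq_of_le (b := 4 * (M * d2sq g + K * d2sq f
    + 9 * (18 * (M * d2sq g + K * d2sq f)))) ?_ ?_)
  · simp only [← Finset.mul_sum, Finset.sum_add_distrib]
    simp [d2sq]
    ring
  · have := mul_nonneg hM0 (d2sq_nonneg g)
    have := mul_nonneg hK0 (d2sq_nonneg f)
    linarith

end SobolevTools

section Sobolev

open Set Filter Topology

theorem integral_cube_sub {f g : Spc 3 → ℝ} (hf : Continuous f) (hg : Continuous g) :
    ∫ x in cube 3, (f x - g x) = (∫ x in cube 3, f x) - ∫ x in cube 3, g x :=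
  integral_sub (hf.continuousOn.integrableOn_compact isCompact_cube)
    (hg.continuousOn.integrableOn_compact isCompact_cube)

theorem integral_cube_const (c : ℝ) : ∫ _ in cube 3, c = c := integ_algebraMap c

theorem sq_integral_cube_le {g : Spc 3 → ℝ} (hg : Continuous g) :
    (∫ x in cube 3, g x) ^ 2 ≤ ∫ x in cube 3, g x ^ 2 := by
  set c := ∫ x in cube 3, g x with hc
  have h : 0 ≤ ∫ x in cube 3, (g x ^ 2 - ((2 * c) * g x - c ^ 2)) := by
    refine setIntegral_nonneg isCompact_cube.measurableSet fun x _ => ?_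
    nlinarith [sq_nonneg (g x - c)]
  rw [integral_cube_sub (by fun_prop) (by fun_prop), integral_cube_sub (by fun_prop) (by fun_prop),
    integral_const_mul, ← hc, integral_cube_const] at h
  linarith

theorem integral_cube_scale_le {f : TF} (hf : ∀ x, 0 ≤ f.1 x) {r : ℝ} (hr : 0 < r) (hr1 : r ≤ 1) :
    ∫ x in cube 3, f.1 (r • x) ≤ (r ^ 3)⁻¹ * integ f := by
  rw [Measure.setIntegral_comp_smul_of_pos _ _ _ hr]
  simp only [Module.finrank_fintype_fun_eq_card, Fintype.card_fin, smul_eq_mul]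
  refine mul_le_mul_of_nonneg_left ?_ (by positivity)
  refine setIntegral_mono_set f.integrableOn (Eventually.of_forall hf) ?_
  refine LE.le.eventuallyLE ?_
  rintro _ ⟨x, hx, rfl⟩ i _
  have := hx i trivial
  simp only [Pi.smul_apply, smul_eq_mul, mem_Icc] at this ⊢
  exact ⟨mul_nonneg hr.le this.1, by nlinarith [this.1, this.2]⟩

theorem cube_sq_le {x : Spc 3} (hx : x ∈ cube 3) (i : Fin 3) : x i ^ 2 ≤ 1 := by
  have := hx i trivial
  simp only [mem_Icc] at this
  nlinarith [this.1, this.2]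

theorem dsq_sq_le (f : TF) : dsq f ^ 2 ≤ 3 * (nsq f * d2sq f) := by
  have h1 : dsq f = -integ (f * ∑ i, dx i (dx i f)) := by
    rw [Finset.mul_sum, map_sum, ← Finset.sum_neg_distrib]
    refine Finset.sum_congr rfl fun i _ => ?_
    rw [integ_mul_dx, neg_neg]
    rfl
  have h2 := integ_mul_sq_le f (∑ i, dx i (dx i f))
  have h3 : nsq (∑ i, dx i (dx i f)) ≤ 3 * d2sq f := by
    refine (nsq_sum_le _ _).trans ?_
    simp only [Finset.card_univ, Fintype.card_fin]
    push_cast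
    refine mul_le_mul_of_nonneg_left ?_ (by norm_num)
    exact Finset.sum_le_sum fun k _ =>
      Finset.single_le_sum (f := fun l => nsq (dx k (dx l f))) (fun _ _ => nsq_nonneg _)
        (Finset.mem_univ k)
  rw [h1, neg_sq]
  calc _ ≤ _ := h2
    _ ≤ nsq f * (3 * d2sq f) := mul_le_mul_of_nonneg_left h3 (nsq_nonneg f)
    _ = _ := by ring

theorem nsq_shift (z : Spc 3) (f : TF) : nsq (shift z f) = nsq f := integ_shift z (f * f)

theorem d2sq_shift (z : Spc 3) (f : TF) : d2sq (shift z f) = d2sq f := by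
  simp only [d2sq, dx_shift, nsq_shift]

theorem sq_apply_zero_le (f : TF) {r : ℝ} (hr : 0 < r) (hr1 : r ≤ 1) :
    f.1 0 ^ 2 ≤ 120 * ((r ^ 3)⁻¹ * nsq f + r * d2sq f) := by
  set h : ℝ → ℝ := fun s => ∫ y in cube 3, (f.1 (s • y) - s * ∑ i, y i * (dx i f).1 (s • y)) with hh
  set h' : ℝ → ℝ := fun s => ∫ y in cube 3, -(s * ∑ i, y i * ∑ j, y j * (dx j (dx i f)).1 (s • y))
    with hh'
  have hcont : ∀ g : TF, Continuous fun q : ℝ × Spc 3 => g.1 (q.1 • q.2) := fun g =>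
    g.continuous.comp (by fun_prop)
  have hcont' : ∀ (g : TF) (s : ℝ), Continuous fun y : Spc 3 => g.1 (s • y) := fun g s =>
    g.continuous.comp (by fun_prop)
  have hder : ∀ s, HasDerivAt h (h' s) s := fun s => by
    refine hasDerivAt_integral_cube
      (F := fun s y => f.1 (s • y) - s * ∑ i, y i * (dx i f).1 (s • y))
      (F' := fun s y => -(s * ∑ i, y i * ∑ j, y j * (dx j (dx i f)).1 (s • y)))
      (O := univ) isOpen_univ (fun s _ => ?_) ?_ (fun s _ y => ?_) (mem_univ s)
    · have h1 := hcont' f s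
      have h2 := fun i => hcont' (dx i f) s
      exact h1.sub (by fun_prop)
    · have := fun i j => hcont (dx j (dx i f))
      refine Continuous.continuousOn ?_
      fun_prop
    · have h1 : ∀ g : TF, HasDerivAt (fun s : ℝ => g.1 (s • y)) (∑ i, y i * (dx i g).1 (s • y)) s :=
        fun g => by simpa using hasDerivAt_line g 0 y s
      have h2 : HasDerivAt (fun s : ℝ => ∑ i, y i * (dx i f).1 (s • y))
          (∑ i, y i * ∑ j, y j * (dx j (dx i f)).1 (s • y)) s :=
        HasDerivAt.fun_sum fun i _ => (h1 (dx i f)).const_mul (y i)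
      refine ((h1 f).sub ((hasDerivAt_id s).mul h2)).congr_deriv ?_
      simp only [id]
      ring
  set G : TF := ∑ i, ∑ j, dx j (dx i f) * dx j (dx i f) with hG
  have hGi : integ G = d2sq f := by
    simp only [hG, map_sum, d2sq, nsq]
    exact Finset.sum_comm
  set K : ℝ := 3 * √(d2sq f) with hK
  have hbound : ∀ s ∈ Ioc (0 : ℝ) r, |h' s| ≤ K / √s := fun s hs => by
    have hs1 : s ≤ 1 := hs.2.trans hr1
    have e1 : h' s = -(s * ∫ y in cube 3, ∑ i, y i * ∑ j, y j * (dx j (dx i f)).1 (s • y)) := by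
      rw [hh']
      simp only [integral_neg, integral_const_mul]
    have hc : Continuous fun y : Spc 3 => ∑ i, y i * ∑ j, y j * (dx j (dx i f)).1 (s • y) := by
      have := fun i j => hcont' (dx j (dx i f)) s
      fun_prop
    have h2 := sq_integral_cube_le hc
    have h3 : ∫ y in cube 3, (∑ i, y i * ∑ j, y j * (dx j (dx i f)).1 (s • y)) ^ 2
        ≤ ∫ y in cube 3, 9 * G.1 (s • y) := by
      refine setIntegral_mono_on ((hc.pow 2).continuousOn.integrableOn_compact isCompact_cube)
        ((continuous_const.mul (hcont' G s)).continuousOn.integrableOn_compact isCompact_cube)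
        isCompact_cube.measurableSet fun y hy => ?_
      have hGe : G.1 (s • y) = ∑ i, ∑ j, ((dx j (dx i f)).1 (s • y)) ^ 2 := by
        rw [hG, TF.sum_apply]
        refine Finset.sum_congr rfl fun i _ => ?_
        rw [TF.sum_apply]
        exact Finset.sum_congr rfl fun j _ => (sq _).symm
      rw [hGe]
      have hin : ∀ (i : Fin 3) (a : Fin 3 → ℝ), (∑ j, y j * a j) ^ 2 ≤ 3 * ∑ j, a j ^ 2 :=
        fun i a => by
          refine (sq_sum_le_card_mul_sum_sq (s := Finset.univ) (f := fun j => y j * a j)).trans ?_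
          simp only [Finset.card_univ, Fintype.card_fin]
          push_cast
          refine mul_le_mul_of_nonneg_left (Finset.sum_le_sum fun j _ => ?_) (by norm_num)
          rw [mul_pow]
          exact mul_le_of_le_one_left (sq_nonneg _) (cube_sq_le hy j)
      calc _ ≤ 3 * ∑ i, (∑ j, y j * (dx j (dx i f)).1 (s • y)) ^ 2 := hin 0 _
        _ ≤ 3 * ∑ i, 3 * ∑ j, ((dx j (dx i f)).1 (s • y)) ^ 2 := by
          gcongr with i
          exact hin 0 _
        _ = _ := by rw [← Finset.mul_sum]; ring
    have h4 : ∫ y in cube 3, 9 * G.1 (s • y) ≤ 9 * ((s ^ 3)⁻¹ * d2sq f) := by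
      rw [integral_const_mul, ← hGi]
      refine mul_le_mul_of_nonneg_left (integral_cube_scale_le (fun x => ?_) hs.1 hs1) (by norm_num)
      rw [hG, TF.sum_apply]
      refine Finset.sum_nonneg fun i _ => ?_
      rw [TF.sum_apply]
      exact Finset.sum_nonneg fun j _ => mul_self_nonneg _
    have hK0 : 0 ≤ K := by positivity
    refine abs_le_of_sq_le_sq ?_ (by positivity)
    rw [e1, div_pow, sq_sqrt hs.1.le, hK, mul_pow, sq_sqrt (d2sq_nonneg f), neg_sq, mul_pow]
    have h5 := mul_le_mul_of_nonneg_left (h2.trans (h3.trans h4)) (sq_nonneg s)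
    refine h5.trans (le_of_eq ?_)
    have := hs.1.ne'
    field_simp
    ring
  have hsqrt : ∀ s ∈ Ioo (0 : ℝ) r, HasDerivAt (fun s => 2 * K * √s) (K / √s) s := fun s hs => by
    have := (hasDerivAt_sqrt hs.1.ne').const_mul (2 * K)
    refine this.congr_deriv ?_
    ring
  have hmono : ∀ σ : ℝ, |σ| = 1 → 0 ≤ 2 * K * √r + σ * (h r - h 0) := fun σ hσ => by
    have hd : ∀ s ∈ Ioo (0 : ℝ) r,
        HasDerivAt (fun s => 2 * K * √s + σ * h s) (K / √s + σ * h' s) s :=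
      fun s hs => (hsqrt s hs).add ((hder s).const_mul σ)
    have hcn : Continuous h := continuous_iff_continuousAt.2 fun s => (hder s).continuousAt
    have hm : MonotoneOn (fun s => 2 * K * √s + σ * h s) (Icc 0 r) := by
      refine monotoneOn_of_deriv_nonneg (convex_Icc 0 r) (by fun_prop) ?_ ?_
      · rw [interior_Icc]
        exact fun s hs => (hd s hs).differentiableAt.differentiableWithinAt
      · rw [interior_Icc]
        intro s hs
        rw [(hd s hs).deriv]
        have h1 := hbound s ⟨hs.1, hs.2.le⟩
        have h2 := neg_abs_le (σ * h' s)
        rw [abs_mul, hσ, one_mul] at h2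
        linarith
    have := hm (left_mem_Icc.2 hr.le) (right_mem_Icc.2 hr.le) hr.le
    simp only [sqrt_zero, mul_zero, zero_add] at this
    linarith
  have hh0 : h 0 = f.1 0 := by
    rw [hh]
    simp only [zero_smul, zero_mul, sub_zero]
    exact integ_algebraMap (f.1 0)
  have hdiff : (f.1 0 - h r) ^ 2 ≤ 36 * (r * d2sq f) := by
    have h1 := hmono 1 (by simp)
    have h2 := hmono (-1) (by simp)
    have h3 : |f.1 0 - h r| ≤ 2 * K * √r := by
      rw [abs_le]
      constructor <;> rw [← hh0] <;> linarith
    have h4 := sq_le_sq' (abs_le.1 h3).1 (abs_le.1 h3).2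
    refine h4.trans (le_of_eq ?_)
    rw [mul_pow, mul_pow, hK, mul_pow, sq_sqrt (d2sq_nonneg f), sq_sqrt hr.le]
    ring
  have hhr : h r ^ 2 ≤ 2 * ((r ^ 3)⁻¹ * nsq f + 3 * r⁻¹ * dsq f) := by
    have hc1 := hcont' f r
    have hc2 : Continuous fun y : Spc 3 => ∑ i, y i * (dx i f).1 (r • y) := by
      have := fun i => hcont' (dx i f) r
      fun_prop
    have h1 : h r = (∫ y in cube 3, f.1 (r • y))
        - r * ∫ y in cube 3, ∑ i, y i * (dx i f).1 (r • y) := by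
      rw [hh]
      simp only
      rw [integral_cube_sub hc1 (hc2.const_mul r), integral_const_mul]
    have h2 : (∫ y in cube 3, f.1 (r • y)) ^ 2 ≤ (r ^ 3)⁻¹ * nsq f := by
      refine (sq_integral_cube_le hc1).trans ?_
      have := integral_cube_scale_le (f := f * f) (fun x => mul_self_nonneg (f.1 x)) hr hr1
      refine le_trans (le_of_eq ?_) this
      exact integral_congr_ae (Eventually.of_forall fun y => sq _)
    have h3 : (∫ y in cube 3, ∑ i, y i * (dx i f).1 (r • y)) ^ 2 ≤ 3 * ((r ^ 3)⁻¹ * dsq f) := by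
      refine (sq_integral_cube_le hc2).trans ?_
      have h4 := integral_cube_scale_le (f := ∑ i, dx i f * dx i f) (fun x => by
        rw [TF.sum_apply]
        exact Finset.sum_nonneg fun i _ => mul_self_nonneg _) hr hr1
      have h5 : integ (∑ i, dx i f * dx i f) = dsq f := by simp only [map_sum, dsq, nsq]
      rw [h5] at h4
      refine le_trans ?_ (mul_le_mul_of_nonneg_left h4 (by norm_num))
      rw [← integral_const_mul]
      refine setIntegral_mono_on ((hc2.pow 2).continuousOn.integrableOn_compact isCompact_cube)
        ((continuous_const.mul (hcont' _ r)).continuousOn.integrableOn_compact isCompact_cube)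
        isCompact_cube.measurableSet fun y hy => ?_
      rw [TF.sum_apply]
      refine (sq_sum_le_card_mul_sum_sq (s := Finset.univ)
        (f := fun j => y j * (dx j f).1 (r • y))).trans ?_
      simp only [Finset.card_univ, Fintype.card_fin]
      push_cast
      refine mul_le_mul_of_nonneg_left (Finset.sum_le_sum fun j _ => ?_) (by norm_num)
      rw [mul_pow]
      refine (mul_le_of_le_one_left (sq_nonneg _) (cube_sq_le hy j)).trans (le_of_eq (sq _))
    have h6 : r ^ 2 * (3 * ((r ^ 3)⁻¹ * dsq f)) = 3 * r⁻¹ * dsq f := by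
      field_simp
    have h7 := mul_le_mul_of_nonneg_left h3 (sq_nonneg r)
    rw [h6] at h7
    rw [h1]
    nlinarith [sq_nonneg ((∫ y in cube 3, f.1 (r • y))
        + r * ∫ y in cube 3, ∑ i, y i * (dx i f).1 (r • y))]
  have hscale : r⁻¹ * dsq f ≤ (r ^ 3)⁻¹ * nsq f + r * d2sq f := by
    have h0 := nsq_nonneg f
    have h1 := d2sq_nonneg f
    refine abs_le_of_sq_le_sq' ?_ (by positivity) |>.2
    have h2 : (r⁻¹ * dsq f) ^ 2 ≤ 3 * (((r ^ 3)⁻¹ * nsq f) * (r * d2sq f)) := by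
      have := mul_le_mul_of_nonneg_left (dsq_sq_le f) (sq_nonneg r⁻¹)
      rw [mul_pow]
      refine this.trans (le_of_eq ?_)
      field_simp
    have : 0 ≤ ((r ^ 3)⁻¹ * nsq f) := by positivity
    have : 0 ≤ r * d2sq f := by positivity
    nlinarith [sq_nonneg ((r ^ 3)⁻¹ * nsq f - r * d2sq f)]
  have h0 : 0 ≤ (r ^ 3)⁻¹ * nsq f := mul_nonneg (by positivity) (nsq_nonneg f)
  have h1 : 0 ≤ r * d2sq f := mul_nonneg hr.le (d2sq_nonneg f)
  nlinarith [sq_nonneg (f.1 0 - h r - h r)]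

/-- Agmon-type interpolation inequality at scale `r`. -/
theorem sq_apply_le (f : TF) {r : ℝ} (hr : 0 < r) (hr1 : r ≤ 1) (x : Spc 3) :
    f.1 x ^ 2 ≤ 120 * ((r ^ 3)⁻¹ * nsq f + r * d2sq f) := by
  have h := sq_apply_zero_le (shift x f) hr hr1
  rwa [nsq_shift, d2sq_shift, shift_apply, add_zero] at h

theorem sq_apply_le_hsq (f : TF) (x : Spc 3) : f.1 x ^ 2 ≤ 120 * hsq f := by
  simpa [hsq] using sq_apply_le f one_pos le_rfl x

theorem hsq_mul_le (f g : TF) : hsq (f * g) ≤ 200000 * (hsq f * hsq g) := by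
  have h1 := d2sq_mul_le (sq_apply_le_hsq f) (sq_apply_le_hsq g)
  have h2 := nsq_mul_le (sq_apply_le_hsq f) g
  have h3 : hsq f * d2sq g ≤ hsq f * hsq g :=
    mul_le_mul_of_nonneg_left (by unfold hsq; linarith [nsq_nonneg g]) (hsq_nonneg f)
  have h4 : hsq g * d2sq f ≤ hsq g * hsq f :=
    mul_le_mul_of_nonneg_left (by unfold hsq; linarith [nsq_nonneg f]) (hsq_nonneg g)
  have h5 : hsq f * nsq g ≤ hsq f * hsq g :=
    mul_le_mul_of_nonneg_left (by unfold hsq; linarith [d2sq_nonneg g]) (hsq_nonneg f)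
  have h6 := mul_nonneg (hsq_nonneg f) (hsq_nonneg g)
  rw [hsq]
  linarith

theorem nsq_shift_sub_le (f : TF) (z : Spc 3) (hz : ∀ i, z i ^ 2 ≤ 1) :
    2 * nsq f - 2 * integ (shift z f * f) ≤ 6 * dsq f := by
  set N : ℝ := 3 * dsq f with hN
  set ψ : ℝ → ℝ := fun s => 2 * nsq f - 2 * integ (shift (s • z) f * f) with hψ
  have hψn : ∀ s, ψ s = nsq (shift (s • z) f - f) := fun s => by
    have : nsq (shift (s • z) f - f)
        = nsq (shift (s • z) f) - 2 * integ (shift (s • z) f * f) + nsq f := by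
      unfold nsq
      have : (shift (s • z) f - f) * (shift (s • z) f - f) = shift (s • z) f * shift (s • z) f
          - (2 : ℝ) • (shift (s • z) f * f) + f * f := by
        simp only [Algebra.smul_def, map_ofNat]
        ring
      rw [this]
      simp only [map_add, map_sub, map_smul, smul_eq_mul]
    rw [this, nsq_shift, hψ]
    ring
  have hd : ∀ s, HasDerivAt ψ (-(2 * integ (∑ i, z i • shift (s • z) (dx i f) * f))) s :=
      fun s => by
    simpa using ((hasDerivAt_integ_shift_mul f f z s).const_mul 2).const_sub (2 * nsq f)
  have hle : ∀ s, -(2 * integ (∑ i, z i • shift (s • z) (dx i f) * f)) ≤ ψ s + N := fun s => by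
    set D : TF := ∑ i, z i • shift (s • z) (dx i f) with hD
    have e1 : (∑ i, z i • shift (s • z) (dx i f) * f) = D * f := by rw [hD, Finset.sum_mul]
    have e2 : integ (shift (s • z) f * D) = 0 := by
      rw [hD, Finset.mul_sum, map_sum]
      refine Finset.sum_eq_zero fun i _ => ?_
      rw [mul_smul_comm, map_smul, ← dx_shift]
      have := integ_mul_dx i (shift (s • z) f) (shift (s • z) f)
      rw [mul_comm (dx i _)] at this
      rw [show integ (shift (s • z) f * dx i (shift (s • z) f)) = 0 by linarith, smul_zero]
    have h1 := two_integ_mul_le (shift (s • z) f - f) D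
    have h2 : nsq D ≤ N := by
      refine (nsq_sum_le _ _).trans ?_
      simp only [Finset.card_univ, Fintype.card_fin]
      push_cast
      rw [hN]
      refine mul_le_mul_of_nonneg_left (Finset.sum_le_sum fun i _ => ?_) (by norm_num)
      rw [nsq_smul, nsq_shift]
      exact mul_le_of_le_one_left (nsq_nonneg _) (hz i)
    rw [sub_mul, map_sub, e2, ← hψn] at h1
    rw [e1, mul_comm D]
    linarith
  have hanti : AntitoneOn (fun s => exp (-s) * (ψ s + N)) (Icc 0 1) := by
    have hd2 : ∀ s, HasDerivAt (fun s => exp (-s) * (ψ s + N))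
        (exp (-s) * (-1) * (ψ s + N)
          + exp (-s) * (-(2 * integ (∑ i, z i • shift (s • z) (dx i f) * f)))) s := fun s =>
      ((hasDerivAt_neg s).exp).mul ((hd s).add_const N)
    refine antitoneOn_of_deriv_nonpos (convex_Icc 0 1)
      (fun s _ => (hd2 s).continuousAt.continuousWithinAt)
      (fun s _ => (hd2 s).differentiableAt.differentiableWithinAt) fun s _ => ?_
    rw [(hd2 s).deriv]
    nlinarith [hle s, exp_pos (-s)]
  have h := hanti (left_mem_Icc.2 zero_le_one) (right_mem_Icc.2 zero_le_one) zero_le_one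
  have h0 : ψ 0 = 0 := by rw [hψn, zero_smul, shift_zero, sub_self]; simp [nsq]
  have h1 : ψ 1 = 2 * nsq f - 2 * integ (shift z f * f) := by rw [hψ]; simp
  simp only [neg_zero, exp_zero, one_mul, h0, zero_add, h1] at h
  have he : (1 / 3 : ℝ) ≤ exp (-1) := by
    rw [exp_neg, one_div]
    exact inv_anti₀ (exp_pos 1) (by linarith [exp_one_lt_d9])
  have hN0 : 0 ≤ N := mul_nonneg (by norm_num) (dsq_nonneg f)
  have hx0 : 0 ≤ 2 * nsq f - 2 * integ (shift z f * f) := by rw [← h1, hψn]; exact nsq_nonneg _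
  nlinarith

/-- Poincaré inequality. -/
theorem nsq_le_dsq {f : TF} (hf : integ f = 0) : nsq f ≤ 3 * dsq f := by
  have hc : Continuous fun q : Spc 3 × Spc 3 => f.1 (q.1 + q.2) * f.1 q.2 :=
    (f.continuous.comp (by fun_prop)).mul (f.continuous.comp continuous_snd)
  have hi : ∀ z, integ (shift z f * f) = ∫ y in cube 3, f.1 (z + y) * f.1 y := fun z => rfl
  have hcont : Continuous fun z => integ (shift z f * f) := by
    simp only [hi]
    exact continuous_parametric_integral_of_continuous hc isCompact_cube
  have hzero : ∫ z in cube 3, integ (shift z f * f) = 0 := by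
    simp only [hi]
    rw [integral_integral_swap]
    · refine integral_eq_zero_of_ae (Eventually.of_forall fun y => ?_)
      simp only [integral_mul_const, Pi.zero_apply]
      have : ∫ z in cube 3, f.1 (z + y) = integ (shift y f) :=
        integral_congr_ae (Eventually.of_forall fun z => by simp only [shift_apply, add_comm])
      rw [this, integ_shift, hf, zero_mul]
    · rw [Measure.prod_restrict]
      exact hc.continuousOn.integrableOn_compact (isCompact_cube.prod isCompact_cube)
  have hm : ∫ z in cube 3, (2 * nsq f - 2 * integ (shift z f * f)) ≤ ∫ z in cube 3, 6 * dsq f := by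
    refine setIntegral_mono_on ((continuous_const.sub (continuous_const.mul
      hcont)).continuousOn.integrableOn_compact isCompact_cube)
      (continuousOn_const.integrableOn_compact isCompact_cube) isCompact_cube.measurableSet
      fun z hz => nsq_shift_sub_le f z (cube_sq_le hz)
  rw [integral_cube_sub continuous_const (hcont.const_mul 2),
    integral_const_mul 2 (fun z => integ (shift z f * f)), hzero, integral_cube_const,
    integral_cube_const] at hm
  linarith

theorem dsq_le_d2sq (f : TF) : dsq f ≤ 3 * d2sq f := by
  have h : d2sq f = ∑ l, dsq (dx l f) := by
    simp only [d2sq, dsq]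
    exact Finset.sum_comm
  rw [h, Finset.mul_sum]
  exact Finset.sum_le_sum fun l _ => nsq_le_dsq (integ_dx l f)

theorem hsq_le_d2sq {f : TF} (hf : integ f = 0) : hsq f ≤ 10 * d2sq f := by
  have h1 := nsq_le_dsq hf
  have h2 := dsq_le_d2sq f
  rw [hsq]
  linarith

theorem d2sq_le_sum (f : TF) : d2sq f ≤ 9 * ∑ j, d2sq (dx j f) := by
  have h1 : d2sq f = ∑ l, dsq (dx l f) := by
    simp only [d2sq, dsq]
    exact Finset.sum_comm
  rw [h1, Finset.mul_sum]
  exact Finset.sum_le_sum fun l _ => (dsq_le_d2sq _).trans (by linarith [d2sq_nonneg (dx l f)])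

end Sobolev

section TimeCurves

open Set Filter Topology

open Classical in
/-- A function viewed as an element of `TF`, with value `0` if it is not smooth and periodic. -/
def toTF (f : Spc 3 → ℝ) : TF := if h : f ∈ torusAlg then ⟨f, h⟩ else 0

theorem toTF_val {f : Spc 3 → ℝ} (h : f ∈ torusAlg) : (toTF f).1 = f := by
  rw [toTF, dif_pos h]

/-- A curve in `TF` that is jointly smooth in time and space over the time set `O`. -/
def Smo (O : Set ℝ) (F : ℝ → TF) : Prop :=
  ∀ t ∈ O, ∀ x, ContDiffAt ℝ (⊤ : ℕ∞) (fun q : ℝ × Spc 3 => (F q.1).1 q.2) (t, x)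

/-- The time derivative of a curve in `TF`. -/
def ddt (F : ℝ → TF) (t : ℝ) : TF := toTF fun x => deriv (fun s => (F s).1 x) t

variable {O : Set ℝ} {F G : ℝ → TF} {t : ℝ}

theorem Smo.mono {O' : Set ℝ} (h : Smo O F) (hO : O' ⊆ O) : Smo O' F := fun t ht => h t (hO ht)

theorem Smo.congr (hO : IsOpen O) (h : Smo O F) (hFG : ∀ s ∈ O, G s = F s) : Smo O G :=
  fun t ht x => (h t ht x).congr_of_eventuallyEq <| by
    filter_upwards [(hO.preimage continuous_fst).mem_nhds (show (t, x) ∈ Prod.fst ⁻¹' O from ht)]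
      with q hq
    rw [hFG q.1 hq]

theorem Smo.const (f : TF) : Smo O fun _ => f := fun _ _ _ =>
  (f.contDiff.comp contDiff_snd).contDiffAt

theorem Smo.add (hF : Smo O F) (hG : Smo O G) : Smo O fun s => F s + G s :=
  fun t ht x => (hF t ht x).add (hG t ht x)

theorem Smo.sub (hF : Smo O F) (hG : Smo O G) : Smo O fun s => F s - G s :=
  fun t ht x => (hF t ht x).sub (hG t ht x)

theorem Smo.mul (hF : Smo O F) (hG : Smo O G) : Smo O fun s => F s * G s :=
  fun t ht x => (hF t ht x).mul (hG t ht x)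

theorem Smo.smul (c : ℝ) (hF : Smo O F) : Smo O fun s => c • F s :=
  fun t ht x => contDiffAt_const.mul (hF t ht x)

theorem Smo.neg (hF : Smo O F) : Smo O fun s => -F s :=
  fun t ht x => (hF t ht x).neg

theorem Smo.sum {ι : Type*} {s : Finset ι} {F : ι → ℝ → TF} (h : ∀ i ∈ s, Smo O (F i)) :
    Smo O fun r => ∑ i ∈ s, F i r := fun t ht x => by
  simp only [TF.sum_apply]
  exact ContDiffAt.sum fun i hi => h i hi t ht x

theorem contDiffAt_fderiv_apply {Φ : ℝ × Spc 3 → ℝ} {z : ℝ × Spc 3}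
    (h : ContDiffAt ℝ (⊤ : ℕ∞) Φ z) (w : ℝ × Spc 3) :
    ContDiffAt ℝ (⊤ : ℕ∞) (fun q => fderiv ℝ Φ q w) z :=
  (h.fderiv_right (m := (⊤ : ℕ∞)) (by simp)).clm_apply contDiffAt_const

theorem fderiv_fderiv_apply {Φ : ℝ × Spc 3 → ℝ} {z : ℝ × Spc 3}
    (h : ContDiffAt ℝ (⊤ : ℕ∞) Φ z) (v w : ℝ × Spc 3) :
    fderiv ℝ (fun q => fderiv ℝ Φ q w) z v = fderiv ℝ (fun q => fderiv ℝ Φ q v) z w := by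
  have hd : DifferentiableAt ℝ (fderiv ℝ Φ) z :=
    (h.fderiv_right (m := (⊤ : ℕ∞)) (by simp)).differentiableAt (by simp)
  rw [fderiv_clm_apply hd (differentiableAt_const _),
    fderiv_clm_apply hd (differentiableAt_const _)]
  simpa using (h.isSymmSndFDerivAt (by
    simp only [minSmoothness_of_isRCLikeNormedField]
    exact WithTop.coe_le_coe.2 (le_top : (2 : ℕ∞) ≤ ⊤))) v w

theorem hasDerivAt_time {Φ : ℝ × Spc 3 → ℝ} {x : Spc 3}
    (h : ContDiffAt ℝ (⊤ : ℕ∞) Φ (t, x)) :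
    HasDerivAt (fun s => Φ (s, x)) (fderiv ℝ Φ (t, x) (1, 0)) t :=
  (h.differentiableAt (by simp)).hasFDerivAt.comp_hasDerivAt (f := fun s : ℝ => (s, x)) t
    ((hasDerivAt_id t).prodMk (hasDerivAt_const t x))

theorem pd_eq_fderiv {Φ : ℝ × Spc 3 → ℝ} {x : Spc 3} (i : Fin 3)
    (h : ContDiffAt ℝ (⊤ : ℕ∞) Φ (t, x)) :
    pd i (fun y => Φ (t, y)) x = fderiv ℝ Φ (t, x) (0, Pi.single i 1) := by
  have h1 : HasFDerivAt (fun y : Spc 3 => (t, y))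
      ((0 : Spc 3 →L[ℝ] ℝ).prod (ContinuousLinearMap.id ℝ (Spc 3))) x :=
    (hasFDerivAt_const t x).prodMk (hasFDerivAt_id x)
  have h2 := (h.differentiableAt (by simp)).hasFDerivAt.comp x h1
  rw [pd]
  change fderiv ℝ (Φ ∘ fun y => (t, y)) x _ = _
  rw [h2.fderiv]
  rfl

theorem Smo.ddt_val (h : Smo O F) (ht : t ∈ O) :
    (ddt F t).1 = fun x => fderiv ℝ (fun q : ℝ × Spc 3 => (F q.1).1 q.2) (t, x) (1, 0) := by
  have e : (fun x => deriv (fun s => (F s).1 x) t) =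
      fun x => fderiv ℝ (fun q : ℝ × Spc 3 => (F q.1).1 q.2) (t, x) (1, 0) :=
    funext fun x => (hasDerivAt_time (h t ht x)).deriv
  rw [ddt, toTF_val, e]
  refine ⟨?_, fun x k => ?_⟩
  · rw [e]
    refine contDiff_iff_contDiffAt.2 fun x => ?_
    exact (contDiffAt_fderiv_apply (h t ht x) (1, 0)).comp (f := fun x : Spc 3 => (t, x)) x
      (by fun_prop)
  · simp only [(F _).2.2 x k]

theorem Smo.hasDerivAt (h : Smo O F) (ht : t ∈ O) (x : Spc 3) :
    HasDerivAt (fun s => (F s).1 x) ((ddt F t).1 x) t := by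
  rw [h.ddt_val ht]
  exact hasDerivAt_time (h t ht x)

theorem Smo.ddt_eq (h : Smo O F) (ht : t ∈ O) {g : TF}
    (hg : ∀ x, HasDerivAt (fun s => (F s).1 x) (g.1 x) t) : ddt F t = g :=
  Subtype.ext <| funext fun x => (h.hasDerivAt ht x).unique (hg x)

theorem Smo.ddt (hO : IsOpen O) (h : Smo O F) : Smo O (ddt F) := fun t ht x =>
  (contDiffAt_fderiv_apply (h t ht x) (1, 0)).congr_of_eventuallyEq <| by
    filter_upwards [(hO.preimage continuous_fst).mem_nhds (show (t, x) ∈ Prod.fst ⁻¹' O from ht)]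
      with q hq
    rw [h.ddt_val hq]

theorem Smo.dx_apply (h : Smo O F) (i : Fin 3) (ht : t ∈ O) (x : Spc 3) :
    (dx i (F t)).1 x =
      fderiv ℝ (fun q : ℝ × Spc 3 => (F q.1).1 q.2) (t, x) (0, Pi.single i 1) := by
  rw [dx_val]
  exact pd_eq_fderiv i (h t ht x)

theorem Smo.dx (hO : IsOpen O) (i : Fin 3) (h : Smo O F) : Smo O fun s => dx i (F s) :=
  fun t ht x => (contDiffAt_fderiv_apply (h t ht x) (0, Pi.single i 1)).congr_of_eventuallyEq <| by
    filter_upwards [(hO.preimage continuous_fst).mem_nhds (show (t, x) ∈ Prod.fst ⁻¹' O from ht)]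
      with q hq
    exact h.dx_apply i hq q.2

theorem ddt_dx (hO : IsOpen O) (i : Fin 3) (h : Smo O F) (ht : t ∈ O) :
    ddt (fun s => dx i (F s)) t = dx i (ddt F t) := by
  refine Subtype.ext <| funext fun x => ?_
  rw [(h.dx hO i).ddt_val ht, (h.ddt hO).dx_apply i ht]
  have hn : ∀ᶠ q : ℝ × Spc 3 in 𝓝 (t, x), q.1 ∈ O :=
    (hO.preimage continuous_fst).mem_nhds (show (t, x) ∈ Prod.fst ⁻¹' O from ht)
  have e1 : (fun q : ℝ × Spc 3 => (dx i (F q.1)).1 q.2) =ᶠ[𝓝 (t, x)]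
      fun q => fderiv ℝ (fun q : ℝ × Spc 3 => (F q.1).1 q.2) q (0, Pi.single i 1) := by
    filter_upwards [hn] with q hq
    exact h.dx_apply i hq q.2
  have e2 : (fun q : ℝ × Spc 3 => (ddt F q.1).1 q.2) =ᶠ[𝓝 (t, x)]
      fun q => fderiv ℝ (fun q : ℝ × Spc 3 => (F q.1).1 q.2) q (1, 0) := by
    filter_upwards [hn] with q hq
    rw [h.ddt_val hq]
  simp only [e1.fderiv_eq, e2.fderiv_eq]
  exact fderiv_fderiv_apply (h t ht x) _ _

theorem ddt_add (hF : Smo O F) (hG : Smo O G) (ht : t ∈ O) :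
    ddt (fun s => F s + G s) t = ddt F t + ddt G t :=
  (hF.add hG).ddt_eq ht fun x => (hF.hasDerivAt ht x).add (hG.hasDerivAt ht x)

theorem ddt_sub (hF : Smo O F) (hG : Smo O G) (ht : t ∈ O) :
    ddt (fun s => F s - G s) t = ddt F t - ddt G t :=
  (hF.sub hG).ddt_eq ht fun x => (hF.hasDerivAt ht x).sub (hG.hasDerivAt ht x)

theorem ddt_smul (c : ℝ) (hF : Smo O F) (ht : t ∈ O) :
    ddt (fun s => c • F s) t = c • ddt F t :=
  (hF.smul c).ddt_eq ht fun x => (hF.hasDerivAt ht x).const_mul c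

theorem ddt_mul (hF : Smo O F) (hG : Smo O G) (ht : t ∈ O) :
    ddt (fun s => F s * G s) t = ddt F t * G t + F t * ddt G t :=
  (hF.mul hG).ddt_eq ht fun x => (hF.hasDerivAt ht x).mul (hG.hasDerivAt ht x)

theorem ddt_sum {ι : Type*} {s : Finset ι} {F : ι → ℝ → TF} (h : ∀ i ∈ s, Smo O (F i))
    (ht : t ∈ O) : ddt (fun r => ∑ i ∈ s, F i r) t = ∑ i ∈ s, ddt (F i) t :=
  (Smo.sum h).ddt_eq ht fun x => by
    simp only [TF.sum_apply]
    exact HasDerivAt.fun_sum fun i hi => (h i hi).hasDerivAt ht x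

theorem ddt_congr (hO : IsOpen O) (hF : Smo O F) (hFG : ∀ s ∈ O, G s = F s) (ht : t ∈ O) :
    ddt G t = ddt F t :=
  (hF.congr hO hFG).ddt_eq ht fun x => (hF.hasDerivAt ht x).congr_of_eventuallyEq <| by
    filter_upwards [hO.mem_nhds ht] with s hs
    rw [hFG s hs]

theorem Smo.hasDerivAt_integ (hO : IsOpen O) (h : Smo O F) (ht : t ∈ O) :
    HasDerivAt (fun s => integ (F s)) (integ (NSRelax.ddt F t)) t := by
  refine hasDerivAt_integral_cube (F := fun s x => (F s).1 x)
    (F' := fun s x => (NSRelax.ddt F s).1 x) hO (fun s _ => (F s).continuous) ?_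
    (fun s hs x => h.hasDerivAt hs x) ht
  rintro ⟨s, x⟩ ⟨hs, -⟩
  exact ((h.ddt hO) s hs x).continuousAt.continuousWithinAt

/-- The inner product of second derivatives. -/
def b2 (f g : TF) : ℝ := ∑ k, ∑ l, integ (dx k (dx l f) * dx k (dx l g))

theorem b2_self (f : TF) : b2 f f = d2sq f := rfl

theorem Smo.hasDerivAt_nsq (hO : IsOpen O) (h : Smo O F) (ht : t ∈ O) :
    HasDerivAt (fun s => nsq (F s)) (2 * integ (F t * NSRelax.ddt F t)) t := by
  refine ((h.mul h).hasDerivAt_integ hO ht).congr_deriv ?_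
  rw [ddt_mul h h ht, map_add, mul_comm (NSRelax.ddt F t)]
  ring

theorem Smo.hasDerivAt_d2sq (hO : IsOpen O) (h : Smo O F) (ht : t ∈ O) :
    HasDerivAt (fun s => d2sq (F s)) (2 * b2 (F t) (NSRelax.ddt F t)) t := by
  simp only [d2sq, b2, Finset.mul_sum]
  refine HasDerivAt.fun_sum fun k _ => HasDerivAt.fun_sum fun l _ =>
    (((h.dx hO l).dx hO k).hasDerivAt_nsq hO ht).congr_deriv ?_
  rw [ddt_dx hO k (h.dx hO l) ht, ddt_dx hO l h ht]

theorem Smo.continuousOn_hsq (hO : IsOpen O) (h : Smo O F) :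
    ContinuousOn (fun s => hsq (F s)) O := fun _ ht =>
  ((h.hasDerivAt_nsq hO ht).add (h.hasDerivAt_d2sq hO ht)).continuousAt.continuousWithinAt

theorem L2sq_eq {ι : Type*} [Fintype ι] {v : Spc 3 → ι → ℝ} {V : ι → TF}
    (h : ∀ a x, v x a = (V a).1 x) : L2sq v = ∑ a, nsq (V a) := by
  simp only [nsq, ← map_sum]
  rw [L2sq, integ_def]
  refine integral_congr_ae (Eventually.of_forall fun x => ?_)
  simp only [ptsq, h, TF.sum_apply]
  exact Finset.sum_congr rfl fun a _ => sq _

theorem D2L2sq_eq {ι : Type*} [Fintype ι] {v : Spc 3 → ι → ℝ} {V : ι → TF}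
    (h : ∀ a x, v x a = (V a).1 x) : D2L2sq v = ∑ a, d2sq (V a) := by
  simp only [d2sq, nsq, ← map_sum]
  rw [D2L2sq, integ_def]
  refine integral_congr_ae (Eventually.of_forall fun x => ?_)
  have e : ∀ a, (fun y => v y a) = (V a).1 := fun a => funext (h a)
  simp only [ptsqD2, e, TF.sum_apply, ← dx_val]
  exact Finset.sum_congr rfl fun a _ => Finset.sum_congr rfl fun k _ =>
    Finset.sum_congr rfl fun l _ => sq _

end TimeCurves

section WeightedForms

open Set Filter Topology

/-- The inner product `⟨f, g⟩ + θ ⟨∇²f, ∇²g⟩`, linear in `g`. -/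
def ip (θ : ℝ) (f : TF) : TF →ₗ[ℝ] ℝ :=
  integ ∘ₗ LinearMap.mulLeft ℝ f + θ • ∑ k, ∑ l, integ ∘ₗ LinearMap.mulLeft ℝ (dx k (dx l f)) ∘ₗ
    (dx k : TF →ₗ[ℝ] TF) ∘ₗ (dx l : TF →ₗ[ℝ] TF)

theorem ip_apply (θ : ℝ) (f g : TF) : ip θ f g = integ (f * g) + θ * b2 f g := by
  simp [ip, b2]

/-- The weighted square norm `‖f‖² + θ ‖∇²f‖²`. -/
def hn (θ : ℝ) (f : TF) : ℝ := nsq f + θ * d2sq f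

theorem ip_self (θ : ℝ) (f : TF) : ip θ f f = hn θ f := by
  rw [ip_apply, b2_self, hn, nsq]

theorem hn_one (f : TF) : hn 1 f = hsq f := by rw [hn, hsq, one_mul]

theorem ip_comm (θ : ℝ) (f g : TF) : ip θ f g = ip θ g f := by
  simp only [ip_apply, b2, mul_comm]

theorem ip_dx (θ : ℝ) (i : Fin 3) (f g : TF) : ip θ f (dx i g) = -ip θ (dx i f) g := by
  have h : b2 f (dx i g) = -b2 (dx i f) g := by
    simp only [b2, ← Finset.sum_neg_distrib]
    refine Finset.sum_congr rfl fun k _ => Finset.sum_congr rfl fun l _ => ?_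
    rw [dx_comm l i g, dx_comm k i, integ_mul_dx, dx_comm i k, dx_comm i l f]
  rw [ip_apply, ip_apply, h, integ_mul_dx]
  ring

theorem hn_nonneg {θ : ℝ} (hθ : 0 ≤ θ) (f : TF) : 0 ≤ hn θ f :=
  add_nonneg (nsq_nonneg f) (mul_nonneg hθ (d2sq_nonneg f))

theorem hn_le_hsq {θ : ℝ} (hθ1 : θ ≤ 1) (f : TF) : hn θ f ≤ hsq f := by
  rw [hn, hsq]
  nlinarith [d2sq_nonneg f]

theorem hn_add_smul (θ c : ℝ) (f g : TF) :
    hn θ (f + c • g) = hn θ f + 2 * c * ip θ f g + c ^ 2 * hn θ g := by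
  rw [← ip_self, map_add, map_smul, ip_comm θ _ f, ip_comm θ _ g, map_add, map_smul, map_add,
    map_smul, ip_self, ip_self, ip_comm θ g f]
  simp only [smul_eq_mul]
  ring

theorem two_ip_le {θ : ℝ} (hθ : 0 ≤ θ) (f g : TF) : 2 * ip θ f g ≤ hn θ f + hn θ g := by
  have h := hn_add_smul θ (-1) f g
  have := hn_nonneg hθ (f + (-1 : ℝ) • g)
  linarith

theorem neg_two_ip_le {θ : ℝ} (hθ : 0 ≤ θ) (f g : TF) : -(2 * ip θ f g) ≤ hn θ f + hn θ g := by
  have h := hn_add_smul θ 1 f g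
  have := hn_nonneg hθ (f + (1 : ℝ) • g)
  linarith

theorem abs_ip_le {θ : ℝ} (hθ : 0 ≤ θ) (f g : TF) : |ip θ f g| ≤ √(hn θ f) * √(hn θ g) := by
  have h : ∀ t : ℝ, 0 ≤ hn θ g * (t * t) + 2 * ip θ f g * t + hn θ f := fun t => by
    have h1 := hn_nonneg hθ (f + t • g)
    rw [hn_add_smul] at h1
    linarith
  have h2 := discrim_le_zero h
  rw [discrim] at h2
  rw [← sqrt_mul (hn_nonneg hθ f)]
  refine abs_le_sqrt ?_
  linarith

theorem hn_add_le {θ : ℝ} (hθ : 0 ≤ θ) (f g : TF) : hn θ (f + g) ≤ 2 * (hn θ f + hn θ g) := by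
  have h1 := hn_add_smul θ 1 f g
  have h2 := two_ip_le hθ f g
  rw [one_smul] at h1
  linarith

theorem Smo.hasDerivAt_hn {O : Set ℝ} {F : ℝ → TF} {t : ℝ} (θ : ℝ) (hO : IsOpen O) (h : Smo O F)
    (ht : t ∈ O) : HasDerivAt (fun s => hn θ (F s)) (2 * ip θ (F t) (NSRelax.ddt F t)) t := by
  refine ((h.hasDerivAt_nsq hO ht).add ((h.hasDerivAt_d2sq hO ht).const_mul θ)).congr_deriv ?_
  rw [ip_apply]
  ring

theorem hn_mul_le {θ : ℝ} (hθ : 0 ≤ θ) {M K : ℝ} {f g : TF} (hM : ∀ x, f.1 x ^ 2 ≤ M)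
    (hK : ∀ x, g.1 x ^ 2 ≤ K) : hn θ (f * g) ≤ 700 * (M * hn θ g + K * (θ * d2sq f)) := by
  have h1 := nsq_mul_le hM g
  have h2 := mul_le_mul_of_nonneg_left (d2sq_mul_le hM hK) hθ
  have h3 : 0 ≤ M * nsq g := mul_nonneg ((sq_nonneg _).trans (hM 0)) (nsq_nonneg g)
  rw [hn, hn]
  linarith

/-- The weighted energy of a state of the relaxation system. -/
def energy (θ ε δ : ℝ) (P : TF) (N : Fin 3 → TF) (S : Fin 3 → Fin 3 → TF) : ℝ :=
  ε * hn θ P + ∑ a, hn θ (N a) + δ * ∑ i, ∑ j, hn θ (S i j)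

section Energy

variable {θ ε δ : ℝ} {P : TF} {N : Fin 3 → TF} {S : Fin 3 → Fin 3 → TF}

theorem energy_nonneg (hθ : 0 ≤ θ) (hε : 0 ≤ ε) (hδ : 0 ≤ δ) : 0 ≤ energy θ ε δ P N S := by
  have h1 := hn_nonneg hθ P
  have h2 : 0 ≤ ∑ a, hn θ (N a) := Finset.sum_nonneg fun a _ => hn_nonneg hθ _
  have h3 : 0 ≤ ∑ i, ∑ j, hn θ (S i j) :=
    Finset.sum_nonneg fun i _ => Finset.sum_nonneg fun j _ => hn_nonneg hθ _
  unfold energy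
  positivity

theorem le_energy (hθ : 0 ≤ θ) (hε : 0 ≤ ε) (hδ : 0 ≤ δ) :
    ε * hn θ P ≤ energy θ ε δ P N S ∧ ∑ a, hn θ (N a) ≤ energy θ ε δ P N S ∧
      δ * ∑ i, ∑ j, hn θ (S i j) ≤ energy θ ε δ P N S := by
  have h1 := mul_nonneg hε (hn_nonneg hθ P)
  have h2 : 0 ≤ ∑ a, hn θ (N a) := Finset.sum_nonneg fun a _ => hn_nonneg hθ _
  have h3 : 0 ≤ δ * ∑ i, ∑ j, hn θ (S i j) := mul_nonneg hδ <|
    Finset.sum_nonneg fun i _ => Finset.sum_nonneg fun j _ => hn_nonneg hθ _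
  unfold energy
  refine ⟨?_, ?_, ?_⟩ <;> linarith

theorem hn_le_energy (hθ : 0 ≤ θ) (hε : 0 ≤ ε) (hδ : 0 ≤ δ) (a : Fin 3) :
    hn θ (N a) ≤ energy θ ε δ P N S :=
  (Finset.single_le_sum (f := fun a => hn θ (N a)) (fun _ _ => hn_nonneg hθ _)
    (Finset.mem_univ a)).trans (le_energy hθ hε hδ).2.1

theorem hn_stress_le_energy (hθ : 0 ≤ θ) (hε : 0 ≤ ε) (hδ : 0 ≤ δ) (i j : Fin 3) :
    δ * hn θ (S i j) ≤ energy θ ε δ P N S := by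
  refine le_trans (mul_le_mul_of_nonneg_left ?_ hδ) (le_energy hθ hε hδ).2.2
  refine le_trans ?_ (Finset.single_le_sum (f := fun i => ∑ j, hn θ (S i j))
    (fun i _ => Finset.sum_nonneg fun _ _ => hn_nonneg hθ _) (Finset.mem_univ i))
  exact Finset.single_le_sum (f := fun j => hn θ (S i j)) (fun _ _ => hn_nonneg hθ _)
    (Finset.mem_univ j)

theorem hyperbolic_identity {P' Q : TF} {N' : Fin 3 → TF} {S' R : Fin 3 → Fin 3 → TF}
    (h1 : ε • P' + ∑ i, dx i (N i) = Q) (h2 : ∀ a, N' a + ∑ j, dx j (S a j) + dx a P = 0)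
    (h3 : ∀ i j, δ • S' i j + dx j (N i) = R i j) :
    ε * ip θ P P' + ∑ a, ip θ (N a) (N' a) + δ * ∑ i, ∑ j, ip θ (S i j) (S' i j) =
      ip θ P Q + ∑ i, ∑ j, ip θ (S i j) (R i j) := by
  have e2 : ∀ a, ip θ (N a) (N' a) =
      ∑ j, ip θ (dx j (N a)) (S a j) + ip θ (dx a (N a)) P := fun a => by
    have h : N' a = -(∑ j, dx j (S a j)) - dx a P := by linear_combination h2 a
    rw [h, map_sub, map_neg, map_sum, ip_dx]
    simp only [ip_dx, Finset.sum_neg_distrib]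
    ring
  have e3 : ∀ i j, ip θ (S i j) (R i j) =
      δ * ip θ (S i j) (S' i j) + ip θ (dx j (N i)) (S i j) := fun i j => by
    rw [← h3, map_add, map_smul, ip_comm θ _ (dx j (N i))]
    rfl
  rw [← h1]
  simp only [e2, e3, map_add, map_smul, map_sum, smul_eq_mul, Finset.sum_add_distrib,
    Finset.mul_sum, ip_comm θ P (dx _ _)]
  ring

end Energy

theorem hasDerivAt_energy {O : Set ℝ} (hO : IsOpen O) (θ ε δ : ℝ) {P : ℝ → TF}
    {N : Fin 3 → ℝ → TF} {S : Fin 3 → Fin 3 → ℝ → TF} (hP : Smo O P) (hN : ∀ a, Smo O (N a))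
    (hS : ∀ i j, Smo O (S i j)) {Q : TF} {R : Fin 3 → Fin 3 → TF} {t : ℝ} (ht : t ∈ O)
    (h1 : ε • ddt P t + ∑ i, dx i (N i t) = Q)
    (h2 : ∀ a, ddt (N a) t + ∑ j, dx j (S a j t) + dx a (P t) = 0)
    (h3 : ∀ i j, δ • ddt (S i j) t + dx j (N i t) = R i j) :
    HasDerivAt (fun s => energy θ ε δ (P s) (fun a => N a s) fun i j => S i j s)
      (2 * (ip θ (P t) Q + ∑ i, ∑ j, ip θ (S i j t) (R i j))) t := by
  rw [← hyperbolic_identity (N' := fun a => ddt (N a) t) (S' := fun i j => ddt (S i j) t) h1 h2 h3]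
  refine ((((hP.hasDerivAt_hn θ hO ht).const_mul ε).add
    (HasDerivAt.fun_sum fun a _ => (hN a).hasDerivAt_hn θ hO ht)).add
    ((HasDerivAt.fun_sum fun i _ => HasDerivAt.fun_sum fun j _ =>
      (hS i j).hasDerivAt_hn θ hO ht).const_mul δ)).congr_deriv ?_
  simp only [← Finset.mul_sum]
  ring

theorem sq_apply_le_hn {θ : ℝ} (hθ : 0 < θ) (hθ1 : θ ≤ 1) (f : TF) (x : Spc 3) :
    f.1 x ^ 2 ≤ 120 * (θ ^ (-(3 / 4 : ℝ)) * hn θ f) := by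
  set r : ℝ := θ ^ (1 / 4 : ℝ) with hr
  have hr0 : 0 < r := rpow_pos_of_pos hθ _
  have h1 : (r ^ 3)⁻¹ = θ ^ (-(3 / 4 : ℝ)) := by
    rw [hr, ← rpow_natCast, ← rpow_mul hθ.le, ← rpow_neg hθ.le]
    norm_num
  have h2 : r = θ ^ (-(3 / 4 : ℝ)) * θ := by
    have : θ ^ (-(3 / 4 : ℝ)) * θ = θ ^ (-(3 / 4 : ℝ)) * θ ^ (1 : ℝ) := by rw [rpow_one]
    rw [hr, this, ← rpow_add hθ]
    norm_num
  have h := sq_apply_le f hr0 (rpow_le_one hθ.le hθ1 (by norm_num)) x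
  rw [h1] at h
  nth_rewrite 1 [h2] at h
  refine h.trans (le_of_eq ?_)
  rw [hn]
  ring

theorem hn_mul_self_le {θ : ℝ} (hθ : 0 < θ) (hθ1 : θ ≤ 1) (f g : TF) :
    hn θ (f * g) ≤ 168000 * (θ ^ (-(3 / 4 : ℝ)) * (hn θ f * hn θ g)) := by
  have h := hn_mul_le hθ.le (sq_apply_le_hn hθ hθ1 f) (sq_apply_le_hn hθ hθ1 g)
  have h1 : θ * d2sq f ≤ hn θ f := by
    have := nsq_nonneg f
    rw [hn]
    linarith
  have h2 : 0 ≤ 120 * (θ ^ (-(3 / 4 : ℝ)) * hn θ g) :=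
    mul_nonneg (by norm_num) (mul_nonneg (rpow_nonneg hθ.le _) (hn_nonneg hθ.le g))
  have h3 := mul_le_mul_of_nonneg_left h1 h2
  refine h.trans ?_
  linarith

theorem hn_mul_le_hsq_mul {θ : ℝ} (hθ : 0 ≤ θ) (hθ1 : θ ≤ 1) (f g : TF) :
    hn θ (f * g) ≤ 168000 * (hsq f * hn θ g) := by
  have h := hn_mul_le hθ (sq_apply_le_hsq f) (sq_apply_le_hsq g)
  have h1 : θ * hsq g ≤ hn θ g := by
    have := nsq_nonneg g
    rw [hn, hsq]
    nlinarith
  have h2 : d2sq f ≤ hsq f := by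
    have := nsq_nonneg f
    rw [hsq]
    linarith
  have h3 := mul_le_mul h1 h2 (d2sq_nonneg f) (hn_nonneg hθ g)
  refine h.trans ?_
  linarith

theorem ip_le_of_mul_le {θ c E B : ℝ} (hθ : 0 ≤ θ) (hc : 0 < c) (f g : TF)
    (hf : c * hn θ f ≤ E) (hg : hn θ g ≤ B) : |c * ip θ f g| ≤ √B * √(c * E) := by
  rw [abs_mul, abs_of_pos hc]
  have h1 := abs_ip_le hθ f g
  have h2 : c * √(hn θ f) ≤ √(c * E) := by
    refine le_sqrt_of_sq_le ?_
    rw [mul_pow, sq_sqrt (hn_nonneg hθ f), sq, mul_assoc]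
    exact mul_le_mul_of_nonneg_left hf hc.le
  calc _ ≤ c * (√(hn θ f) * √(hn θ g)) := mul_le_mul_of_nonneg_left h1 hc.le
    _ = √(hn θ g) * (c * √(hn θ f)) := by ring
    _ ≤ _ := mul_le_mul (sqrt_le_sqrt hg) h2 (by positivity) (sqrt_nonneg _)

theorem energy_rate_le {θ ε δ B : ℝ} (hθ : 0 < θ) (hθ1 : θ ≤ 1) (hε : 0 < ε) (hδ : 0 < δ)
    {P pt : TF} {N u : Fin 3 → TF} {S Ut : Fin 3 → Fin 3 → TF} (hu : ∀ a, hsq (u a) ≤ B)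
    (hpt : hsq pt ≤ B) (hUt : ∀ i j, hsq (Ut i j) ≤ B) :
    2 * (ip θ P (-(ε • pt)) + ∑ i, ∑ j, ip θ (S i j)
      (u i * N j + N i * u j + N i * N j - S i j - δ • Ut i j)) ≤
      (20 * √B + 20000000 * B + 20000000) * (√((ε + δ) * energy θ ε δ P N S) +
        energy θ ε δ P N S + θ ^ (-(3 / 4 : ℝ)) * energy θ ε δ P N S ^ 2) := by
  set E := energy θ ε δ P N S with hE
  set κ := θ ^ (-(3 / 4 : ℝ)) with hκ
  have hE0 : 0 ≤ E := energy_nonneg hθ.le hε.le hδ.le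
  have hκ0 : 0 ≤ κ := rpow_nonneg hθ.le _
  have hB0 : 0 ≤ B := (hsq_nonneg pt).trans hpt
  set r := √((ε + δ) * E) with hr
  have hr0 : 0 ≤ r := sqrt_nonneg _
  have hNE : ∀ a, hn θ (N a) ≤ E := hn_le_energy hθ.le hε.le hδ.le
  have t1 : ip θ P (-(ε • pt)) ≤ √B * r := by
    rw [map_neg, map_smul, smul_eq_mul]
    have h := ip_le_of_mul_le hθ.le hε P pt (le_energy hθ.le hε.le hδ.le (N := N) (S := S)).1
      ((hn_le_hsq hθ1 pt).trans hpt)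
    refine (neg_le_abs _).trans (h.trans (mul_le_mul_of_nonneg_left (sqrt_le_sqrt ?_)
      (sqrt_nonneg B)))
    nlinarith
  have t2 : ∀ i j, ip θ (S i j) (u i * N j + N i * u j + N i * N j - S i j - δ • Ut i j) ≤
      √B * r + (672000 * B * E + 168000 * κ * E ^ 2) := fun i j => by
    rw [map_sub, map_smul, smul_eq_mul, map_sub, ip_self]
    have h1 : -(δ * ip θ (S i j) (Ut i j)) ≤ √B * r := by
      have h := ip_le_of_mul_le hθ.le hδ (S i j) (Ut i j)
        (hn_stress_le_energy hθ.le hε.le hδ.le (P := P) (N := N) (S := S) i j)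
        ((hn_le_hsq hθ1 _).trans (hUt i j))
      refine (neg_le_abs _).trans (h.trans (mul_le_mul_of_nonneg_left (sqrt_le_sqrt ?_)
        (sqrt_nonneg B)))
      nlinarith
    have h2 := two_ip_le hθ.le (S i j) (u i * N j + N i * u j + N i * N j)
    have h3 := hn_add_le hθ.le (u i * N j + N i * u j) (N i * N j)
    have h4 := hn_add_le hθ.le (u i * N j) (N i * u j)
    have h5 : hn θ (u i * N j) ≤ 168000 * (B * E) := (hn_mul_le_hsq_mul hθ.le hθ1 _ _).trans <|
      mul_le_mul_of_nonneg_left (mul_le_mul (hu i) (hNE j) (hn_nonneg hθ.le _) hB0) (by norm_num)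
    have h6 : hn θ (N i * u j) ≤ 168000 * (B * E) := by
      rw [mul_comm]
      exact (hn_mul_le_hsq_mul hθ.le hθ1 _ _).trans <|
        mul_le_mul_of_nonneg_left (mul_le_mul (hu j) (hNE i) (hn_nonneg hθ.le _) hB0) (by norm_num)
    have h7 : hn θ (N i * N j) ≤ 168000 * (κ * (E * E)) := (hn_mul_self_le hθ hθ1 _ _).trans <|
      mul_le_mul_of_nonneg_left (mul_le_mul_of_nonneg_left (mul_le_mul (hNE i) (hNE j)
        (hn_nonneg hθ.le _) hE0) hκ0) (by norm_num)
    have h8 := hn_nonneg hθ.le (S i j)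
    linarith
  have t3 : ∑ i, ∑ j, ip θ (S i j) (u i * N j + N i * u j + N i * N j - S i j - δ • Ut i j) ≤
      ∑ _i : Fin 3, ∑ _j : Fin 3, (√B * r + (672000 * B * E + 168000 * κ * E ^ 2)) :=
    Finset.sum_le_sum fun i _ => Finset.sum_le_sum fun j _ => t2 i j
  simp only [Finset.sum_const, Finset.card_univ, Fintype.card_fin, nsmul_eq_mul] at t3
  push_cast at t3
  have hsB := sqrt_nonneg B
  have p1 := mul_nonneg hsB hE0
  have p2 := mul_nonneg hB0 hr0
  have p3 := mul_nonneg hB0 hE0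
  have p4 : 0 ≤ κ * E ^ 2 := by positivity
  have p5 := mul_nonneg hsB p4
  have p6 := mul_nonneg hB0 p4
  linarith

end WeightedForms

section Solutions

open Set Filter Topology

/-- A Navier–Stokes solution given by curves in `TF`. -/
structure NSCurve (I : Set ℝ) (p : ℝ → TF) (u : Fin 3 → ℝ → TF) : Prop where
  smo_p : Smo univ p
  smo_u : ∀ a, Smo univ (u a)
  div_free : ∀ t ∈ I, ∑ i, dx i (u i t) = 0
  momentum : ∀ t ∈ I, ∀ a,
    ddt (u a) t = ∑ j, dx j (dx j (u a t)) - ∑ j, dx j (u a t * u j t) - dx a (p t)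
  mean_zero : ∀ t ∈ I, integ (p t) = 0

/-- The stress tensor of a velocity field. -/
def str (u : Fin 3 → ℝ → TF) (i j : Fin 3) (t : ℝ) : TF := u i t * u j t - dx j (u i t)

theorem NSCurve.smo_str {I : Set ℝ} {p : ℝ → TF} {u : Fin 3 → ℝ → TF} (h : NSCurve I p u)
    (i j : Fin 3) : Smo univ (str u i j) :=
  ((h.smo_u i).mul (h.smo_u j)).sub ((h.smo_u i).dx isOpen_univ j)

/-- Open time interval `(0, Tl)`. -/
def Oitv (Tl : ℝ≥0∞) : Set ℝ := {t : ℝ | 0 < t ∧ ENNReal.ofReal t < Tl}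

theorem isOpen_Oitv (Tl : ℝ≥0∞) : IsOpen (Oitv Tl) :=
  isOpen_Ioi.inter (isOpen_Iio.preimage ENNReal.continuous_ofReal)

theorem Oitv_subset (Tl : ℝ≥0∞) : Oitv Tl ⊆ Itv Tl := fun _ h => ⟨h.1.le, h.2⟩

/-- A solution of the relaxation system given by curves in `TF`, on a set of positive times. -/
structure RelCurve (O : Set ℝ) (ε δ : ℝ) (P : ℝ → TF) (N : Fin 3 → ℝ → TF)
    (S : Fin 3 → Fin 3 → ℝ → TF) : Prop where
  smo_P : Smo O P
  smo_N : ∀ a, Smo O (N a)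
  smo_S : ∀ i j, Smo O (S i j)
  mass : ∀ t ∈ O, ε • ddt P t + ∑ i, dx i (N i t) = 0
  momentum : ∀ t ∈ O, ∀ a, ddt (N a) t + ∑ j, dx j (S a j t) + dx a (P t) = 0
  stress : ∀ t ∈ O, ∀ i j, δ • ddt (S i j) t + dx j (N i t) = N i t * N j t - S i j t

theorem smo_toTF {O : Set ℝ} (hO : IsOpen O) {f : ℝ → Spc 3 → ℝ}
    (hs : ∀ t ∈ O, ∀ x, ContDiffAt ℝ (⊤ : ℕ∞) (fun q : ℝ × Spc 3 => f q.1 q.2) (t, x))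
    (hp : ∀ t ∈ O, Per (f t)) :
    (∀ t ∈ O, (toTF (f t)).1 = f t) ∧ Smo O fun t => toTF (f t) := by
  have hv : ∀ t ∈ O, (toTF (f t)).1 = f t := fun t ht => toTF_val
    ⟨contDiff_iff_contDiffAt.2 fun x =>
      (hs t ht x).comp (f := fun x : Spc 3 => (t, x)) x (by fun_prop), hp t ht⟩
  refine ⟨hv, fun t ht x => (hs t ht x).congr_of_eventuallyEq ?_⟩
  filter_upwards [(hO.preimage continuous_fst).mem_nhds (show (t, x) ∈ Prod.fst ⁻¹' O from ht)]
    with q hq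
  rw [hv q.1 hq]

theorem ddt_toTF_apply {O : Set ℝ} (hO : IsOpen O) {f : ℝ → Spc 3 → ℝ}
    (hv : ∀ t ∈ O, (toTF (f t)).1 = f t) (hs : Smo O fun t => toTF (f t)) {t : ℝ} (ht : t ∈ O)
    (x : Spc 3) : (ddt (fun t => toTF (f t)) t).1 x = deriv (fun s => f s x) t := by
  rw [← (hs.hasDerivAt ht x).deriv]
  refine Filter.EventuallyEq.deriv_eq ?_
  filter_upwards [hO.mem_nhds ht] with s hs
  rw [hv s hs]

section NS

variable {I : Set ℝ} {p : ℝ → Spc 3 → ℝ} {u : ℝ → Spc 3 → Vec 3}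

theorem IsNS.toTF_p (h : IsNS 3 I p u) :
    (∀ t ∈ (univ : Set ℝ), (toTF (p t)).1 = p t) ∧ Smo univ fun t => toTF (p t) :=
  smo_toTF isOpen_univ (fun _ _ _ => h.smooth_p.contDiffAt) fun t _ => h.per_p t

theorem IsNS.toTF_u (h : IsNS 3 I p u) (a : Fin 3) :
    (∀ t ∈ (univ : Set ℝ), (toTF fun x => u t x a).1 = fun x => u t x a) ∧
      Smo univ fun t => toTF fun x => u t x a :=
  smo_toTF (f := fun t x => u t x a) isOpen_univ
    (fun _ _ _ => (contDiff_pi.1 h.smooth_u a).contDiffAt)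
    fun t _ x k => congrFun (h.per_u t x k) a

theorem IsNS.nsCurve (h : IsNS 3 I p u) :
    NSCurve I (fun t => toTF (p t)) fun a t => toTF fun x => u t x a := by
  have hp := h.toTF_p
  have hu := h.toTF_u
  have hpv : ∀ t, (toTF (p t)).1 = p t := fun t => hp.1 t trivial
  have huv : ∀ a t, (toTF fun x => u t x a).1 = fun x => u t x a := fun a t => (hu a).1 t trivial
  refine ⟨hp.2, fun a => (hu a).2, fun t ht => ?_, fun t ht a => ?_, fun t ht => ?_⟩
  · refine Subtype.ext <| funext fun x => ?_
    rw [TF.sum_apply]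
    simp only [dx_val, huv]
    exact h.div_free t ht x
  · refine Subtype.ext <| funext fun x => ?_
    have e := ddt_toTF_apply (f := fun t x => u t x a) isOpen_univ (hu a).1 (hu a).2
      (mem_univ t) x
    have h1 := h.momentum t ht x a
    have e2 : ∀ j, (dx j ((toTF fun x => u t x a) * toTF fun x => u t x j)).1 x =
        pd j (fun y => tens (u t) (u t) y a j) x := fun j => by
      rw [dx_val]
      change pd j ((toTF fun x => u t x a).1 * (toTF fun x => u t x j).1) x = _
      rw [huv, huv]
      rfl
    have e3 : ∀ j, (dx j (dx j (toTF fun x => u t x a))).1 x =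
        pd j (pd j fun y => u t y a) x := fun j => by
      rw [dx_val, dx_val, huv]
    have e4 : (dx a (toTF (p t))).1 x = pd a (p t) x := by rw [dx_val, hpv]
    rw [e]
    change _ = (∑ j, dx j (dx j (toTF fun x => u t x a))).1 x - (∑ j, dx j
      ((toTF fun x => u t x a) * toTF fun x => u t x j)).1 x - (dx a (toTF (p t))).1 x
    rw [TF.sum_apply, TF.sum_apply, e4]
    simp only [e2, e3]
    simp only [dtV, divM, lapV, lapS] at h1
    linarith
  · rw [integ_def, hpv]
    exact h.mean_zero t ht

end NS

section Relax

variable {ε δ : ℝ} {Tl : ℝ≥0∞} {p : ℝ → Spc 3 → ℝ} {u : ℝ → Spc 3 → Vec 3}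
  {U : ℝ → Spc 3 → Fin 3 → Fin 3 → ℝ}

theorem IsRelax.toTF_p (h : IsRelax 3 ε δ Tl p u U) :
    (∀ t ∈ Oitv Tl, (toTF (p t)).1 = p t) ∧ Smo (Oitv Tl) fun t => toTF (p t) :=
  smo_toTF (isOpen_Oitv Tl) (fun t ht x => (h.smooth t (Oitv_subset Tl ht) ht.1 x).fst)
    fun t ht => h.per_p t (Oitv_subset Tl ht)

theorem IsRelax.toTF_u (h : IsRelax 3 ε δ Tl p u U) (a : Fin 3) :
    (∀ t ∈ Oitv Tl, (toTF fun x => u t x a).1 = fun x => u t x a) ∧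
      Smo (Oitv Tl) fun t => toTF fun x => u t x a :=
  smo_toTF (f := fun t x => u t x a) (isOpen_Oitv Tl)
    (fun t ht x => contDiffAt_pi.1 (h.smooth t (Oitv_subset Tl ht) ht.1 x).snd.fst a)
    fun t ht x k => congrFun (h.per_u t (Oitv_subset Tl ht) x k) a

theorem IsRelax.toTF_U (h : IsRelax 3 ε δ Tl p u U) (i j : Fin 3) :
    (∀ t ∈ Oitv Tl, (toTF fun x => U t x i j).1 = fun x => U t x i j) ∧
      Smo (Oitv Tl) fun t => toTF fun x => U t x i j :=
  smo_toTF (f := fun t x => U t x i j) (isOpen_Oitv Tl)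
    (fun t ht x => contDiffAt_pi.1 (contDiffAt_pi.1
      (h.smooth t (Oitv_subset Tl ht) ht.1 x).snd.snd i) j)
    fun t ht x k => congrFun (congrFun (h.per_U t (Oitv_subset Tl ht) x k) i) j

theorem IsRelax.relCurve (h : IsRelax 3 ε δ Tl p u U) :
    RelCurve (Oitv Tl) ε δ (fun t => toTF (p t)) (fun a t => toTF fun x => u t x a)
      fun i j t => toTF fun x => U t x i j := by
  have hO := isOpen_Oitv Tl
  have hp := h.toTF_p
  have hu := h.toTF_u
  have hU := h.toTF_U
  refine ⟨hp.2, fun a => (hu a).2, fun i j => (hU i j).2, fun t ht => ?_, fun t ht a => ?_,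
    fun t ht i j => ?_⟩
  · refine Subtype.ext <| funext fun x => ?_
    change ε * (ddt (fun t => toTF (p t)) t).1 x + (∑ i, dx i (toTF fun x => u t x i)).1 x = 0
    rw [TF.sum_apply, ddt_toTF_apply hO hp.1 hp.2 ht]
    simp only [dx_val, (hu _).1 t ht]
    exact h.mass t (Oitv_subset Tl ht) ht.1 x
  · refine Subtype.ext <| funext fun x => ?_
    change (ddt (fun t => toTF fun x => u t x a) t).1 x + (∑ j, dx j (toTF fun x => U t x a j)).1 x
      + (dx a (toTF (p t))).1 x = 0
    rw [TF.sum_apply, ddt_toTF_apply (f := fun t x => u t x a) hO (hu a).1 (hu a).2 ht, dx_val,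
      hp.1 t ht]
    simp only [dx_val, (hU _ _).1 t ht]
    exact h.momentum t (Oitv_subset Tl ht) ht.1 x a
  · refine Subtype.ext <| funext fun x => ?_
    change δ * (ddt (fun t => toTF fun x => U t x i j) t).1 x + (dx j (toTF fun x => u t x i)).1 x
      = (toTF fun x => u t x i).1 x * (toTF fun x => u t x j).1 x - (toTF fun x => U t x i j).1 x
    rw [ddt_toTF_apply (f := fun t x => U t x i j) hO (hU i j).1 (hU i j).2 ht, dx_val,
      (hU i j).1 t ht, (hu i).1 t ht, (hu j).1 t ht]
    exact h.stress_eq t (Oitv_subset Tl ht) ht.1 x i j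

theorem IsRelax.toTF_zero (h : IsRelax 3 ε δ Tl p u U) :
    (toTF (p 0)).1 = p 0 ∧ (∀ a, (toTF fun x => u 0 x a).1 = fun x => u 0 x a) ∧
      ∀ i j, (toTF fun x => U 0 x i j).1 = fun x => U 0 x i j := by
  have h0 : (0 : ℝ) ∈ Itv Tl := ⟨le_rfl, by simpa using h.pos⟩
  refine ⟨toTF_val ⟨h.init_smooth.fst, h.per_p 0 h0⟩, fun a => toTF_val
    ⟨contDiff_pi.1 h.init_smooth.snd.fst a, fun x k => congrFun (h.per_u 0 h0 x k) a⟩,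
    fun i j => toTF_val ⟨contDiff_pi.1 (contDiff_pi.1 h.init_smooth.snd.snd i) j, fun x k =>
      congrFun (congrFun (h.per_U 0 h0 x k) i) j⟩⟩

theorem IsRelax.toTF_val_Itv (h : IsRelax 3 ε δ Tl p u U) {t : ℝ} (ht : t ∈ Itv Tl) :
    (toTF (p t)).1 = p t ∧ (∀ a, (toTF fun x => u t x a).1 = fun x => u t x a) ∧
      ∀ i j, (toTF fun x => U t x i j).1 = fun x => U t x i j := by
  rcases ht.1.eq_or_lt with rfl | h0
  · exact h.toTF_zero
  · exact ⟨h.toTF_p.1 t ⟨h0, ht.2⟩, fun a => (h.toTF_u a).1 t ⟨h0, ht.2⟩,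
      fun i j => (h.toTF_U i j).1 t ⟨h0, ht.2⟩⟩

end Relax

theorem residual_mul (a b c d : TF) : a * b - c * d =
    c * (b - d) + (a - c) * d + (a - c) * (b - d) := by ring

theorem hasDerivAt_residual_energy {I O : Set ℝ} (hO : IsOpen O) {ε δ : ℝ} (θ : ℝ)
    {p P : ℝ → TF} {u N : Fin 3 → ℝ → TF} {S : Fin 3 → Fin 3 → ℝ → TF}
    (hN : NSCurve I p u) (hR : RelCurve O ε δ P N S) {t : ℝ} (ht : t ∈ O) (htI : t ∈ I) :
    HasDerivAt (fun s => energy θ ε δ (P s - p s) (fun a => N a s - u a s)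
        fun i j => S i j s - str u i j s)
      (2 * (ip θ (P t - p t) (-(ε • ddt p t)) + ∑ i, ∑ j, ip θ (S i j t - str u i j t)
        (u i t * (N j t - u j t) + (N i t - u i t) * u j t +
          (N i t - u i t) * (N j t - u j t) - (S i j t - str u i j t) -
            δ • ddt (str u i j) t))) t := by
  have sp := hN.smo_p.mono (subset_univ O)
  have su := fun a => (hN.smo_u a).mono (subset_univ O)
  have ss := fun i j => (hN.smo_str i j).mono (subset_univ O)
  refine hasDerivAt_energy hO θ ε δ (hR.smo_P.sub sp) (fun a => (hR.smo_N a).sub (su a))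
    (fun i j => (hR.smo_S i j).sub (ss i j)) ht ?_ (fun a => ?_) (fun i j => ?_)
  · rw [ddt_sub hR.smo_P sp ht]
    simp only [map_sub, Finset.sum_sub_distrib, hN.div_free t htI, smul_sub]
    linear_combination hR.mass t ht
  · rw [ddt_sub (hR.smo_N a) (su a) ht, hN.momentum t htI a]
    simp only [map_sub, Finset.sum_sub_distrib, str]
    linear_combination hR.momentum t ht a
  · rw [ddt_sub (hR.smo_S i j) (ss i j) ht]
    simp only [map_sub, smul_sub]
    have h1 := residual_mul (N i t) (N j t) (u i t) (u j t)
    have h2 : str u i j t = u i t * u j t - dx j (u i t) := rfl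
    linear_combination hR.stress t ht i j + h1 - h2

theorem resEnergyL2_eq {a ε δ t : ℝ} (hε : 0 ≤ ε) (hδ : 0 ≤ δ) {p : ℝ → Spc 3 → ℝ}
    {u : ℝ → Spc 3 → Vec 3} {pe : ℝ → Spc 3 → ℝ} {ue : ℝ → Spc 3 → Vec 3}
    {Ue : ℝ → Spc 3 → Fin 3 → Fin 3 → ℝ} {p' P : TF} {u' : Fin 3 → ℝ → TF} {N : Fin 3 → TF}
    {S : Fin 3 → Fin 3 → TF} (hp : p'.1 = p t) (hu : ∀ a, (u' a t).1 = fun x => u t x a)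
    (hP : P.1 = pe t) (hN : ∀ a, (N a).1 = fun x => ue t x a)
    (hS : ∀ i j, (S i j).1 = fun x => Ue t x i j) :
    resEnergyL2 a ε δ p u pe ue Ue t = energy ((ε + δ) ^ a) ε δ (P - p') (fun a => N a - u' a t)
      fun i j => S i j - str u' i j t := by
  have e1 : ∀ (b : Fin 1) (x : Spc 3), sc (fun x => √ε * (pe t x - p t x)) x b =
      ((fun _ : Fin 1 => √ε • (P - p')) b).1 x := fun b x => by
    change _ = √ε * (P.1 x - p'.1 x)
    rw [hP, hp]
    rfl
  have e2 : ∀ (b : Fin 3) (x : Spc 3), (fun x (b : Fin 3) => ue t x b - u t x b) x b =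
      ((fun b => N b - u' b t) b).1 x := fun b x => by
    change _ = (N b).1 x - (u' b t).1 x
    rw [hN, hu]
  have e3 : ∀ (b : Fin 3 × Fin 3) (x : Spc 3),
      mtx (fun x i j => √δ * (Ue t x i j - stress u t x i j)) x b =
      ((fun b : Fin 3 × Fin 3 => √δ • (S b.1 b.2 - str u' b.1 b.2 t)) b).1 x := fun b x => by
    change _ = √δ * ((S b.1 b.2).1 x -
      ((u' b.1 t).1 x * (u' b.2 t).1 x - (dx b.2 (u' b.1 t)).1 x))
    rw [hS, dx_val, hu, hu]
    rfl
  rw [resEnergyL2, L2sq_eq e1, L2sq_eq e2, L2sq_eq e3, D2L2sq_eq e1, D2L2sq_eq e2, D2L2sq_eq e3]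
  simp only [Fintype.sum_prod_type, nsq_smul, d2sq_smul, sq_sqrt hε, sq_sqrt hδ, energy, hn,
    Finset.sum_add_distrib, ← Finset.mul_sum, Finset.univ_unique, Finset.sum_singleton]
  ring

end Solutions

section ScalarInequalities

open Set Filter Topology

variable {y y' D : ℝ → ℝ} {t₁ : ℝ}

theorem le_of_barrier {K : ℝ} (hy : ∀ t, t₁ ≤ t → HasDerivAt y (y' t) t) (h₁ : y t₁ ≤ K)
    (hK : ∀ t, t₁ ≤ t → y t = K → y' t < 0) {t : ℝ} (ht : t₁ ≤ t) : y t ≤ K :=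
  image_le_of_deriv_right_lt_deriv_boundary (a := t₁) (b := t) (B := fun _ => K) (B' := fun _ => 0)
    (fun s hs => (hy s hs.1).continuousAt.continuousWithinAt)
    (fun s hs => (hy s hs.1).hasDerivWithinAt) h₁ (fun s => hasDerivAt_const s K)
    (fun s hs => hK s hs.1) (right_mem_Icc.2 ht)

theorem antitone_of_rate (hy : ∀ t, t₁ ≤ t → HasDerivAt y (y' t) t) (h : ∀ t, t₁ ≤ t → y' t ≤ 0) :
    AntitoneOn y (Ici t₁) := by
  refine antitoneOn_of_deriv_nonpos (convex_Ici t₁)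
    (fun s hs => (hy s hs).continuousAt.continuousWithinAt)
    (fun s hs => ?_) fun s hs => ?_
  · rw [interior_Ici] at hs
    exact (hy s (mem_Ioi.1 hs).le).differentiableAt.differentiableWithinAt
  · rw [interior_Ici] at hs
    rw [(hy s (mem_Ioi.1 hs).le).deriv]
    exact h s (mem_Ioi.1 hs).le

theorem exists_dissipation_le (hy : ∀ t, t₁ ≤ t → HasDerivAt y (y' t) t) (hy0 : ∀ t, 0 ≤ y t)
    (h : ∀ t, t₁ ≤ t → y' t ≤ -(D t / 2)) {c : ℝ} (hc : 0 < c) : ∃ t, t₁ ≤ t ∧ D t ≤ c := by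
  by_contra! hcon
  have ha := antitone_of_rate (y := fun t => y t + c / 2 * t) (y' := fun t => y' t + c / 2)
    (t₁ := t₁) (fun t ht => by
      exact ((hy t ht).add
        ((hasDerivAt_id t).const_mul (c / 2))).congr_deriv (by ring)) fun t ht => by
        have := h t ht
        have := hcon t ht
        linarith
  set s := t₁ + 2 * (y t₁ + 1) / c with hs
  have hs1 : t₁ ≤ s := by
    have : 0 ≤ 2 * (y t₁ + 1) / c := div_nonneg (by linarith [hy0 t₁]) hc.le
    linarith
  have h1 := ha (mem_Ici.2 le_rfl) (mem_Ici.2 hs1) hs1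
  have h2 : c / 2 * s = c / 2 * t₁ + (y t₁ + 1) := by
    rw [hs]
    field_simp
  simp only at h1
  linarith [hy0 s]

theorem le_of_dissipation {C c κ : ℝ} (hy : ∀ t, t₁ ≤ t → HasDerivAt y (y' t) t)
    (hD : ∀ t, t₁ ≤ t → c * y t ≤ D t) (h : ∀ t, t₁ ≤ t → y' t ≤ -D t + C * y t * D t)
    (hc : 0 < c) (hκ : 0 < κ) (hCκ : C * κ ≤ 1 / 2) (h₁ : y t₁ ≤ κ) {t : ℝ} (ht : t₁ ≤ t) :
    y t ≤ κ :=
  le_of_barrier hy h₁ (fun s hs he => by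
    have h1 := h s hs
    have h2 := hD s hs
    rw [he] at h1 h2
    have h3 : 0 < D s := (mul_pos hc hκ).trans_le h2
    nlinarith) ht

theorem rate_le_of_dissipation {C κ a b d : ℝ} (hd : 0 ≤ d) (hC : 0 ≤ C) (h : b ≤ -d + C * a * d)
    (ha : a ≤ κ) (hCκ : C * κ ≤ 1 / 2) : b ≤ -(d / 2) := by
  have h1 := mul_le_mul_of_nonneg_right (mul_le_mul_of_nonneg_left ha hC) hd
  have h2 := mul_le_mul_of_nonneg_right hCκ hd
  linarith

end ScalarInequalities

section Levels

open Set Filter Topology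

/-- `f` is solenoidal and `g = Δf - div (f ⊗ m + m ⊗ f + F) - ∇q`. -/
structure Lev (m : Fin 3 → ℝ) (f g : Fin 3 → TF) (F : Fin 3 → Fin 3 → TF) (q : TF) : Prop where
  div_free : ∑ a, dx a (f a) = 0
  eqn : ∀ a, g a = ∑ j, dx j (dx j (f a)) - ∑ j, dx j (m j • f a + m a • f j + F a j) - dx a q

variable {m : Fin 3 → ℝ}

theorem Lev.dx {f g : Fin 3 → TF} {F : Fin 3 → Fin 3 → TF} {q : TF} (h : Lev m f g F q)
    (k : Fin 3) : Lev m (fun a => dx k (f a)) (fun a => dx k (g a)) (fun a j => dx k (F a j))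
      (dx k q) := by
  refine ⟨?_, fun a => ?_⟩
  · have := congrArg (NSRelax.dx k) h.div_free
    rw [map_sum, map_zero] at this
    simpa only [dx_comm k] using this
  · have := congrArg (NSRelax.dx k) (h.eqn a)
    simpa only [map_sub, map_sum, map_add, Derivation.map_smul, dx_comm k] using this

theorem Lev.ddt {O : Set ℝ} (hO : IsOpen O) {f : Fin 3 → ℝ → TF} {F : Fin 3 → Fin 3 → ℝ → TF}
    {q : ℝ → TF} (hf : ∀ a, Smo O (f a)) (hF : ∀ a j, Smo O (F a j)) (hq : Smo O q)
    (h : ∀ t ∈ O, Lev m (fun a => f a t) (fun a => ddt (f a) t) (fun a j => F a j t) (q t))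
    {t : ℝ} (ht : t ∈ O) : Lev m (fun a => NSRelax.ddt (f a) t)
      (fun a => NSRelax.ddt (NSRelax.ddt (f a)) t) (fun a j => NSRelax.ddt (F a j) t)
      (NSRelax.ddt q t) := by
  refine ⟨?_, fun a => ?_⟩
  · have h1 := ddt_congr hO (Smo.const (O := O) (0 : TF)) (fun s hs => (h s hs).div_free) ht
    rw [ddt_sum (fun a _ => (hf a).dx hO a) ht,
      (Smo.const (O := O) (0 : TF)).ddt_eq ht (g := 0) fun x => hasDerivAt_const t _] at h1
    rw [← h1]
    exact Finset.sum_congr rfl fun a _ => (ddt_dx hO a (hf a) ht).symm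
  · have s1 : ∀ j, Smo O fun s => m j • f a s + m a • f j s :=
      fun j => ((hf a).smul (m j)).add ((hf j).smul (m a))
    have s2 : ∀ j, Smo O fun s => m j • f a s + m a • f j s + F a j s :=
      fun j => (s1 j).add (hF a j)
    have s3 : Smo O fun s => ∑ j, NSRelax.dx j (NSRelax.dx j (f a s)) :=
      Smo.sum fun j _ => ((hf a).dx hO j).dx hO j
    have s4 : Smo O fun s => ∑ j, NSRelax.dx j (m j • f a s + m a • f j s + F a j s) :=
      Smo.sum fun j _ => (s2 j).dx hO j
    have h1 := ddt_congr hO ((s3.sub s4).sub (hq.dx hO a)) (fun s hs => (h s hs).eqn a) ht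
    rw [h1, ddt_sub (s3.sub s4) (hq.dx hO a) ht, ddt_sub s3 s4 ht, ddt_dx hO a hq ht,
      ddt_sum (fun j _ => ((hf a).dx hO j).dx hO j) ht, ddt_sum (fun j _ => (s2 j).dx hO j) ht]
    congr 2
    · refine Finset.sum_congr rfl fun j _ => ?_
      rw [ddt_dx hO j ((hf a).dx hO j) ht, ddt_dx hO j (hf a) ht]
    · refine Finset.sum_congr rfl fun j _ => ?_
      rw [ddt_dx hO j (s2 j) ht, ddt_add (s1 j) (hF a j) ht,
        ddt_add ((hf a).smul (m j)) ((hf j).smul (m a)) ht, ddt_smul _ (hf a) ht,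
        ddt_smul _ (hf j) ht]

theorem ip_dx_self (θ : ℝ) (j : Fin 3) (f : TF) : ip θ (dx j f) f = 0 := by
  have h := ip_dx θ j f f
  rw [ip_comm θ f] at h
  linarith

theorem Lev.identity {f g : Fin 3 → TF} {F : Fin 3 → Fin 3 → TF} {q : TF} (h : Lev m f g F q)
    (θ : ℝ) : ∑ a, ip θ (f a) (g a) = -∑ a, ∑ j, hn θ (NSRelax.dx j (f a)) +
      ∑ a, ∑ j, ip θ (NSRelax.dx j (f a)) (F a j) := by
  have e1 : ∀ a, ∑ j, ip θ (NSRelax.dx j (f a)) (f j) = 0 := fun a => by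
    have : ip θ (f a) (∑ j, NSRelax.dx j (f j)) = 0 := by rw [h.div_free, map_zero]
    rw [map_sum] at this
    simp only [ip_dx, Finset.sum_neg_distrib, neg_eq_zero] at this
    exact this
  have e2 : ∑ a, ip θ (NSRelax.dx a (f a)) q = 0 := by
    have : ip θ q (∑ j, NSRelax.dx j (f j)) = 0 := by rw [h.div_free, map_zero]
    rw [map_sum] at this
    simpa only [ip_comm θ q] using this
  have e3 : ∀ a, ip θ (f a) (g a) = -∑ j, hn θ (NSRelax.dx j (f a)) +
      ∑ j, ip θ (NSRelax.dx j (f a)) (F a j) + ip θ (NSRelax.dx a (f a)) q := fun a => by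
    rw [h.eqn a]
    simp only [map_sub, map_sum, map_add, Derivation.map_smul, map_smul, ip_dx, smul_eq_mul,
      ip_dx_self, ip_self, Finset.sum_add_distrib, Finset.sum_neg_distrib, ← Finset.mul_sum, e1,
      mul_neg, mul_zero]
    ring
  simp only [e3, Finset.sum_add_distrib, Finset.sum_neg_distrib, e2, add_zero]

theorem Lev.rate_le {f g : Fin 3 → TF} {F : Fin 3 → Fin 3 → TF} {q : TF} (h : Lev m f g F q)
    {θ : ℝ} (hθ : 0 ≤ θ) : 2 * ∑ a, ip θ (f a) (g a) ≤
      -∑ a, ∑ j, hn θ (NSRelax.dx j (f a)) + ∑ a, ∑ j, hn θ (F a j) := by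
  have h1 : ∑ a, ∑ j, 2 * ip θ (NSRelax.dx j (f a)) (F a j) ≤
      ∑ a, ∑ j, (hn θ (NSRelax.dx j (f a)) + hn θ (F a j)) :=
    Finset.sum_le_sum fun a _ => Finset.sum_le_sum fun j _ => two_ip_le hθ _ _
  simp only [← Finset.mul_sum, Finset.sum_add_distrib] at h1
  rw [h.identity θ]
  linarith

theorem hasDerivAt_sum_hn {O : Set ℝ} (hO : IsOpen O) {f : Fin 3 → ℝ → TF}
    (hf : ∀ a, Smo O (f a)) (θ : ℝ) {t : ℝ} (ht : t ∈ O) :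
    HasDerivAt (fun s => ∑ a, hn θ (f a s)) (2 * ∑ a, ip θ (f a t) (ddt (f a) t)) t := by
  rw [Finset.mul_sum]
  exact HasDerivAt.fun_sum fun a _ => (hf a).hasDerivAt_hn θ hO ht

theorem sum_hn_nonneg {θ : ℝ} (hθ : 0 ≤ θ) (f : Fin 3 → TF) : 0 ≤ ∑ a, hn θ (f a) :=
  Finset.sum_nonneg fun _ _ => hn_nonneg hθ _

end Levels

section Decay

open Set Filter Topology

/-- Sum of the squared `H²` norms of the components. -/
def vsq (f : Fin 3 → TF) : ℝ := ∑ a, hsq (f a)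

theorem vsq_nonneg (f : Fin 3 → TF) : 0 ≤ vsq f := Finset.sum_nonneg fun _ _ => hsq_nonneg _

theorem hsq_le_vsq (f : Fin 3 → TF) (a : Fin 3) : hsq (f a) ≤ vsq f :=
  Finset.single_le_sum (f := fun a => hsq (f a)) (fun _ _ => hsq_nonneg _) (Finset.mem_univ a)

theorem sum_hsq_mul_le (f g : Fin 3 → TF) :
    ∑ a, ∑ j, hsq (f a * g j) ≤ 200000 * (vsq f * vsq g) := by
  rw [vsq, vsq, Finset.sum_mul_sum, Finset.mul_sum]
  refine Finset.sum_le_sum fun a _ => ?_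
  rw [Finset.mul_sum]
  exact Finset.sum_le_sum fun j _ => hsq_mul_le _ _

theorem sum_hsq_add_le (F G : Fin 3 → Fin 3 → TF) :
    ∑ a, ∑ j, hsq (F a j + G a j) ≤
      2 * (∑ a, ∑ j, hsq (F a j) + ∑ a, ∑ j, hsq (G a j)) := by
  simp only [← Finset.sum_add_distrib, Finset.mul_sum]
  exact Finset.sum_le_sum fun a _ => Finset.sum_le_sum fun j _ => hsq_add_le _ _

theorem sum_hsq_symm_mul_le (f g : Fin 3 → TF) :
    ∑ a, ∑ j, hsq (f a * g j + g a * f j) ≤ 800000 * (vsq f * vsq g) := by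
  have h1 := sum_hsq_add_le (fun a j => f a * g j) fun a j => g a * f j
  have h2 := sum_hsq_mul_le f g
  have h3 := sum_hsq_mul_le g f
  rw [mul_comm (vsq g)] at h3
  linarith

theorem vsq_le_dissipation {f : Fin 3 → TF} (hf : ∀ a, integ (f a) = 0) :
    vsq f ≤ 90 * ∑ a, ∑ j, hsq (dx j (f a)) := by
  rw [vsq, Finset.mul_sum]
  refine Finset.sum_le_sum fun a _ => ?_
  have h1 := hsq_le_d2sq (hf a)
  have h2 := d2sq_le_sum (f a)
  have h3 : ∑ j, d2sq (dx j (f a)) ≤ ∑ j, hsq (dx j (f a)) :=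
    Finset.sum_le_sum fun j _ => le_add_of_nonneg_left (nsq_nonneg _)
  linarith

theorem d2sq_eq_nsq_laplacian (f : TF) : d2sq f = nsq (∑ a, dx a (dx a f)) := by
  have h : ∀ k l, nsq (dx k (dx l f)) = integ (dx k (dx k f) * dx l (dx l f)) := fun k l => by
    have h1 := integ_mul_dx k (dx k (dx l f)) (dx l f)
    have h2 := integ_mul_dx l (dx k (dx k f)) (dx l f)
    rw [dx_comm k l f, dx_comm k l (dx k f)] at h1
    rw [h2, nsq, dx_comm k l f, ← h1]
  rw [d2sq, nsq, Finset.sum_mul_sum, map_sum]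
  refine Finset.sum_congr rfl fun k _ => ?_
  rw [map_sum]
  exact Finset.sum_congr rfl fun l _ => h k l

variable {m : Fin 3 → ℝ}

theorem Lev.hsq_pressure_le {f g : Fin 3 → TF} {F : Fin 3 → Fin 3 → TF} {q : TF}
    (h : Lev m f g F q) (hg : ∑ a, NSRelax.dx a (g a) = 0) (hq : integ q = 0) :
    hsq q ≤ 90 * ∑ a, ∑ j, hsq (F a j) := by
  have e1 : ∀ a, NSRelax.dx a (NSRelax.dx a q) = NSRelax.dx a (∑ j, NSRelax.dx j
      (NSRelax.dx j (f a))) - ∑ j, (m j • NSRelax.dx j (NSRelax.dx a (f a)) +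
        m a • NSRelax.dx a (NSRelax.dx j (f j)) + NSRelax.dx a (NSRelax.dx j (F a j))) -
          NSRelax.dx a (g a) := fun a => by
    have := congrArg (NSRelax.dx a) (h.eqn a)
    simp only [map_sub, map_sum, map_add, Derivation.map_smul] at this ⊢
    simp only [dx_comm a _ (f a)] at this ⊢
    rw [this]
    abel
  have e2 : ∑ a, NSRelax.dx a (∑ j, NSRelax.dx j (NSRelax.dx j (f a))) = 0 := by
    have : ∀ j, ∑ a, NSRelax.dx j (NSRelax.dx j (NSRelax.dx a (f a))) = 0 := fun j => by
      rw [← map_sum, ← map_sum, h.div_free, map_zero, map_zero]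
    simp only [map_sum]
    rw [Finset.sum_comm]
    refine Finset.sum_eq_zero fun j _ => ?_
    rw [← this j]
    refine Finset.sum_congr rfl fun a _ => ?_
    rw [dx_comm a j, dx_comm a j]
  have e3 : ∑ a, ∑ j, m j • NSRelax.dx j (NSRelax.dx a (f a)) = 0 := by
    rw [Finset.sum_comm]
    refine Finset.sum_eq_zero fun j _ => ?_
    rw [← Finset.smul_sum, ← map_sum, h.div_free, map_zero, smul_zero]
  have e4 : ∑ a, ∑ j, m a • NSRelax.dx a (NSRelax.dx j (f j)) = 0 := by
    refine Finset.sum_eq_zero fun a _ => ?_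
    rw [← Finset.smul_sum, ← map_sum, h.div_free, map_zero, smul_zero]
  have e5 : ∑ a, NSRelax.dx a (NSRelax.dx a q) =
      -∑ a, ∑ j, NSRelax.dx a (NSRelax.dx j (F a j)) := by
    simp only [e1, Finset.sum_sub_distrib, Finset.sum_add_distrib, e2, e3, e4, hg]
    abel
  have h1 : nsq (∑ a, ∑ j, NSRelax.dx a (NSRelax.dx j (F a j))) ≤
      9 * ∑ a, ∑ j, nsq (NSRelax.dx a (NSRelax.dx j (F a j))) := by
    refine (nsq_sum_le _ _).trans ?_
    simp only [Finset.card_univ, Fintype.card_fin, Nat.cast_ofNat]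
    have : ∑ a : Fin 3, nsq (∑ j, NSRelax.dx a (NSRelax.dx j (F a j))) ≤
        ∑ a, 3 * ∑ j, nsq (NSRelax.dx a (NSRelax.dx j (F a j))) :=
      Finset.sum_le_sum fun a _ => by
        simpa using nsq_sum_le Finset.univ fun j => NSRelax.dx a (NSRelax.dx j (F a j))
    rw [← Finset.mul_sum] at this
    linarith
  have h2 : ∑ a, ∑ j, nsq (NSRelax.dx a (NSRelax.dx j (F a j))) ≤ ∑ a, ∑ j, hsq (F a j) :=
    Finset.sum_le_sum fun a _ => Finset.sum_le_sum fun j _ =>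
      ((Finset.single_le_sum (f := fun l => nsq (NSRelax.dx a (NSRelax.dx l (F a j))))
        (fun _ _ => nsq_nonneg _) (Finset.mem_univ j)).trans
          (Finset.single_le_sum (f := fun k => ∑ l, nsq (NSRelax.dx k (NSRelax.dx l (F a j))))
            (fun _ _ => Finset.sum_nonneg fun _ _ => nsq_nonneg _) (Finset.mem_univ a))).trans
        (le_add_of_nonneg_left (nsq_nonneg _))
  have h3 := hsq_le_d2sq hq
  rw [d2sq_eq_nsq_laplacian, e5, nsq_neg] at h3
  linarith

theorem hasDerivAt_vsq {O : Set ℝ} (hO : IsOpen O) {f : Fin 3 → ℝ → TF}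
    (hf : ∀ a, Smo O (f a)) {t : ℝ} (ht : t ∈ O) :
    HasDerivAt (fun s => vsq fun a => f a s) (2 * ∑ a, ip 1 (f a t) (ddt (f a) t)) t := by
  simpa only [hn_one, vsq] using hasDerivAt_sum_hn hO hf 1 ht

/-- The velocity fluctuation of a Navier–Stokes solution with mean velocity `m`. -/
structure Fluct (m : Fin 3 → ℝ) (w : Fin 3 → ℝ → TF) (p : ℝ → TF) : Prop where
  smo_w : ∀ a, Smo (Ioi 0) (w a)
  smo_p : Smo (Ioi 0) p
  lev : ∀ t ∈ Ioi (0 : ℝ), Lev m (fun a => w a t) (fun a => ddt (w a) t)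
    (fun a j => w a t * w j t) (p t)
  mean_w : ∀ t ∈ Ioi (0 : ℝ), ∀ a, integ (w a t) = 0
  mean_p : ∀ t ∈ Ioi (0 : ℝ), integ (p t) = 0

variable {w : Fin 3 → ℝ → TF} {p : ℝ → TF}

theorem ip_zero (f g : TF) : ip 0 f g = integ (f * g) := by rw [ip_apply, zero_mul, add_zero]

theorem hn_zero (f : TF) : hn 0 f = nsq f := by rw [hn, zero_mul, add_zero]

theorem integ_trilinear_eq_zero {f : Fin 3 → TF} (hf : ∑ a, dx a (f a) = 0) (a : Fin 3) :
    ∑ j, integ (dx j (f a) * (f a * f j)) = 0 := by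
  have h1 : ∑ j, integ (dx j (f a * f a * f j)) = 0 :=
    Finset.sum_eq_zero fun j _ => integ_dx j _
  have h2 : ∀ j, integ (dx j (f a * f a * f j)) =
      2 * integ (dx j (f a) * (f a * f j)) + integ (f a * f a * dx j (f j)) := fun j => by
    rw [two_mul, ← map_add, ← map_add]
    congr 1
    simp only [dx_mul]
    ring
  simp only [h2, Finset.sum_add_distrib, ← Finset.mul_sum] at h1
  have h3 : ∑ j, integ (f a * f a * dx j (f j)) = 0 := by
    rw [← map_sum, ← Finset.mul_sum, hf, mul_zero, map_zero]
  linarith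

theorem Fluct.exists_dsq_le (h : Fluct m w p) {c : ℝ} (hc : 0 < c) :
    ∃ t, 1 ≤ t ∧ ∑ a, dsq (w a t) ≤ c := by
  refine exists_dissipation_le (y := fun t => ∑ a, hn 0 (w a t)) (t₁ := 1) (fun t ht =>
    hasDerivAt_sum_hn isOpen_Ioi h.smo_w 0 (zero_lt_one.trans_le ht))
    (fun t => sum_hn_nonneg le_rfl _) (fun t ht => ?_) hc
  have ht0 : t ∈ Ioi (0 : ℝ) := zero_lt_one.trans_le ht
  have h1 := (h.lev t ht0).identity 0
  simp only [ip_zero, hn_zero, integ_trilinear_eq_zero (h.lev t ht0).div_free,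
    Finset.sum_const_zero, add_zero] at h1
  simp only [ip_zero]
  rw [h1]
  have : 0 ≤ ∑ a, dsq (w a t) := Finset.sum_nonneg fun _ _ => dsq_nonneg _
  simp only [dsq] at this ⊢
  linarith

theorem nsq_dx_mul_le {f g : TF} (hf : integ f = 0) (hg : integ g = 0) (k : Fin 3) :
    nsq (dx k (f * g)) ≤ 2400 * (d2sq f * nsq (dx k g) + d2sq g * nsq (dx k f)) := by
  have h1 := nsq_add_le (f * dx k g) (dx k f * g)
  have h2 := nsq_mul_le (sq_apply_le_hsq f) (dx k g)
  have h3 := nsq_mul_le (sq_apply_le_hsq g) (dx k f)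
  have h4 := mul_le_mul_of_nonneg_right (hsq_le_d2sq hf) (nsq_nonneg (dx k g))
  have h5 := mul_le_mul_of_nonneg_right (hsq_le_d2sq hg) (nsq_nonneg (dx k f))
  rw [mul_comm g] at h3
  rw [dx_mul]
  linarith

theorem Fluct.dsq_rate_le (h : Fluct m w p) {t : ℝ} (ht : t ∈ Ioi (0 : ℝ)) :
    ∃ y', HasDerivAt (fun s => ∑ a, dsq (w a s)) y' t ∧
      y' ≤ -∑ a, d2sq (w a t) + 4800 * (∑ a, dsq (w a t)) * ∑ a, d2sq (w a t) := by
  refine ⟨∑ k, 2 * ∑ a, ip 0 (dx k (w a t)) (dx k (ddt (w a) t)), ?_, ?_⟩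
  · have h1 : HasDerivAt (fun s => ∑ k, ∑ a, hn 0 (dx k (w a s)))
        (∑ k, 2 * ∑ a, ip 0 (dx k (w a t)) (ddt (fun s => dx k (w a s)) t)) t :=
      HasDerivAt.fun_sum fun k _ =>
        hasDerivAt_sum_hn isOpen_Ioi (fun a => (h.smo_w a).dx isOpen_Ioi k) 0 ht
    simp only [fun a k => ddt_dx isOpen_Ioi k (h.smo_w a) ht, hn_zero] at h1
    refine h1.congr_of_eventuallyEq (Eventually.of_forall fun s => ?_)
    simp only [dsq]
    exact Finset.sum_comm
  · have h1 : ∑ k, 2 * ∑ a, ip 0 (dx k (w a t)) (dx k (ddt (w a) t)) ≤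
        ∑ k, (-∑ a, ∑ j, nsq (dx j (dx k (w a t))) +
          ∑ a, ∑ j, nsq (dx k (w a t * w j t))) := Finset.sum_le_sum fun k _ => by
      simpa only [hn_zero] using ((h.lev t ht).dx k).rate_le le_rfl
    have h2 : ∑ k, ∑ a, ∑ j, nsq (dx k (w a t * w j t)) ≤ ∑ k, ∑ a, ∑ j,
        2400 * (d2sq (w a t) * nsq (dx k (w j t)) + d2sq (w j t) * nsq (dx k (w a t))) :=
      Finset.sum_le_sum fun k _ => Finset.sum_le_sum fun a _ => Finset.sum_le_sum fun j _ =>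
        nsq_dx_mul_le (h.mean_w t ht a) (h.mean_w t ht j) k
    have h3 : ∑ k, ∑ a, ∑ j, 2400 * (d2sq (w a t) * nsq (dx k (w j t)) +
        d2sq (w j t) * nsq (dx k (w a t))) =
          4800 * (∑ a, dsq (w a t)) * ∑ a, d2sq (w a t) := by
      simp only [dsq, Fin.sum_univ_three]
      ring
    have h4 : ∑ k, ∑ a, ∑ j, nsq (dx j (dx k (w a t))) = ∑ a, d2sq (w a t) := by
      rw [Finset.sum_comm]
      refine Finset.sum_congr rfl fun a _ => ?_
      rw [d2sq, Finset.sum_comm]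
    rw [Finset.sum_add_distrib, Finset.sum_neg_distrib, h4] at h1
    linarith

theorem Fluct.exists_vsq_le (h : Fluct m w p) :
    ∃ t₁, 1 ≤ t₁ ∧ ∀ t, t₁ ≤ t → vsq (fun a => w a t) ≤ 1 / 10 ^ 9 := by
  obtain ⟨s, hs1, hs⟩ := h.exists_dsq_le (c := 1 / 10 ^ 4) (by norm_num)
  have hpos : ∀ t, s ≤ t → t ∈ Ioi (0 : ℝ) := fun t ht =>
    zero_lt_one.trans_le (hs1.trans ht)
  choose! y' hy' hy'' using fun t (ht : s ≤ t) => h.dsq_rate_le (hpos t ht)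
  have hle : ∀ t, s ≤ t → ∑ a, dsq (w a t) ≤ 1 / 10 ^ 4 := fun t ht =>
    le_of_dissipation (c := 1 / 3) (D := fun t => ∑ a, d2sq (w a t)) hy' (fun r hr => by
      have : ∑ a, dsq (w a r) ≤ ∑ a, 3 * d2sq (w a r) :=
        Finset.sum_le_sum fun a _ => dsq_le_d2sq _
      rw [← Finset.mul_sum] at this
      linarith) hy'' (by norm_num) (by norm_num) (by norm_num) hs ht
  obtain ⟨r, hr1, hr⟩ := exists_dissipation_le (D := fun t => ∑ a, d2sq (w a t)) hy'
    (fun t => Finset.sum_nonneg fun _ _ => dsq_nonneg _) (fun t ht =>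
      rate_le_of_dissipation (Finset.sum_nonneg fun _ _ => d2sq_nonneg _) (by norm_num)
        (hy'' t ht) (hle t ht) (by norm_num)) (c := 1 / 10 ^ 10) (by norm_num)
  refine ⟨r, hs1.trans hr1, fun t ht => ?_⟩
  refine le_of_dissipation (c := 1 / 90) (C := 18000000) (y := fun t => vsq fun a => w a t)
    (D := fun t => ∑ a, ∑ j, hsq (dx j (w a t))) (t₁ := r)
    (fun v hv => hasDerivAt_vsq isOpen_Ioi h.smo_w (hpos v (hr1.trans hv))) (fun v hv => ?_)
    (fun v hv => ?_) (by norm_num) (by norm_num) (by norm_num) ?_ ht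
  · have := vsq_le_dissipation (h.mean_w v (hpos v (hr1.trans hv)))
    linarith
  · have hv0 := hpos v (hr1.trans hv)
    have h1 := (h.lev v hv0).rate_le zero_le_one
    have h2 := sum_hsq_mul_le (fun a => w a v) fun a => w a v
    have h3 := mul_le_mul_of_nonneg_left (vsq_le_dissipation (h.mean_w v hv0))
      (vsq_nonneg fun a => w a v)
    simp only [hn_one] at h1
    linarith
  · have : vsq (fun a => w a r) ≤ ∑ a, 10 * d2sq (w a r) :=
      Finset.sum_le_sum fun a _ => hsq_le_d2sq (h.mean_w r (hpos r hr1) a)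
    rw [← Finset.mul_sum] at this
    norm_num at hr ⊢
    linarith

/-- Solutions of the linearization around a small flow remain bounded. -/
theorem vsq_bounded_of_lev {t₁ : ℝ} (ht₁ : 1 ≤ t₁)
    (hw : ∀ t, t₁ ≤ t → vsq (fun a => w a t) ≤ 1 / 10 ^ 9) {f : Fin 3 → ℝ → TF}
    {G : Fin 3 → Fin 3 → ℝ → TF} {q : ℝ → TF} (hf : ∀ a, Smo (Ioi 0) (f a))
    (hm : ∀ t ∈ Ioi (0 : ℝ), ∀ a, integ (f a t) = 0)
    (hl : ∀ t ∈ Ioi (0 : ℝ), Lev m (fun a => f a t) (fun a => ddt (f a) t)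
      (fun a j => f a t * w j t + w a t * f j t + G a j t) (q t)) {B : ℝ}
    (hG : ∀ t, t₁ ≤ t → ∑ a, ∑ j, hsq (G a j t) ≤ B) :
    ∃ K, ∀ t, t₁ ≤ t → vsq (fun a => f a t) ≤ K := by
  refine ⟨max (vsq fun a => f a t₁) (360 * B + 1), fun t ht => ?_⟩
  have hpos : ∀ t, t₁ ≤ t → t ∈ Ioi (0 : ℝ) := fun t ht =>
    zero_lt_one.trans_le (ht₁.trans ht)
  refine le_of_barrier (fun s hs => hasDerivAt_vsq isOpen_Ioi hf (hpos s hs)) (le_max_left _ _)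
    (fun s hs he => ?_) ht
  have h1 := (hl s (hpos s hs)).rate_le zero_le_one
  have h2 := sum_hsq_add_le (fun a j => f a s * w j s + w a s * f j s) fun a j => G a j s
  have h3 := sum_hsq_symm_mul_le (fun a => f a s) fun a => w a s
  have h4 := mul_le_mul_of_nonneg_left (hw s hs) (vsq_nonneg fun a => f a s)
  have h5 := vsq_le_dissipation (hm s (hpos s hs))
  have h6 := hG s hs
  have h7 := he.symm ▸ le_max_right (vsq fun a => f a t₁) (360 * B + 1)
  have h8 := vsq_nonneg fun a => f a s
  simp only [hn_one] at h1
  norm_num at h4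
  linarith

end Decay

section UniformBounds

open Set Filter Topology

variable {m : Fin 3 → ℝ} {w : Fin 3 → ℝ → TF} {p : ℝ → TF} {I : Set ℝ} {u : Fin 3 → ℝ → TF}

theorem integ_ddt_eq_zero {O : Set ℝ} (hO : IsOpen O) {F : ℝ → TF} (hF : Smo O F) {c : ℝ}
    (h : ∀ t ∈ O, integ (F t) = c) {t : ℝ} (ht : t ∈ O) : integ (ddt F t) = 0 :=
  (hF.hasDerivAt_integ hO ht).unique ((hasDerivAt_const t c).congr_of_eventuallyEq
    (eventually_of_mem (hO.mem_nhds ht) h))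

theorem Fluct.lev_ddt (h : Fluct m w p) {t : ℝ} (ht : t ∈ Ioi (0 : ℝ)) :
    Lev m (fun a => ddt (w a) t) (fun a => ddt (ddt (w a)) t)
      (fun a j => ddt (w a) t * w j t + w a t * ddt (w j) t) (ddt p t) := by
  have := Lev.ddt isOpen_Ioi h.smo_w (fun a j => (h.smo_w a).mul (h.smo_w j)) h.smo_p h.lev ht
  simpa only [fun a j => ddt_mul (h.smo_w a) (h.smo_w j) ht] using this

theorem Fluct.bounded (h : Fluct m w p) : ∃ t₁, 1 ≤ t₁ ∧ ∃ K, ∀ t, t₁ ≤ t →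
    vsq (fun a => w a t) ≤ K ∧ vsq (fun a => ddt (w a) t) ≤ K ∧
      (∀ i, vsq (fun a => dx i (ddt (w a) t)) ≤ K) ∧ hsq (ddt p t) ≤ K := by
  obtain ⟨t₁, ht₁, hw⟩ := h.exists_vsq_le
  have hpos : ∀ t, t₁ ≤ t → t ∈ Ioi (0 : ℝ) := fun t ht => zero_lt_one.trans_le (ht₁.trans ht)
  have sz : ∀ a, Smo (Ioi 0) (ddt (w a)) := fun a => (h.smo_w a).ddt isOpen_Ioi
  have hD : ∀ i, ∃ K, ∀ t, t₁ ≤ t → vsq (fun a => dx i (w a t)) ≤ K := fun i =>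
    vsq_bounded_of_lev ht₁ hw (f := fun a t => dx i (w a t)) (G := fun _ _ _ => 0) (B := 0)
      (q := fun t => dx i (p t)) (fun a => (h.smo_w a).dx isOpen_Ioi i)
      (fun t _ a => integ_dx i _) (fun t ht => by
        have := (h.lev t ht).dx i
        simp only [dx_mul] at this
        simpa only [fun a => ddt_dx isOpen_Ioi i (h.smo_w a) ht, add_zero,
          add_comm (dx i (w _ t) * _)] using this)
      fun t _ => by simp [hsq, nsq, d2sq]
  obtain ⟨KZ, hZ⟩ := vsq_bounded_of_lev ht₁ hw (f := fun a => ddt (w a))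
    (G := fun _ _ _ => 0) (B := 0)
    (q := ddt p) sz (fun t ht a => integ_ddt_eq_zero isOpen_Ioi (h.smo_w a)
      (fun s hs => h.mean_w s hs a) ht) (fun t ht => by
        simpa only [add_zero] using h.lev_ddt ht) fun t _ => by simp [hsq, nsq, d2sq]
  choose KD hKD using hD
  have hX : ∀ i, ∃ K, ∀ t, t₁ ≤ t → vsq (fun a => dx i (ddt (w a) t)) ≤ K := fun i =>
    vsq_bounded_of_lev ht₁ hw (f := fun a t => dx i (ddt (w a) t))
      (G := fun a j t => ddt (w a) t * dx i (w j t) + dx i (w a t) * ddt (w j) t)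
      (B := 800000 * (KZ * KD i)) (q := fun t => dx i (ddt p t))
      (fun a => (sz a).dx isOpen_Ioi i) (fun t _ a => integ_dx i _) (fun t ht => by
        have := (h.lev_ddt ht).dx i
        simp only [map_add, dx_mul] at this
        refine ⟨this.div_free, fun a => ?_⟩
        rw [ddt_dx isOpen_Ioi i (sz a) ht, this.eqn a]
        simp only [map_add]
        congr 2
        refine Finset.sum_congr rfl fun j _ => ?_
        abel)
      fun t ht => by
        refine (sum_hsq_symm_mul_le (fun a => ddt (w a) t) fun a => dx i (w a t)).trans ?_
        have := mul_le_mul (hZ t ht) (hKD i t ht) (vsq_nonneg _)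
          ((vsq_nonneg _).trans (hZ t ht))
        linarith
  choose KX hKX using hX
  obtain ⟨KM, hKM⟩ := Finite.exists_le KX
  have h0 : ∀ t, t₁ ≤ t → hsq (ddt p t) ≤ 90 * (800000 * KZ) := fun t ht => by
    have h1 := h.lev_ddt (hpos t ht)
    have h2 : ∑ a, dx a (ddt (ddt (w a)) t) = 0 :=
      (Lev.ddt isOpen_Ioi (F := fun a j s => ddt (w a) s * w j s + w a s * ddt (w j) s) sz
        (fun a j => ((sz a).mul (h.smo_w j)).add ((h.smo_w a).mul (sz j)))
        (h.smo_p.ddt isOpen_Ioi) (fun s hs => h.lev_ddt hs) (hpos t ht)).div_free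
    have h3 := h1.hsq_pressure_le h2 (integ_ddt_eq_zero isOpen_Ioi h.smo_p h.mean_p (hpos t ht))
    have h4 := sum_hsq_symm_mul_le (fun a => ddt (w a) t) fun a => w a t
    have h5 := mul_le_mul (hZ t ht) ((hw t ht).trans (show _ ≤ (1 : ℝ) by norm_num))
      (vsq_nonneg _) ((vsq_nonneg _).trans (hZ t ht))
    linarith
  refine ⟨t₁, ht₁, max 1 (max KZ (max KM (90 * (800000 * KZ)))),
    fun t ht => ⟨?_, ?_, fun i => ?_, ?_⟩⟩
  · exact (hw t ht).trans (le_trans (by norm_num) (le_max_left _ _))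
  · exact (hZ t ht).trans ((le_max_left _ _).trans (le_max_right _ _))
  · exact ((hKX i t ht).trans (hKM i)).trans ((le_max_left _ _).trans ((le_max_right _ _).trans
      (le_max_right _ _)))
  · exact (h0 t ht).trans ((le_max_right _ _).trans ((le_max_right _ _).trans
      (le_max_right _ _)))

theorem smo_sub_mean (h : NSCurve I p u) (m : Fin 3 → ℝ) (a : Fin 3) :
    Smo univ fun t => u a t - algebraMap ℝ TF (m a) := (h.smo_u a).sub (Smo.const _)

theorem ddt_sub_mean (h : NSCurve I p u) (m : Fin 3 → ℝ) (a : Fin 3) (t : ℝ) :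
    ddt (fun t => u a t - algebraMap ℝ TF (m a)) t = ddt (u a) t := by
  rw [ddt_sub (h.smo_u a) (Smo.const _) (mem_univ t),
    (Smo.const (O := univ) (algebraMap ℝ TF (m a))).ddt_eq (mem_univ t) (g := 0)
      fun x => hasDerivAt_const t _, sub_zero]

theorem NSCurve.exists_fluct (h : NSCurve I p u) (hI : Ici 0 ⊆ I) :
    ∃ m : Fin 3 → ℝ, Fluct m (fun a t => u a t - algebraMap ℝ TF (m a)) p := by
  have hm : ∀ a, ∀ t ∈ Ioi (0 : ℝ), integ (u a t) = integ (u a 1) := fun a t ht => by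
    have hd : ∀ s ∈ Ioi (0 : ℝ), HasDerivAt (fun s => integ (u a s)) 0 s := fun s hs => by
      have h1 := (h.smo_u a).hasDerivAt_integ isOpen_univ (mem_univ s)
      rwa [h.momentum s (hI (mem_Ioi.1 hs).le) a, map_sub, map_sub, map_sum, map_sum,
        Finset.sum_eq_zero fun j _ => integ_dx j _, Finset.sum_eq_zero fun j _ => integ_dx j _,
        integ_dx, sub_zero, sub_zero] at h1
    exact isOpen_Ioi.is_const_of_deriv_eq_zero isPreconnected_Ioi
      (fun s hs => (hd s hs).differentiableAt.differentiableWithinAt)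
      (fun s hs => (hd s hs).deriv) ht (mem_Ioi.2 one_pos)
  refine ⟨fun a => integ (u a 1),
    fun a => (smo_sub_mean h (fun a => integ (u a 1)) a).mono (subset_univ _),
    h.smo_p.mono (subset_univ _), fun t ht => ⟨?_, fun a => ?_⟩, fun t ht a => ?_, fun t ht =>
      h.mean_zero t (hI (mem_Ioi.1 ht).le)⟩
  · simpa only [map_sub, Derivation.map_algebraMap, sub_zero] using
      h.div_free t (hI (mem_Ioi.1 ht).le)
  · rw [ddt_sub_mean h (fun a => integ (u a 1)) a t, h.momentum t (hI (mem_Ioi.1 ht).le) a]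
    simp only [map_sub, Derivation.map_algebraMap, sub_zero]
    congr 2
    refine Finset.sum_congr rfl fun j _ => ?_
    simp only [map_add, map_sub, Derivation.map_algebraMap, sub_zero, dx_mul,
      Algebra.smul_def]
    ring
  · rw [map_sub, integ_algebraMap, hm a t ht, sub_self]

theorem ddt_str (h : NSCurve I p u) (i j : Fin 3) (t : ℝ) :
    ddt (str u i j) t = ddt (u i) t * u j t + u i t * ddt (u j) t - dx j (ddt (u i) t) := by
  rw [← ddt_mul (h.smo_u i) (h.smo_u j) (mem_univ t), ← ddt_dx isOpen_univ j (h.smo_u i)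
    (mem_univ t), ← ddt_sub ((h.smo_u i).mul (h.smo_u j)) ((h.smo_u i).dx isOpen_univ j)
    (mem_univ t)]
  rfl

theorem hsq_algebraMap (c : ℝ) : hsq (algebraMap ℝ TF c) = c ^ 2 := by
  simp only [hsq, d2sq, nsq, Derivation.map_algebraMap, map_zero, mul_zero,
    Finset.sum_const_zero, add_zero, ← map_mul, integ_algebraMap]
  ring

theorem hsq_sub_le (f g : TF) : hsq (f - g) ≤ 2 * (hsq f + hsq g) := by
  have h := hsq_add_le f ((-1 : ℝ) • g)
  rw [hsq_smul] at h
  rw [sub_eq_add_neg, ← neg_one_smul ℝ g]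
  linarith

/-- The squared `H²` norms controlling the forcing of the residual system. -/
def forcing (p : ℝ → TF) (u : Fin 3 → ℝ → TF) (t : ℝ) : ℝ :=
  vsq (fun a => u a t) + hsq (ddt p t) + ∑ i, ∑ j, hsq (ddt (str u i j) t)

theorem forcing_bounds (p : ℝ → TF) (u : Fin 3 → ℝ → TF) (t : ℝ) :
    (∀ a, hsq (u a t) ≤ forcing p u t) ∧ hsq (ddt p t) ≤ forcing p u t ∧
      ∀ i j, hsq (ddt (str u i j) t) ≤ forcing p u t := by
  have h1 : 0 ≤ ∑ i, ∑ j, hsq (ddt (str u i j) t) :=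
    Finset.sum_nonneg fun _ _ => Finset.sum_nonneg fun _ _ => hsq_nonneg _
  have h2 := vsq_nonneg fun a => u a t
  have h3 := hsq_nonneg (ddt p t)
  refine ⟨fun a => ?_, ?_, fun i j => ?_⟩
  · have := hsq_le_vsq (fun a => u a t) a
    simp only [forcing]
    linarith
  · simp only [forcing]
    linarith
  · have h4 := (Finset.single_le_sum (f := fun j => hsq (ddt (str u i j) t))
      (fun _ _ => hsq_nonneg _) (Finset.mem_univ j)).trans (Finset.single_le_sum
        (f := fun i => ∑ j, hsq (ddt (str u i j) t))
        (fun _ _ => Finset.sum_nonneg fun _ _ => hsq_nonneg _) (Finset.mem_univ i))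
    simp only [forcing]
    linarith

theorem NSCurve.continuous_forcing (h : NSCurve I p u) : Continuous (forcing p u) := by
  have hc : ∀ {F : ℝ → TF}, Smo univ F → Continuous fun t => hsq (F t) := fun hF =>
    continuousOn_univ.1 (hF.continuousOn_hsq isOpen_univ)
  exact ((continuous_finsetSum _ fun a _ => hc (h.smo_u a)).add
    (hc (h.smo_p.ddt isOpen_univ))).add (continuous_finsetSum _ fun i _ =>
      continuous_finsetSum _ fun j _ => hc ((h.smo_str i j).ddt isOpen_univ))

theorem NSCurve.forcing_bounded_Icc (h : NSCurve I p u) (b : ℝ) :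
    ∃ B, ∀ t ∈ Icc 0 b, forcing p u t ≤ B := by
  obtain ⟨B, hB⟩ := isCompact_Icc.exists_bound_of_continuousOn
    (s := Icc 0 b) h.continuous_forcing.continuousOn
  exact ⟨B, fun t ht => (le_abs_self _).trans (hB t ht)⟩

theorem NSCurve.forcing_bounded_Ici (h : NSCurve I p u) (hI : Ici 0 ⊆ I) :
    ∃ B, ∀ t, 0 ≤ t → forcing p u t ≤ B := by
  obtain ⟨m, hF⟩ := h.exists_fluct hI
  obtain ⟨t₁, ht₁, K, hK⟩ := hF.bounded
  simp only [ddt_sub_mean h] at hK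
  obtain ⟨B, hB⟩ := h.forcing_bounded_Icc t₁
  obtain ⟨M, hM⟩ := Finite.exists_le fun a => m a ^ 2
  set L := 2 * (K + M) with hL
  refine ⟨max B (3 * L + K + 9 * (2 * (800000 * (K * (3 * L)) + K))), fun t ht => ?_⟩
  rcases le_total t t₁ with h1 | h1
  · exact (hB t ⟨ht, h1⟩).trans (le_max_left _ _)
  obtain ⟨k1, k2, k3, k4⟩ := hK t h1
  refine le_trans ?_ (le_max_right _ _)
  have hu : vsq (fun a => u a t) ≤ 3 * L := by
    have : vsq (fun a => u a t) ≤ ∑ _a : Fin 3, L := Finset.sum_le_sum fun a _ => by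
      have e1 := hsq_add_le (u a t - algebraMap ℝ TF (m a)) (algebraMap ℝ TF (m a))
      have e2 := (hsq_le_vsq (fun a => u a t - algebraMap ℝ TF (m a)) a).trans k1
      rw [sub_add_cancel, hsq_algebraMap] at e1
      linarith [hM a]
    simpa using this
  have hz : vsq (fun a => ddt (u a) t) * vsq (fun a => u a t) ≤ K * (3 * L) :=
    mul_le_mul k2 hu (vsq_nonneg _) ((vsq_nonneg _).trans k2)
  have hs : ∀ i j, hsq (ddt (str u i j) t) ≤ 2 * (800000 * (K * (3 * L)) + K) := fun i j => by
    have e1 := hsq_sub_le (ddt (u i) t * u j t + u i t * ddt (u j) t) (dx j (ddt (u i) t))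
    have e2 := (hsq_le_vsq (fun a => dx j (ddt (u a) t)) i).trans (k3 j)
    have e3 := sum_hsq_symm_mul_le (fun a => ddt (u a) t) fun a => u a t
    have e4 := (Finset.single_le_sum
      (f := fun j => hsq (ddt (u i) t * u j t + u i t * ddt (u j) t))
      (fun _ _ => hsq_nonneg _) (Finset.mem_univ j)).trans (Finset.single_le_sum
        (f := fun i => ∑ j, hsq (ddt (u i) t * u j t + u i t * ddt (u j) t))
        (fun _ _ => Finset.sum_nonneg fun _ _ => hsq_nonneg _) (Finset.mem_univ i))
    rw [ddt_str h]
    linarith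
  have hs' : ∑ i, ∑ j, hsq (ddt (str u i j) t) ≤
      ∑ _i : Fin 3, ∑ _j : Fin 3, 2 * (800000 * (K * (3 * L)) + K) :=
    Finset.sum_le_sum fun i _ => Finset.sum_le_sum fun j _ => hs i j
  simp only [Finset.sum_const, Finset.card_univ, Fintype.card_fin, nsmul_eq_mul,
    Nat.cast_ofNat] at hs'
  rw [forcing]
  linarith

theorem NSCurve.forcing_bounded {T₀ : ℝ≥0∞}
    (h : NSCurve {t : ℝ | 0 ≤ t ∧ ENNReal.ofReal t ≤ T₀} p u) :
    ∃ B, ∀ t, 0 ≤ t → ENNReal.ofReal t ≤ T₀ → forcing p u t ≤ B := by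
  rcases eq_or_ne T₀ ⊤ with rfl | hT
  · obtain ⟨B, hB⟩ := h.forcing_bounded_Ici fun t ht => ⟨ht, le_top⟩
    exact ⟨B, fun t ht _ => hB t ht⟩
  · obtain ⟨B, hB⟩ := h.forcing_bounded_Icc T₀.toReal
    exact ⟨B, fun t ht htT => hB t ⟨ht, (ENNReal.ofReal_le_iff_le_toReal hT).1 htT⟩⟩

end UniformBounds

section InitialTime

open Set Filter Topology

theorem le_exp_mul_of_neg_deriv_le {y y' : ℝ → ℝ} {K t t₀ : ℝ}
    (hy : ∀ s ∈ Icc t t₀, HasDerivAt y (y' s) s) (h : ∀ s ∈ Icc t t₀, -y' s ≤ K * y s)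
    (ht : t ≤ t₀) : y t ≤ exp (K * (t₀ - t)) * y t₀ := by
  have hd : ∀ s ∈ Icc t t₀, HasDerivAt (fun s => exp (K * s) * y s)
      (exp (K * s) * K * y s + exp (K * s) * y' s) s := fun s hs => by
    have := ((hasDerivAt_id s).const_mul K).exp.fun_mul (hy s hs)
    simpa using this
  have hm : MonotoneOn (fun s => exp (K * s) * y s) (Icc t t₀) := by
    refine monotoneOn_of_deriv_nonneg (convex_Icc t t₀)
      (fun s hs => (hd s hs).continuousAt.continuousWithinAt)
      (fun s hs => (hd s (interior_subset hs)).differentiableAt.differentiableWithinAt)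
      fun s hs => ?_
    rw [(hd s (interior_subset hs)).deriv]
    have h1 := h s (interior_subset hs)
    have h2 := exp_pos (K * s)
    nlinarith
  have h1 := hm (left_mem_Icc.2 ht) (right_mem_Icc.2 ht) ht
  simp only at h1
  rw [mul_sub, exp_sub, div_mul_eq_mul_div, le_div_iff₀ (exp_pos _)]
  linarith

theorem neg_energy_rate_le {ε δ L : ℝ} (hε : 0 ≤ ε) (hδ : 0 < δ) {P : TF} {N : Fin 3 → TF}
    {S T : Fin 3 → Fin 3 → TF} (hT : ∑ i, ∑ j, hsq (T i j) ≤ L * energy 1 ε δ P N S) :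
    -(2 * (ip 1 P 0 + ∑ i, ∑ j, ip 1 (S i j) (T i j - S i j))) ≤
      (3 / δ + L) * energy 1 ε δ P N S := by
  have h1 : ∑ i, ∑ j, -(2 * ip 1 (S i j) (T i j - S i j)) ≤
      ∑ i, ∑ j, (3 * hn 1 (S i j) + hsq (T i j)) :=
    Finset.sum_le_sum fun i _ => Finset.sum_le_sum fun j _ => by
      have := neg_two_ip_le zero_le_one (S i j) (T i j)
      rw [hn_one (T i j)] at this
      rw [map_sub, ip_self]
      linarith
  simp only [Finset.sum_add_distrib, Finset.sum_neg_distrib, ← Finset.mul_sum] at h1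
  have h2 := (le_energy (θ := 1) (P := P) (N := N) (S := S) zero_le_one hε hδ.le).2.2
  have h3 : 3 * ∑ i, ∑ j, hn 1 (S i j) ≤ 3 / δ * energy 1 ε δ P N S := by
    rw [div_mul_eq_mul_div, le_div_iff₀ hδ]
    linarith
  rw [map_zero, zero_add]
  linarith

theorem sum_hsq_mul_self_le {M : ℝ} {f : Fin 3 → TF} (hf : ∀ a x, (f a).1 x ^ 2 ≤ M) :
    ∑ i, ∑ j, hsq (f i * f j) ≤ 4200 * M * vsq f := by
  have h1 : ∑ i, ∑ j, hsq (f i * f j) ≤ ∑ i, ∑ j, 700 * (M * hsq (f j) + M * hsq (f i)) :=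
    Finset.sum_le_sum fun i _ => Finset.sum_le_sum fun j _ => by
      have h2 := hn_mul_le zero_le_one (hf i) (hf j)
      have hM : 0 ≤ M := (sq_nonneg _).trans (hf 0 0)
      have h3 : M * d2sq (f i) ≤ M * hsq (f i) :=
        mul_le_mul_of_nonneg_left (le_add_of_nonneg_left (nsq_nonneg _)) hM
      rw [hn_one, hn_one, one_mul] at h2
      linarith
  refine h1.trans (le_of_eq ?_)
  simp only [vsq, Fin.sum_univ_three]
  ring

theorem vsq_le_energy {ε δ : ℝ} (hε : 0 ≤ ε) (hδ : 0 ≤ δ) {P : TF} {N : Fin 3 → TF}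
    {S : Fin 3 → Fin 3 → TF} : vsq N ≤ energy 1 ε δ P N S := by
  simpa only [hn_one, vsq] using (le_energy (P := P) (N := N) (S := S) zero_le_one hε hδ).2.1

section Translation

variable {O : Set ℝ} {F : ℝ → TF} {h t : ℝ}

theorem Smo.translate (hF : Smo O F) (h : ℝ) : Smo {t | t + h ∈ O} fun t => F (t + h) :=
  fun t ht x => by
    have h1 : ContDiff ℝ (⊤ : ℕ∞) fun q : ℝ × Spc 3 => (q.1 + h, q.2) :=
      (contDiff_fst.add contDiff_const).prodMk contDiff_snd
    exact ContDiffAt.comp (g := fun q : ℝ × Spc 3 => (F q.1).1 q.2) (t, x) (hF (t + h) ht x)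
      h1.contDiffAt

theorem Smo.ddt_translate (hF : Smo O F) (ht : t + h ∈ O) :
    NSRelax.ddt (fun t => F (t + h)) t = NSRelax.ddt F (t + h) :=
  (hF.translate h).ddt_eq ht fun x => (hF.hasDerivAt ht x).comp_add_const t h

end Translation

section Relaxation

variable {ε δ b M : ℝ} {O : Set ℝ} {P : ℝ → TF} {N : Fin 3 → ℝ → TF} {S : Fin 3 → Fin 3 → ℝ → TF}

theorem RelCurve.exists_vsq_le (h : RelCurve O ε δ P N S) (hO : IsOpen O) (hε : 0 < ε)
    (hδ : 0 < δ) (hb : Ioc 0 b ⊆ O) (hM : ∀ t ∈ Ioc 0 b, ∀ a x, (N a t).1 x ^ 2 ≤ M) :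
    ∃ K, 0 ≤ K ∧ ∀ t ∈ Ioc 0 b, vsq (fun a => N a t) ≤ K := by
  set y : ℝ → ℝ := fun t => energy 1 ε δ (P t) (fun a => N a t) fun i j => S i j t with hy
  have hy0 : ∀ t, 0 ≤ y t := fun t => energy_nonneg zero_le_one hε.le hδ.le
  refine ⟨exp (|3 / δ + 4200 * M| * b) * y b, mul_nonneg (exp_pos _).le (hy0 b), fun t ht => ?_⟩
  refine (vsq_le_energy (P := P t) (S := fun i j => S i j t) hε.le hδ.le).trans ?_
  have h1 : y t ≤ exp (|3 / δ + 4200 * M| * (b - t)) * y b := by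
    have hs : ∀ s ∈ Icc t b, s ∈ Ioc 0 b := fun s hs => ⟨ht.1.trans_le hs.1, hs.2⟩
    refine le_exp_mul_of_neg_deriv_le (fun s hs' => hasDerivAt_energy hO 1 ε δ h.smo_P h.smo_N
      h.smo_S (hb (hs s hs')) (h.mass s (hb (hs s hs'))) (h.momentum s (hb (hs s hs')))
      (h.stress s (hb (hs s hs')))) (fun s hs' => ?_) ht.2
    refine (neg_energy_rate_le (L := 4200 * M) hε.le hδ ?_).trans
      (mul_le_mul_of_nonneg_right (le_abs_self _) (hy0 s))
    have hM0 : 0 ≤ M := (sq_nonneg _).trans (hM s (hs s hs') 0 0)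
    exact (sum_hsq_mul_self_le (hM s (hs s hs'))).trans
      (mul_le_mul_of_nonneg_left (vsq_le_energy hε.le hδ.le) (by positivity))
  exact h1.trans (mul_le_mul_of_nonneg_right (exp_le_exp.2
    (mul_le_mul_of_nonneg_left (by linarith [ht.1]) (abs_nonneg _))) (hy0 b))

theorem RelCurve.exists_energy_increment_le (h : RelCurve O ε δ P N S) (hO : IsOpen O)
    (hε : 0 < ε) (hδ : 0 < δ) (hb : Ioc 0 b ⊆ O)
    (hM : ∀ t ∈ Ioc 0 b, ∀ a x, (N a t).1 x ^ 2 ≤ M) :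
    ∃ C, 0 ≤ C ∧ ∀ t ∈ Ioc 0 (b / 2), ∀ k ∈ Ioc 0 (b / 2),
      energy 1 ε δ (P (t + k) - P t) (fun a => N a (t + k) - N a t)
        (fun i j => S i j (t + k) - S i j t) ≤
      C * energy 1 ε δ (P (b / 2 + k) - P (b / 2)) (fun a => N a (b / 2 + k) - N a (b / 2))
        (fun i j => S i j (b / 2 + k) - S i j (b / 2)) := by
  obtain ⟨K, hK0, hK⟩ := h.exists_vsq_le hO hε hδ hb hM
  set L := 3 / δ + 1600000 * K with hL
  have hL0 : 0 ≤ L := by positivity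
  refine ⟨exp (L * (b / 2)), (exp_pos _).le, fun t ht k hk => ?_⟩
  set y : ℝ → ℝ := fun t => energy 1 ε δ (P (t + k) - P t) (fun a => N a (t + k) - N a t)
        (fun i j => S i j (t + k) - S i j t) with hy
  have hy0 : ∀ t, 0 ≤ y t := fun t => energy_nonneg zero_le_one hε.le hδ.le
  have hO' : IsOpen {t | t + k ∈ O} := hO.preimage (continuous_id.add continuous_const)
  have h1 : y t ≤ exp (L * (b / 2 - t)) * y (b / 2) := by
    have hs1 : ∀ s ∈ Icc t (b / 2), s ∈ Ioc 0 b := fun s hs =>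
      ⟨ht.1.trans_le hs.1, by linarith [hs.2, ht.1, ht.2]⟩
    have hs2 : ∀ s ∈ Icc t (b / 2), s + k ∈ Ioc 0 b := fun s hs =>
      ⟨by linarith [ht.1, hs.1, hk.1], by linarith [hs.2, hk.2]⟩
    have hsub : ∀ {F : ℝ → TF}, Smo O F → Smo (O ∩ {t | t + k ∈ O}) fun s => F (s + k) - F s :=
      fun hF => ((hF.translate k).mono inter_subset_right).sub (hF.mono inter_subset_left)
    have hdd : ∀ {F : ℝ → TF}, Smo O F → ∀ s ∈ O ∩ {t | t + k ∈ O},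
        ddt (fun s => F (s + k) - F s) s = ddt F (s + k) - ddt F s := fun hF s hs => by
      rw [ddt_sub ((hF.translate k).mono inter_subset_right) (hF.mono inter_subset_left) hs,
        hF.ddt_translate hs.2]
    refine le_exp_mul_of_neg_deriv_le (y' := fun s => 2 * (ip 1 (P (s + k) - P s) 0 +
      ∑ i, ∑ j, ip 1 (S i j (s + k) - S i j s)
        ((N i (s + k) * N j (s + k) - N i s * N j s) - (S i j (s + k) - S i j s))))
      (fun s hs => ?_) (fun s hs => ?_) ht.2
    · have hsO : s ∈ O ∩ {t | t + k ∈ O} := ⟨hb (hs1 s hs), hb (hs2 s hs)⟩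
      refine hasDerivAt_energy (hO.inter hO') 1 ε δ (hsub h.smo_P) (fun a => hsub (h.smo_N a))
        (fun i j => hsub (h.smo_S i j)) hsO ?_ (fun a => ?_) fun i j => ?_
      · have e1 := h.mass s hsO.1
        have e2 := h.mass (s + k) hsO.2
        rw [hdd h.smo_P s hsO]
        simp only [map_sub, Finset.sum_sub_distrib, smul_sub]
        rw [← sub_eq_zero.2 (e2.trans e1.symm)]
        abel
      · have e1 := h.momentum s hsO.1 a
        have e2 := h.momentum (s + k) hsO.2 a
        rw [hdd (h.smo_N a) s hsO]
        simp only [map_sub, Finset.sum_sub_distrib]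
        rw [← sub_eq_zero.2 (e2.trans e1.symm)]
        abel
      · have e1 := h.stress s hsO.1 i j
        have e2 := h.stress (s + k) hsO.2 i j
        rw [hdd (h.smo_S i j) s hsO]
        have e3 := congrArg₂ (· - ·) e2 e1
        simp only [map_sub, smul_sub]
        rw [sub_sub_sub_comm (N i (s + k) * _), ← e3]
        abel
    · refine neg_energy_rate_le hε.le hδ ?_
      have e1 := sum_hsq_add_le (fun i j => N i (s + k) * (N j (s + k) - N j s))
        fun i j => (N i (s + k) - N i s) * N j s
      have e2 := sum_hsq_mul_le (fun i => N i (s + k)) fun j => N j (s + k) - N j s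
      have e3 := sum_hsq_mul_le (fun j => N j (s + k) - N j s) fun i => N i s
      have e4 : vsq (fun j => N j (s + k) - N j s) ≤ y s := vsq_le_energy hε.le hδ.le
      have e5 := mul_le_mul (hK (s + k) (hs2 s hs)) e4 (vsq_nonneg _) hK0
      have e6 := mul_le_mul e4 (hK s (hs1 s hs)) (vsq_nonneg _) (hy0 s)
      have e7 : ∀ i j, N i (s + k) * (N j (s + k) - N j s) + (N i (s + k) - N i s) * N j s =
          N i (s + k) * N j (s + k) - N i s * N j s := fun i j => by ring
      simp only [e7] at e1
      have e8 : 0 ≤ K * y s := mul_nonneg hK0 (hy0 s)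
      refine e1.trans ?_
      show _ ≤ 1600000 * K * y s
      linarith
  exact h1.trans (mul_le_mul_of_nonneg_right (exp_le_exp.2
    (mul_le_mul_of_nonneg_left (by linarith [ht.1]) hL0)) (hy0 _))

/-- The curve is uniformly continuous in `H²` near the initial time. -/
def H2Cauchy (F : ℝ → TF) : Prop :=
  ∀ η > 0, ∃ k > 0, ∀ s t, 0 < s → s < t → t ≤ k → hsq (F t - F s) ≤ η

theorem h2Cauchy_of_increment {F : ℝ → TF} {y : ℝ → ℝ} {c r : ℝ} (hr : 0 < r) (hc : 0 < c)
    (hy : Tendsto y (𝓝[>] 0) (𝓝 0))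
    (h : ∀ t ∈ Ioc 0 r, ∀ k ∈ Ioc 0 r, c * hsq (F (t + k) - F t) ≤ y k) : H2Cauchy F := by
  intro η hη
  have h1 : ∀ᶠ k in 𝓝[>] (0 : ℝ), y k < c * η := hy.eventually (gt_mem_nhds (by positivity))
  obtain ⟨k₀, hk₀, hk⟩ := mem_nhdsGT_iff_exists_Ioc_subset.1 h1
  refine ⟨min k₀ r, lt_min hk₀ hr, fun s t hs hst ht => ?_⟩
  have h2 := h s ⟨hs, hst.le.trans (ht.trans (min_le_right _ _))⟩ (t - s)
    ⟨sub_pos.2 hst, by linarith [ht.trans (min_le_right _ _)]⟩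
  have h3 : y (t - s) < c * η := hk ⟨sub_pos.2 hst, by linarith [ht.trans (min_le_left _ _)]⟩
  rw [add_sub_cancel] at h2
  exact (lt_of_mul_lt_mul_left (h2.trans_lt h3) hc.le).le

theorem RelCurve.h2Cauchy (h : RelCurve O ε δ P N S) (hO : IsOpen O) (hε : 0 < ε) (hδ : 0 < δ)
    (hb0 : 0 < b) (hb : Ioc 0 b ⊆ O) (hM : ∀ t ∈ Ioc 0 b, ∀ a x, (N a t).1 x ^ 2 ≤ M) :
    H2Cauchy P ∧ (∀ a, H2Cauchy (N a)) ∧ ∀ i j, H2Cauchy (S i j) := by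
  obtain ⟨C, hC0, hC⟩ := h.exists_energy_increment_le hO hε hδ hb hM
  have hr : 0 < b / 2 := half_pos hb0
  have hbO : b / 2 ∈ O := hb ⟨hr, half_le_self hb0.le⟩
  have ht : ∀ {F : ℝ → TF}, Smo O F →
      Tendsto (fun k => hn 1 (F (b / 2 + k) - F (b / 2))) (𝓝[>] 0) (𝓝 0) := fun {F} hF => by
    have h1 := ((hF.sub (Smo.const (F (b / 2)))).continuousOn_hsq hO).continuousAt
      (hO.mem_nhds hbO)
    have h2 : Tendsto (fun k : ℝ => b / 2 + k) (𝓝[>] 0) (𝓝 (b / 2)) := by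
      have : Tendsto (fun k : ℝ => b / 2 + k) (𝓝 0) (𝓝 (b / 2 + 0)) :=
        (continuous_const.add continuous_id).tendsto 0
      rw [add_zero] at this
      exact this.mono_left nhdsWithin_le_nhds
    have h3 := h1.tendsto.comp h2
    simp only [sub_self] at h3
    have h4 : hsq (0 : TF) = 0 := by simp [hsq, nsq, d2sq]
    rw [h4] at h3
    simpa only [hn_one, Function.comp_def] using h3
  have hy : Tendsto (fun k => C * energy 1 ε δ (P (b / 2 + k) - P (b / 2))
      (fun a => N a (b / 2 + k) - N a (b / 2))
        (fun i j => S i j (b / 2 + k) - S i j (b / 2))) (𝓝[>] 0) (𝓝 0) := by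
    have h1 := (((ht h.smo_P).const_mul ε).add (tendsto_finsetSum Finset.univ fun a _ =>
      ht (h.smo_N a))).add ((tendsto_finsetSum Finset.univ fun i _ =>
        tendsto_finsetSum Finset.univ fun j _ => ht (h.smo_S i j)).const_mul δ)
    have h2 := h1.const_mul C
    simpa only [Finset.sum_const_zero, mul_zero, add_zero, energy] using h2
  refine ⟨h2Cauchy_of_increment hr hε hy fun t ht k hk => ?_,
    fun a => h2Cauchy_of_increment hr one_pos hy fun t ht k hk => ?_,
    fun i j => h2Cauchy_of_increment hr hδ hy fun t ht k hk => ?_⟩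
  · refine le_trans ?_ (hC t ht k hk)
    rw [← hn_one]
    exact (le_energy zero_le_one hε.le hδ.le).1
  · refine le_trans ?_ (hC t ht k hk)
    rw [← hn_one, one_mul]
    exact hn_le_energy (N := fun a => N a (t + k) - N a t) zero_le_one hε.le hδ.le a
  · refine le_trans ?_ (hC t ht k hk)
    rw [← hn_one]
    exact hn_stress_le_energy (S := fun i j => S i j (t + k) - S i j t) zero_le_one hε.le hδ.le i j

end Relaxation

end InitialTime

section StrongConvergence

open Set Filter Topology

/-- Right-continuity at the initial time with respect to the `H²` norm. -/
def H2Lim (F : ℝ → TF) : Prop := Tendsto (fun t => hsq (F t - F 0)) (𝓝[>] 0) (𝓝 0)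

theorem exists_ip_eq_integ (f : TF) : ∃ g : TF, ∀ h, ip 1 f h = integ (g * h) := by
  refine ⟨f + ∑ k, ∑ l, dx l (dx k (dx k (dx l f))), fun h => ?_⟩
  have h1 : ∀ k l, integ (dx k (dx l f) * dx k (dx l h)) =
      integ (dx l (dx k (dx k (dx l f))) * h) := fun k l => by
    rw [integ_mul_dx, integ_mul_dx, neg_neg]
  rw [ip_apply, one_mul, add_mul, map_add, Finset.sum_mul, map_sum, b2]
  congr 1
  refine Finset.sum_congr rfl fun k _ => ?_
  rw [Finset.sum_mul, map_sum]
  exact Finset.sum_congr rfl fun l _ => h1 k l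

theorem h2Lim_of_h2Cauchy {F : ℝ → TF} (hF : H2Cauchy F)
    (h : Tendsto (fun t => nsq (F t - F 0)) (𝓝[>] 0) (𝓝 0)) : H2Lim F := by
  have key : ∀ η > 0, ∃ k > 0, ∀ t, 0 < t → t ≤ k → hsq (F t - F 0) ≤ η := fun η hη => by
    obtain ⟨k, hk, hc⟩ := hF η hη
    refine ⟨k, hk, fun t ht htk => ?_⟩
    obtain ⟨g, hg⟩ := exists_ip_eq_integ (F t - F 0)
    have h1 : ∀ᶠ s in 𝓝[>] (0 : ℝ), hsq (F t - F 0) ≤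
        η + 2 * (√(nsq g) * √(nsq (F s - F 0))) := by
      filter_upwards [Ioo_mem_nhdsGT ht] with s hs
      have e1 := hc s t hs.1 hs.2 htk
      have e2 := hn_add_smul 1 (-1) (F t - F 0) (F s - F 0)
      have e3 : F t - F 0 + (-1 : ℝ) • (F s - F 0) = F t - F s := by
        rw [neg_one_smul]
        abel
      have e4 := (le_abs_self _).trans (abs_integ_mul_le g (F s - F 0))
      have e5 := hsq_nonneg (F s - F 0)
      rw [e3, hn_one, hn_one, hn_one, hg] at e2
      linarith
    have h2 : Tendsto (fun s => η + 2 * (√(nsq g) * √(nsq (F s - F 0)))) (𝓝[>] 0) (𝓝 η) := by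
      simpa using (((continuous_sqrt.tendsto _).comp h).const_mul (√(nsq g))).const_mul 2
        |>.const_add η
    exact ge_of_tendsto h2 h1
  refine tendsto_order.2 ⟨fun c hc => Eventually.of_forall fun t => hc.trans_le (hsq_nonneg _),
    fun c hc => ?_⟩
  obtain ⟨k, hk, hkc⟩ := key (c / 2) (half_pos hc)
  filter_upwards [Ioc_mem_nhdsGT hk] with t ht
  exact (hkc t ht.1 ht.2).trans_lt (half_lt_self hc)

section Closure

variable {F G : ℝ → TF}

theorem h2Lim_of_le {y : ℝ → ℝ} (hy : Tendsto y (𝓝[>] 0) (𝓝 0))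
    (h : ∀ t, hsq (F t - F 0) ≤ y t) : H2Lim F :=
  squeeze_zero (fun _ => hsq_nonneg _) h hy

theorem Smo.h2Lim (h : Smo univ F) : H2Lim F := by
  have h1 := ((h.sub (Smo.const (F 0))).continuousOn_hsq isOpen_univ).continuousAt
    (x := (0 : ℝ)) univ_mem
  have h2 : hsq (F 0 - F 0) = 0 := by simp [hsq, nsq, d2sq]
  rw [ContinuousAt, h2] at h1
  exact h1.mono_left nhdsWithin_le_nhds

theorem H2Lim.sub (hF : H2Lim F) (hG : H2Lim G) : H2Lim fun t => F t - G t := by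
  refine h2Lim_of_le (y := fun t => 2 * (hsq (F t - F 0) + hsq (G t - G 0))) ?_ fun t => ?_
  · simpa using (Tendsto.add hF hG).const_mul 2
  · rw [sub_sub_sub_comm]
    exact hsq_sub_le _ _

theorem H2Lim.smul (c : ℝ) (hF : H2Lim F) : H2Lim fun t => c • F t := by
  refine h2Lim_of_le (y := fun t => c ^ 2 * hsq (F t - F 0)) ?_ fun t => ?_
  · simpa using Tendsto.const_mul (c ^ 2) hF
  · rw [← smul_sub, hsq_smul]

theorem H2Lim.add (hF : H2Lim F) (hG : H2Lim G) : H2Lim fun t => F t + G t := by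
  simpa using hF.sub (hG.smul (-1))

theorem H2Lim.mul (hF : H2Lim F) (hG : H2Lim G) : H2Lim fun t => F t * G t := by
  refine h2Lim_of_le (y := fun t => 2 * (2 * (200000 * (hsq (F t - F 0) * hsq (G t - G 0)) +
    200000 * (hsq (F 0) * hsq (G t - G 0))) + 200000 * (hsq (F t - F 0) * hsq (G 0)))) ?_
      fun t => ?_
  · simpa using (((((Tendsto.mul hF hG).const_mul 200000).add
      ((Tendsto.const_mul (hsq (F 0)) hG).const_mul 200000)).const_mul 2).add
        ((Tendsto.mul_const (hsq (G 0)) hF).const_mul 200000)).const_mul 2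
  · have e : F t * G t - F 0 * G 0 = (F t - F 0) * (G t - G 0) + F 0 * (G t - G 0) +
        (F t - F 0) * G 0 := by ring
    have h1 := hsq_mul_le (F t - F 0) (G t - G 0)
    have h2 := hsq_mul_le (F 0) (G t - G 0)
    have h3 := hsq_mul_le (F t - F 0) (G 0)
    have h4 := hsq_add_le ((F t - F 0) * (G t - G 0)) (F 0 * (G t - G 0))
    have h5 := hsq_add_le ((F t - F 0) * (G t - G 0) + F 0 * (G t - G 0)) ((F t - F 0) * G 0)
    rw [e]
    linarith

theorem H2Lim.tendsto_ip {θ : ℝ} (hθ : 0 ≤ θ) (hθ1 : θ ≤ 1) (hF : H2Lim F) (hG : H2Lim G) :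
    Tendsto (fun t => ip θ (F t) (G t)) (𝓝[>] 0) (𝓝 (ip θ (F 0) (G 0))) := by
  have hb : ∀ f g : TF, |ip θ f g| ≤ √(hsq f) * √(hsq g) := fun f g =>
    (abs_ip_le hθ f g).trans (mul_le_mul (sqrt_le_sqrt (hn_le_hsq hθ1 f))
      (sqrt_le_sqrt (hn_le_hsq hθ1 g)) (sqrt_nonneg _) (sqrt_nonneg _))
  have hsF : Tendsto (fun t => √(hsq (F t - F 0))) (𝓝[>] 0) (𝓝 0) := by
    simpa [Function.comp_def] using (continuous_sqrt.tendsto _).comp hF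
  have hsG : Tendsto (fun t => √(hsq (G t - G 0))) (𝓝[>] 0) (𝓝 0) := by
    simpa [Function.comp_def] using (continuous_sqrt.tendsto _).comp hG
  rw [tendsto_iff_dist_tendsto_zero]
  refine squeeze_zero (fun _ => dist_nonneg) (g := fun t =>
    √(hsq (F t - F 0)) * √(hsq (G t - G 0)) + √(hsq (F 0)) * √(hsq (G t - G 0)) +
      √(hsq (G 0)) * √(hsq (F t - F 0))) (fun t => ?_) ?_
  · have e : ip θ (F t) (G t) - ip θ (F 0) (G 0) = ip θ (F t - F 0) (G t - G 0) +
        ip θ (F 0) (G t - G 0) + ip θ (G 0) (F t - F 0) := by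
      rw [ip_comm θ (F t - F 0), map_sub, map_sub, map_sub, ip_comm θ (G t - G 0) (F t),
        ip_comm θ (G t - G 0) (F 0), map_sub, map_sub, ip_comm θ (G 0) (F t),
        ip_comm θ (G 0) (F 0)]
      ring
    rw [dist_eq_norm, Real.norm_eq_abs, e]
    exact (abs_add_three _ _ _).trans (add_le_add (add_le_add (hb _ _) (hb _ _)) (hb _ _))
  · simpa using ((hsF.mul hsG).add (hsG.const_mul (√(hsq (F 0))))).add
      (hsF.const_mul (√(hsq (G 0))))

theorem H2Lim.tendsto_hn {θ : ℝ} (hθ : 0 ≤ θ) (hθ1 : θ ≤ 1) (hF : H2Lim F) :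
    Tendsto (fun t => hn θ (F t)) (𝓝[>] 0) (𝓝 (hn θ (F 0))) := by
  simpa only [ip_self] using hF.tendsto_ip hθ hθ1 hF

end Closure

section Continuity

variable {Tl : ℝ≥0∞} {f : ℝ → Spc 3 → ℝ}

theorem exists_mem_cube {g : Spc 3 → ℝ} (hg : Per g) (x : Spc 3) : ∃ y ∈ cube 3, g y = g x := by
  refine ⟨fun i => x i + ((-⌊x i⌋ : ℤ) : ℝ), fun i _ => ?_, hg x _⟩
  simp only [Int.cast_neg, mem_Icc]
  constructor <;> linarith [Int.floor_le (x i), (Int.lt_floor_add_one (x i)).le]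

theorem Icc_subset_Itv {b : ℝ} (hb : b ∈ Itv Tl) : Icc 0 b ⊆ Itv Tl := fun _ hs =>
  ⟨hs.1, (ENNReal.ofReal_le_ofReal hs.2).trans_lt hb.2⟩

theorem exists_sq_le_of_continuousOn
    (hc : ContinuousOn (fun q : ℝ × Spc 3 => f q.1 q.2) (Itv Tl ×ˢ univ))
    (hp : ∀ t ∈ Itv Tl, Per (f t)) {b : ℝ} (hb : b ∈ Itv Tl) :
    ∃ M, ∀ t ∈ Icc 0 b, ∀ x, f t x ^ 2 ≤ M := by
  obtain ⟨M, hM⟩ := (isCompact_Icc.prod isCompact_cube).exists_bound_of_continuousOn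
    ((hc.mono (prod_mono (Icc_subset_Itv hb) (subset_univ (cube 3)))))
  refine ⟨M ^ 2, fun t ht x => ?_⟩
  obtain ⟨y, hy, hyx⟩ := exists_mem_cube (hp t (Icc_subset_Itv hb ht)) x
  rw [← hyx]
  exact sq_le_sq' (neg_le_of_abs_le (hM (t, y) ⟨ht, hy⟩)) (le_of_abs_le (hM (t, y) ⟨ht, hy⟩))

theorem tendsto_nsq_toTF_sub
    (hc : ContinuousOn (fun q : ℝ × Spc 3 => f q.1 q.2) (Itv Tl ×ˢ univ))
    (hp : ∀ t ∈ Itv Tl, Per (f t)) (hv : ∀ t ∈ Itv Tl, (toTF (f t)).1 = f t) {b : ℝ}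
    (hb : b ∈ Itv Tl) (hb0 : 0 < b) :
    Tendsto (fun t => nsq (toTF (f t) - toTF (f 0))) (𝓝[>] 0) (𝓝 0) := by
  obtain ⟨M, hM⟩ := exists_sq_le_of_continuousOn hc hp hb
  have h0 : (0 : ℝ) ∈ Itv Tl := Icc_subset_Itv hb (left_mem_Icc.2 hb0.le)
  have h1 : Tendsto (fun t => ∫ x in cube 3, (toTF (f t) - toTF (f 0)).1 x ^ 2) (𝓝[>] 0)
      (𝓝 (∫ _ in cube 3, (0 : ℝ))) := by
    refine tendsto_integral_filter_of_dominated_convergence (fun _ => 4 * M) ?_ ?_ ?_ ?_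
    · exact Eventually.of_forall fun t => ((TF.continuous _).pow 2).aestronglyMeasurable
    · filter_upwards [Ioc_mem_nhdsGT hb0] with t ht
      refine Eventually.of_forall fun x => ?_
      have e1 := hM t ⟨ht.1.le, ht.2⟩ x
      have e2 := hM 0 (left_mem_Icc.2 hb0.le) x
      have e3 : (toTF (f t) - toTF (f 0)).1 x = f t x - f 0 x := by
        show (toTF (f t)).1 x - (toTF (f 0)).1 x = _
        rw [hv t (Icc_subset_Itv hb ⟨ht.1.le, ht.2⟩), hv 0 h0]
      rw [Real.norm_eq_abs, abs_of_nonneg (sq_nonneg _), e3]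
      nlinarith [sq_nonneg (f t x + f 0 x)]
    · exact (algebraMap ℝ TF (4 * M)).integrableOn
    · refine Eventually.of_forall fun x => ?_
      have e1 : Tendsto (fun t => f t x) (𝓝[Itv Tl] 0) (𝓝 (f 0 x)) := by
        have e2 : ContinuousOn (fun t => f t x) (Itv Tl) :=
          hc.comp (f := fun t : ℝ => (t, x)) (by fun_prop) fun t ht => ⟨ht, mem_univ x⟩
        exact e2 0 h0
      have e2 : Tendsto (fun t => f t x) (𝓝[>] 0) (𝓝 (f 0 x)) :=
        e1.mono_left (nhdsWithin_le_iff.2 (mem_of_superset (Ioc_mem_nhdsGT hb0) fun t ht =>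
          Icc_subset_Itv hb ⟨ht.1.le, ht.2⟩))
      have e3 : Tendsto (fun t => (f t x - f 0 x) ^ 2) (𝓝[>] 0) (𝓝 0) := by
        simpa using (e2.sub_const (f 0 x)).pow 2
      refine e3.congr' ?_
      filter_upwards [Ioc_mem_nhdsGT hb0] with t ht
      show _ = ((toTF (f t)).1 x - (toTF (f 0)).1 x) ^ 2
      rw [hv t (Icc_subset_Itv hb ⟨ht.1.le, ht.2⟩), hv 0 h0]
  rw [integral_zero] at h1
  refine h1.congr fun t => ?_
  rw [nsq, integ_def]
  refine integral_congr_ae (Eventually.of_forall fun x => ?_)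
  exact sq _

end Continuity

theorem IsRelax.h2Lim {ε δ : ℝ} {Tl : ℝ≥0∞} {p : ℝ → Spc 3 → ℝ} {u : ℝ → Spc 3 → Vec 3}
    {U : ℝ → Spc 3 → Fin 3 → Fin 3 → ℝ} (h : IsRelax 3 ε δ Tl p u U) (hε : 0 < ε) (hδ : 0 < δ) :
    H2Lim (fun t => toTF (p t)) ∧ (∀ a, H2Lim fun t => toTF fun x => u t x a) ∧
      ∀ i j, H2Lim fun t => toTF fun x => U t x i j := by
  obtain ⟨b, hb0, hbT⟩ : ∃ b : ℝ, 0 < b ∧ ENNReal.ofReal b < Tl := by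
    obtain ⟨r, hr0, hr⟩ := ENNReal.lt_iff_exists_real_btwn.1 h.pos
    exact ⟨r, ENNReal.ofReal_pos.1 hr.1, hr.2⟩
  have hb : b ∈ Itv Tl := ⟨hb0.le, hbT⟩
  have hbO : Ioc 0 b ⊆ Oitv Tl := fun t ht =>
    ⟨ht.1, (Icc_subset_Itv hb ⟨ht.1.le, ht.2⟩).2⟩
  have cp : ContinuousOn (fun q : ℝ × Spc 3 => p q.1 q.2) (Itv Tl ×ˢ univ) := h.cont.fst
  have cu : ∀ a, ContinuousOn (fun q : ℝ × Spc 3 => u q.1 q.2 a) (Itv Tl ×ˢ univ) := fun a =>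
    (continuous_apply a).comp_continuousOn h.cont.snd.fst
  have cU : ∀ i j, ContinuousOn (fun q : ℝ × Spc 3 => U q.1 q.2 i j) (Itv Tl ×ˢ univ) :=
    fun i j => (continuous_apply j).comp_continuousOn
      ((continuous_apply i).comp_continuousOn h.cont.snd.snd)
  have pu : ∀ a, ∀ t ∈ Itv Tl, Per fun x => u t x a := fun a t ht x k =>
    congrFun (h.per_u t ht x k) a
  have pU : ∀ i j, ∀ t ∈ Itv Tl, Per fun x => U t x i j := fun i j t ht x k =>
    congrFun (congrFun (h.per_U t ht x k) i) j
  choose M hM using fun a => exists_sq_le_of_continuousOn (cu a) (pu a) hb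
  obtain ⟨M', hM'⟩ := Finite.exists_le M
  obtain ⟨k1, k2, k3⟩ := h.relCurve.h2Cauchy (M := M') (isOpen_Oitv Tl) hε hδ hb0 hbO
    fun t ht a x => by
      rw [(h.toTF_val_Itv (Oitv_subset Tl (hbO ht))).2.1 a]
      exact (hM a t ⟨ht.1.le, ht.2⟩ x).trans (hM' a)
  exact ⟨h2Lim_of_h2Cauchy k1 (tendsto_nsq_toTF_sub cp h.per_p
      (fun t ht => (h.toTF_val_Itv ht).1) hb hb0),
    fun a => h2Lim_of_h2Cauchy (k2 a) (tendsto_nsq_toTF_sub (cu a) (pu a)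
      (fun t ht => (h.toTF_val_Itv ht).2.1 a) hb hb0),
    fun i j => h2Lim_of_h2Cauchy (k3 i j) (tendsto_nsq_toTF_sub (cU i j) (pU i j)
      (fun t ht => (h.toTF_val_Itv ht).2.2 i j) hb hb0)⟩

end StrongConvergence

section EnergyRate

open Set Filter Topology

variable {θ ε δ : ℝ} {p P : ℝ → TF} {u N : Fin 3 → ℝ → TF} {S : Fin 3 → Fin 3 → ℝ → TF}

/-- Time derivative of the residual energy. -/
def energyRate (θ ε δ : ℝ) (p P : ℝ → TF) (u N : Fin 3 → ℝ → TF) (S : Fin 3 → Fin 3 → ℝ → TF)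
    (t : ℝ) : ℝ :=
  2 * (ip θ (P t - p t) (-(ε • ddt p t)) + ∑ i, ∑ j, ip θ (S i j t - str u i j t)
    (u i t * (N j t - u j t) + (N i t - u i t) * u j t + (N i t - u i t) * (N j t - u j t) -
      (S i j t - str u i j t) - δ • ddt (str u i j) t))

theorem tendsto_residual_energy {I : Set ℝ} (hθ : 0 ≤ θ) (hθ1 : θ ≤ 1) (hN : NSCurve I p u)
    (hP : H2Lim P) (hu : ∀ a, H2Lim (N a)) (hS : ∀ i j, H2Lim (S i j)) :
    Tendsto (fun s => energy θ ε δ (P s - p s) (fun a => N a s - u a s)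
      fun i j => S i j s - str u i j s) (𝓝[>] 0) (𝓝 (energy θ ε δ (P 0 - p 0)
        (fun a => N a 0 - u a 0) fun i j => S i j 0 - str u i j 0)) := by
  unfold energy
  refine Tendsto.add (Tendsto.add (Tendsto.const_mul _ ?_) (tendsto_finsetSum _ fun a _ => ?_))
    (Tendsto.const_mul _ (tendsto_finsetSum _ fun i _ => tendsto_finsetSum _ fun j _ => ?_))
  · exact (hP.sub hN.smo_p.h2Lim).tendsto_hn hθ hθ1
  · exact ((hu a).sub (hN.smo_u a).h2Lim).tendsto_hn hθ hθ1
  · exact ((hS i j).sub (hN.smo_str i j).h2Lim).tendsto_hn hθ hθ1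

theorem tendsto_energyRate {I : Set ℝ} (hθ : 0 ≤ θ) (hθ1 : θ ≤ 1) (hN : NSCurve I p u)
    (hP : H2Lim P) (hu : ∀ a, H2Lim (N a)) (hS : ∀ i j, H2Lim (S i j)) :
    Tendsto (energyRate θ ε δ p P u N S) (𝓝[>] 0) (𝓝 (energyRate θ ε δ p P u N S 0)) := by
  have hv : ∀ a, H2Lim fun t => N a t - u a t := fun a => (hu a).sub (hN.smo_u a).h2Lim
  have hV : ∀ i j, H2Lim fun t => S i j t - str u i j t := fun i j =>
    (hS i j).sub (hN.smo_str i j).h2Lim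
  unfold energyRate
  refine Tendsto.const_mul _ (Tendsto.add ?_
    (tendsto_finsetSum _ fun i _ => tendsto_finsetSum _ fun j _ => ?_))
  · exact (hP.sub hN.smo_p.h2Lim).tendsto_ip hθ hθ1
      ((hN.smo_p.ddt isOpen_univ).smul ε).neg.h2Lim
  · exact (hV i j).tendsto_ip hθ hθ1 ((((((hN.smo_u i).h2Lim.mul (hv j)).add
      ((hv i).mul (hN.smo_u j).h2Lim)).add ((hv i).mul (hv j))).sub (hV i j)).sub
        (((hN.smo_str i j).ddt isOpen_univ).smul δ).h2Lim)

theorem hasDerivWithinAt_residual_energy_zero {I O : Set ℝ} (hθ : 0 ≤ θ) (hθ1 : θ ≤ 1)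
    (hO : IsOpen O) (hOI : O ∩ I ∈ 𝓝[>] 0) (hN : NSCurve I p u) (hR : RelCurve O ε δ P N S)
    (hP : H2Lim P) (hu : ∀ a, H2Lim (N a)) (hS : ∀ i j, H2Lim (S i j)) :
    HasDerivWithinAt (fun s => energy θ ε δ (P s - p s) (fun a => N a s - u a s)
      fun i j => S i j s - str u i j s) (energyRate θ ε δ p P u N S 0) (Ici 0) 0 := by
  have hd : ∀ t ∈ O ∩ I, HasDerivAt (fun s => energy θ ε δ (P s - p s) (fun a => N a s - u a s)
      fun i j => S i j s - str u i j s) (energyRate θ ε δ p P u N S t) t := fun t ht =>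
    hasDerivAt_residual_energy hO θ hN hR ht.1 ht.2
  refine hasDerivWithinAt_Ici_of_tendsto_deriv (s := O ∩ I ∩ Ioi 0)
    (fun t ht => (hd t ht.1).differentiableAt.differentiableWithinAt) ?_
    (inter_mem hOI self_mem_nhdsWithin) ?_
  · exact (tendsto_residual_energy hθ hθ1 hN hP hu hS).mono_left
      (nhdsWithin_mono _ inter_subset_right)
  · refine (tendsto_energyRate hθ hθ1 hN hP hu hS).congr' ?_
    filter_upwards [hOI] with t ht
    exact (hd t ht).deriv.symm

end EnergyRate

section Assembly

open Set Filter Topology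

theorem exists_hasDerivWithinAt_resEnergyL2_le {T₀ : ℝ≥0∞} (hT₀ : 0 < T₀)
    {p : ℝ → Spc 3 → ℝ} {u : ℝ → Spc 3 → Vec 3}
    (hNS : IsNS 3 {t : ℝ | 0 ≤ t ∧ ENNReal.ofReal t ≤ T₀} p u) {B : ℝ}
    (hB : ∀ t, 0 ≤ t → ENNReal.ofReal t ≤ T₀ →
      forcing (fun t => toTF (p t)) (fun a t => toTF fun x => u t x a) t ≤ B)
    {a ε δ : ℝ} (ha : 0 ≤ a) (hε : 0 < ε) (hδ : 0 < δ) (hεδ : ε + δ < 1) {Tl : ℝ≥0∞}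
    {pe : ℝ → Spc 3 → ℝ} {ue : ℝ → Spc 3 → Vec 3} {Ue : ℝ → Spc 3 → Fin 3 → Fin 3 → ℝ}
    (hR : IsRelax 3 ε δ Tl pe ue Ue) {t : ℝ} (ht : 0 ≤ t) (htT : ENNReal.ofReal t ≤ T₀)
    (htl : ENNReal.ofReal t < Tl) :
    ∃ E' : ℝ, HasDerivWithinAt (resEnergyL2 a ε δ p u pe ue Ue) E' (Ici t) t ∧
      (0 < t → HasDerivAt (resEnergyL2 a ε δ p u pe ue Ue) E' t) ∧
      E' ≤ (20 * √B + 20000000 * B + 20000000) *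
        (√((ε + δ) * resEnergyL2 a ε δ p u pe ue Ue t) + resEnergyL2 a ε δ p u pe ue Ue t +
          (ε + δ) ^ (-(3 * a / 4)) * resEnergyL2 a ε δ p u pe ue Ue t ^ 2) := by
  have h0 : 0 < ε + δ := add_pos hε hδ
  have hθ : 0 < (ε + δ) ^ a := rpow_pos_of_pos h0 a
  have hθ1 : (ε + δ) ^ a ≤ 1 := rpow_le_one h0.le hεδ.le ha
  have hC := hNS.nsCurve
  have hK := hR.relCurve
  have hE : ∀ s ∈ Itv Tl, resEnergyL2 a ε δ p u pe ue Ue s =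
      energy ((ε + δ) ^ a) ε δ (toTF (pe s) - toTF (p s))
        (fun b => (toTF fun x => ue s x b) - toTF fun x => u s x b)
        fun i j => (toTF fun x => Ue s x i j) - str (fun b t => toTF fun x => u t x b) i j s :=
    fun s hs =>
      have hv := hR.toTF_val_Itv hs
      resEnergyL2_eq (u' := fun b t => toTF fun x => u t x b) hε.le hδ.le
        (hNS.toTF_p.1 s (mem_univ s)) (fun b => (hNS.toTF_u b).1 s (mem_univ s)) hv.1 hv.2.1
          hv.2.2
  have htI : t ∈ Itv Tl := ⟨ht, htl⟩
  have hpos : 0 < t → HasDerivAt (resEnergyL2 a ε δ p u pe ue Ue) (energyRate ((ε + δ) ^ a) ε δ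
      (fun t => toTF (p t)) (fun t => toTF (pe t)) (fun a t => toTF fun x => u t x a)
      (fun a t => toTF fun x => ue t x a) (fun i j t => toTF fun x => Ue t x i j) t) t :=
    fun ht0 => (hasDerivAt_residual_energy (isOpen_Oitv Tl) _ hC hK ⟨ht0, htl⟩
      ⟨ht, htT⟩).congr_of_eventuallyEq (((isOpen_Oitv Tl).eventually_mem ⟨ht0, htl⟩).mono
        fun s hs => hE s (Oitv_subset Tl hs))
  refine ⟨energyRate ((ε + δ) ^ a) ε δ (fun t => toTF (p t)) (fun t => toTF (pe t))
    (fun a t => toTF fun x => u t x a) (fun a t => toTF fun x => ue t x a)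
    (fun i j t => toTF fun x => Ue t x i j) t, ?_, hpos, ?_⟩
  · rcases ht.eq_or_lt with rfl | ht0
    · obtain ⟨k1, k2, k3⟩ := hR.h2Lim hε hδ
      obtain ⟨r, hr0, hr⟩ := ENNReal.lt_iff_exists_real_btwn.1 (lt_min hR.pos hT₀)
      have hr1 : 0 < r := ENNReal.ofReal_pos.1 hr.1
      have hmem : ∀ s ∈ Ioc 0 r, s ∈ Oitv Tl ∩ {t : ℝ | 0 ≤ t ∧ ENNReal.ofReal t ≤ T₀} :=
        fun s hs => by
          have h1 := (ENNReal.ofReal_le_ofReal hs.2).trans_lt hr.2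
          exact ⟨⟨hs.1, h1.trans_le (min_le_left _ _)⟩,
            hs.1.le, (h1.trans_le (min_le_right _ _)).le⟩
      refine (hasDerivWithinAt_residual_energy_zero hθ.le hθ1 (isOpen_Oitv Tl)
        (mem_of_superset (Ioc_mem_nhdsGT hr1) hmem) hC hK k1 k2 k3).congr_of_eventuallyEq ?_
          (hE 0 htI)
      filter_upwards [Icc_mem_nhdsGE hr1] with s hs
      exact hE s ⟨hs.1, ((ENNReal.ofReal_le_ofReal hs.2).trans_lt hr.2).trans_le (min_le_left _ _)⟩
    · exact (hpos ht0).hasDerivWithinAt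
  · obtain ⟨f1, f2, f3⟩ := forcing_bounds (fun t => toTF (p t))
      (fun a t => toTF fun x => u t x a) t
    have hBt := hB t ht htT
    have key := energy_rate_le hθ hθ1 hε hδ (P := toTF (pe t) - toTF (p t))
      (N := fun b => (toTF fun x => ue t x b) - toTF fun x => u t x b)
      (S := fun i j => (toTF fun x => Ue t x i j) -
        str (fun b t => toTF fun x => u t x b) i j t)
      (fun b => (f1 b).trans hBt) (f2.trans hBt) fun i j => (f3 i j).trans hBt
    rw [hE t htI, show -(3 * a / 4) = a * -(3 / 4) by ring, rpow_mul h0.le]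
    exact key

end Assembly

/-- energy estimate (3.7) of the paper: differential inequality for
the `L²`-type energy of the rescaled residual. -/
theorem residual_energy_estimate_L2
    (T0 : ℝ≥0∞) (hT0 : 0 < T0)
    (p : ℝ → Spc 3 → ℝ) (u : ℝ → Spc 3 → Vec 3)
    (hNS : IsNS 3 {t : ℝ | 0 ≤ t ∧ ENNReal.ofReal t ≤ T0} p u)
    (pe : ℝ → ℝ → ℝ → Spc 3 → ℝ) (ue : ℝ → ℝ → ℝ → Spc 3 → Vec 3)
    (Ue : ℝ → ℝ → ℝ → Spc 3 → Fin 3 → Fin 3 → ℝ) (Tl : ℝ → ℝ → ℝ≥0∞)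
    (hRel : ∀ ε δ : ℝ, 0 < ε → 0 < δ →
      IsMaxRelax 3 ε δ (Tl ε δ) (pe ε δ) (ue ε δ) (Ue ε δ))
    (a : ℝ) (ha0 : 0 ≤ a) (ha2 : a < 4 / 3) :
    ∃ C > (0:ℝ), ∃ η > (0:ℝ), ∀ ε δ : ℝ, 0 < ε → 0 < δ → ε + δ < η →
      ∀ t : ℝ, 0 ≤ t → ENNReal.ofReal t ≤ T0 → ENNReal.ofReal t < Tl ε δ →
        ∃ E' : ℝ,
          HasDerivWithinAt
            (resEnergyL2 a ε δ p u (pe ε δ) (ue ε δ) (Ue ε δ)) E' (Set.Ici t) t ∧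
          (0 < t → HasDerivAt
            (resEnergyL2 a ε δ p u (pe ε δ) (ue ε δ) (Ue ε δ)) E' t) ∧
          E' ≤ C * (Real.sqrt ((ε + δ) *
                resEnergyL2 a ε δ p u (pe ε δ) (ue ε δ) (Ue ε δ) t)
              + resEnergyL2 a ε δ p u (pe ε δ) (ue ε δ) (Ue ε δ) t
              + (ε + δ) ^ (-(3 * a / 4)) *
                (resEnergyL2 a ε δ p u (pe ε δ) (ue ε δ) (Ue ε δ) t) ^ 2) := by
  obtain ⟨B, hB⟩ := hNS.nsCurve.forcing_bounded
  have hB0 : 0 ≤ B := ((hsq_nonneg _).trans ((forcing_bounds _ _ 0).1 0)).trans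
    (hB 0 le_rfl (by simp))
  exact ⟨20 * √B + 20000000 * B + 20000000, by positivity, 1, one_pos,
    fun ε δ hε hδ hεδ t ht htT htl =>
      exists_hasDerivWithinAt_resEnergyL2_le hT0 hNS hB ha0 hε hδ hεδ (hRel ε δ hε hδ).1 ht htT htl⟩

end NSRelax
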